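/- Let N ≥ 2 be an integer and y₁ < y₂ < ⋯ < y_{2N} be real numbers, and fix w ∈ (y₁, y₂) and x ∈ (y_{2N−1}, y_{2N}). Let h(·, t, s) (for y_{2N−1} < t < s < y_{2N}) and h̃(·, t, s) (for y₁ < t < s < y₂) be the unique holomorphic functions on ℍ solving the two mixed boundary-value problems described below, and define p(z, x) = lim_{(t,s)→(x,x)} Im h(z, t, s)/(s − t) and q(z, w) = lim_{(t,s)→(w,w)} Im h̃(z, t, s)/(s − t) for z ∈ ℍ (these limits exist). Then the limits lim_{ε→0⁺} p(w + iε, x)/ε and lim_{ε→0⁺} q(x + iε, w)/ε both exist and are equal. (Equivalently, with P_ℍ(z, x) := K·p(z, x) and P_ℍ(z, w) := K·q(z, w) for the same constant K > 0, the inward normal derivatives satisfy ∂ₙ P_ℍ(z, x)|_{z=w} = ∂ₙ P_ℍ(z, w)|_{z=x}.) -/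

import Mathlib

open Set Metric Filter Complex Topology

noncomputable section

/-- The open upper half-plane in `ℂ`. -/
def UHP : Set ℂ := {z | 0 < z.im}

/-- The mixed boundary-value problem for the holomorphic observable `h(·, t, s; y₁,…,y_{2N})`,
with the Dirichlet-1 window `(t,s)` contained in `(y_{2N-1}, y_{2N})`.
Boundary values are understood as limits within the upper half-plane. -/
def SolvesBVP (N : ℕ) (y : ℕ → ℝ) (t s : ℝ) (h : ℂ → ℂ) : Prop :=
  -- holomorphic on ℍ
  DifferentiableOn ℂ h UHP ∧
  -- (1) Re h = 0 on (-∞, y₁) ∪ (y_{2N}, +∞)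
  (∀ p : ℝ, (p < y 1 ∨ y (2 * N) < p) →
    Tendsto (fun z => (h z).re) (𝓝[UHP] (p : ℂ)) (𝓝 0)) ∧
  -- (2) Re h equals one common constant on all (y_{2i}, y_{2i+1}), 1 ≤ i ≤ N-1
  (∃ c : ℝ, ∀ i : ℕ, 1 ≤ i → i ≤ N - 1 → ∀ p ∈ Set.Ioo (y (2 * i)) (y (2 * i + 1)),
    Tendsto (fun z => (h z).re) (𝓝[UHP] (p : ℂ)) (𝓝 c)) ∧
  -- (3) Im h is constant on each (y_{2i-1}, y_{2i}), 1 ≤ i ≤ N-1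
  (∀ i : ℕ, 1 ≤ i → i ≤ N - 1 → ∃ c : ℝ, ∀ p ∈ Set.Ioo (y (2 * i - 1)) (y (2 * i)),
    Tendsto (fun z => (h z).im) (𝓝[UHP] (p : ℂ)) (𝓝 c)) ∧
  -- (4) Im h = 0 on (y₁,y₂) ∪ (y_{2N-1},t) ∪ (s,y_{2N}) and Im h = 1 on (t,s)
  (∀ p ∈ Set.Ioo (y 1) (y 2) ∪ Set.Ioo (y (2 * N - 1)) t ∪ Set.Ioo s (y (2 * N)),
    Tendsto (fun z => (h z).im) (𝓝[UHP] (p : ℂ)) (𝓝 0)) ∧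
  (∀ p ∈ Set.Ioo t s, Tendsto (fun z => (h z).im) (𝓝[UHP] (p : ℂ)) (𝓝 1)) ∧
  -- (5) Im h is bounded on ℍ and continuous up to cl(ℍ) \ {t, s}
  (∃ C : ℝ, ∀ z ∈ UHP, |(h z).im| ≤ C) ∧
  (∃ g : ℂ → ℝ, ContinuousOn g (closure UHP \ {(t : ℂ), (s : ℂ)}) ∧
    ∀ z ∈ UHP, g z = (h z).im)

/-- The mixed boundary-value problem for the holomorphic observable `h̃(·, t, s; y₁,…,y_{2N})`,
with the Dirichlet-1 window `(t,s)` contained in `(y₁, y₂)`. -/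
def SolvesBVP' (N : ℕ) (y : ℕ → ℝ) (t s : ℝ) (h : ℂ → ℂ) : Prop :=
  -- holomorphic on ℍ
  DifferentiableOn ℂ h UHP ∧
  -- (1) Re h̃ = 0 on (-∞, y₁) ∪ (y_{2N}, +∞)
  (∀ p : ℝ, (p < y 1 ∨ y (2 * N) < p) →
    Tendsto (fun z => (h z).re) (𝓝[UHP] (p : ℂ)) (𝓝 0)) ∧
  -- (2) Re h̃ equals one common constant on all (y_{2i}, y_{2i+1}), 1 ≤ i ≤ N-1
  (∃ c : ℝ, ∀ i : ℕ, 1 ≤ i → i ≤ N - 1 → ∀ p ∈ Set.Ioo (y (2 * i)) (y (2 * i + 1)),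
    Tendsto (fun z => (h z).re) (𝓝[UHP] (p : ℂ)) (𝓝 c)) ∧
  -- (3) Im h̃ is constant on each (y_{2i-1}, y_{2i}), 2 ≤ i ≤ N
  (∀ i : ℕ, 2 ≤ i → i ≤ N → ∃ c : ℝ, ∀ p ∈ Set.Ioo (y (2 * i - 1)) (y (2 * i)),
    Tendsto (fun z => (h z).im) (𝓝[UHP] (p : ℂ)) (𝓝 c)) ∧
  -- (4) Im h̃ = 0 on (y_{2N-1},y_{2N}) ∪ (y₁,t) ∪ (s,y₂) and Im h̃ = 1 on (t,s)
  (∀ p ∈ Set.Ioo (y (2 * N - 1)) (y (2 * N)) ∪ Set.Ioo (y 1) t ∪ Set.Ioo s (y 2),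
    Tendsto (fun z => (h z).im) (𝓝[UHP] (p : ℂ)) (𝓝 0)) ∧
  (∀ p ∈ Set.Ioo t s, Tendsto (fun z => (h z).im) (𝓝[UHP] (p : ℂ)) (𝓝 1)) ∧
  -- (5) Im h̃ is bounded on ℍ and continuous up to cl(ℍ) \ {t, s}
  (∃ C : ℝ, ∀ z ∈ UHP, |(h z).im| ≤ C) ∧
  (∃ g : ℂ → ℝ, ContinuousOn g (closure UHP \ {(t : ℂ), (s : ℂ)}) ∧
    ∀ z ∈ UHP, g z = (h z).im)

lemma isOpen_UHP : IsOpen UHP := isOpen_lt continuous_const Complex.continuous_im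

lemma convex_UHP : Convex ℝ UHP := by
  have : UHP = {z : ℂ | 0 < Complex.imCLM z} := rfl
  exact convex_halfSpace_im_gt 0

/-- Maximum principle for imaginary parts. -/
lemma max_principle_im (U : Set ℂ) (hU : IsOpen U) (hb : Bornology.IsBounded U)
    (hc : IsPreconnected U) (F : ℂ → ℂ) (hF : DifferentiableOn ℂ F U)
    (hfr : ∀ ζ ∈ frontier U, ∀ ε > 0, ∀ᶠ z in 𝓝[U] ζ, (F z).im ≤ ε) :
    ∀ z ∈ U, (F z).im ≤ 0 := by
  intro z0 hz0
  by_contra hpos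
  push Not at hpos
  set ε := (F z0).im / 2 with hε
  have hεpos : 0 < ε := by positivity
  set K := U ∩ {z | 2 * ε ≤ (F z).im} with hK
  have hKclosed : IsClosed K := by
    rw [← isSeqClosed_iff_isClosed]
    intro u a hu ha
    have haU : a ∈ closure U := mem_closure_of_tendsto ha (Eventually.of_forall fun n => (hu n).1)
    by_cases haU' : a ∈ U
    · refine ⟨haU', ?_⟩
      have hcont : ContinuousAt F a := (hF.differentiableAt (hU.mem_nhds haU')).continuousAt
      have := (Complex.continuous_im.continuousAt.tendsto.comp (hcont.tendsto.comp ha))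
      exact ge_of_tendsto this (Eventually.of_forall fun n => (hu n).2)
    · exfalso
      have hafr : a ∈ frontier U := by
        rw [hU.frontier_eq]; exact ⟨haU, haU'⟩
      have h1 := hfr a hafr ε hεpos
      have h2 : Tendsto u atTop (𝓝[U] a) :=
        tendsto_nhdsWithin_iff.2 ⟨ha, Eventually.of_forall fun n => (hu n).1⟩
      obtain ⟨n, hn⟩ := (h2.eventually h1).exists
      have := (hu n).2
      simp only [mem_ofPred_eq] at this
      linarith
  have hKcomp : IsCompact K :=
    Metric.isCompact_of_isClosed_isBounded hKclosed (hb.subset inter_subset_left)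
  have hKne : K.Nonempty := ⟨z0, hz0, by show 2 * ε ≤ (F z0).im; linarith⟩
  obtain ⟨z1, hz1, hmax⟩ := hKcomp.exists_isMaxOn hKne
    (f := fun z => (F z).im)
    ((Complex.continuous_im.comp_continuousOn (hF.continuousOn)).mono inter_subset_left)
  have hmaxU : ∀ z ∈ U, (F z).im ≤ (F z1).im := by
    intro z hz
    by_cases h : 2 * ε ≤ (F z).im
    · exact hmax ⟨hz, h⟩
    · push Not at h
      have := hz1.2
      simp only [mem_ofPred_eq] at this
      linarith
  have hnorm : ∀ z, ‖Complex.exp (-I * F z)‖ = Real.exp ((F z).im) := by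
    intro z; rw [Complex.norm_exp]; simp
  have hconst := Complex.norm_eqOn_of_isPreconnected_of_isMaxOn (f := fun z => Complex.exp (-I * F z))
    hc hU (by fun_prop) hz1.1 (by
      intro z hz
      simp only [mem_ofPred_eq, Function.comp]
      rw [hnorm, hnorm]
      exact Real.exp_le_exp.2 (hmaxU z hz))
  have hconst' : ∀ z ∈ U, (F z).im = (F z1).im := by
    intro z hz
    have := hconst hz
    simp only [Function.comp, Function.const] at this
    rw [hnorm, hnorm] at this
    exact Real.exp_injective this
  have hfrne : (frontier U).Nonempty := by
    rw [nonempty_iff_ne_empty]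
    intro h
    have hcl : IsClopen U := isClopen_iff_frontier_eq_empty.2 h
    rcases isClopen_iff.1 hcl with h | h
    · rw [h] at hz0; exact hz0
    · rw [h] at hb
      exact NormedSpace.unbounded_univ ℝ ℂ hb
  obtain ⟨ζ, hζ⟩ := hfrne
  have : (𝓝[U] ζ).NeBot := mem_closure_iff_nhdsWithin_neBot.1 (frontier_subset_closure hζ)
  obtain ⟨z, hz, hz'⟩ := ((hfr ζ hζ ε hεpos).and self_mem_nhdsWithin).exists
  have := hz1.2
  simp only [mem_ofPred_eq] at this
  linarith [hconst' z hz']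

/-- Gluing along the real line. -/
lemma glue_real (c : ℂ) (r : ℝ) (f : ℂ → ℂ) (hf : ContinuousOn f (ball c r))
    (hd : ∀ z ∈ ball c r, z.im ≠ 0 → DifferentiableAt ℂ f z) :
    DifferentiableOn ℂ f (ball c r) := by
  have key : ∀ z w : ℂ, Rectangle z w ⊆ ball c r → (0 ≤ z.im ∧ 0 ≤ w.im) ∨ (z.im ≤ 0 ∧ w.im ≤ 0) →
      (∫ x : ℝ in z.re..w.re, f (x + z.im * I)) - (∫ x : ℝ in z.re..w.re, f (x + w.im * I)) +
      I • (∫ y : ℝ in z.im..w.im, f (re w + y * I)) -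
      I • (∫ y : ℝ in z.im..w.im, f (re z + y * I)) = 0 := by
    intro z w hzw hs
    apply integral_boundary_rect_eq_zero_of_continuousOn_of_differentiableOn f z w (hf.mono hzw)
    intro x hx
    have hxb : x ∈ ball c r := by
      apply hzw
      refine ⟨?_, ?_⟩
      · exact Ioo_subset_Icc_self hx.1
      · exact Ioo_subset_Icc_self hx.2
    refine (hd x hxb ?_).differentiableWithinAt
    have h2 : x.im ∈ Ioo (min z.im w.im) (max z.im w.im) := hx.2
    rcases hs with ⟨h3, h4⟩ | ⟨h3, h4⟩
    · have := le_min h3 h4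
      exact (this.trans_lt h2.1).ne'
    · have := max_le h3 h4
      exact (h2.2.trans_le this).ne
  have hcons : IsConservativeOn f (ball c r) := by
    intro z w hzw
    rw [← add_eq_zero_iff_eq_neg, wedgeIntegral_add_wedgeIntegral_eq]
    by_cases hs : (0 ≤ z.im ∧ 0 ≤ w.im) ∨ (z.im ≤ 0 ∧ w.im ≤ 0)
    · exact key z w hzw hs
    · have h0 : (0:ℝ) ∈ uIcc (z.im) (w.im) := by
        rw [mem_uIcc]
        push Not at hs
        rcases le_total 0 z.im with h | h
        · right; exact ⟨(hs.1 h).le, h⟩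
        · left; exact ⟨h, (hs.2 h).le⟩
      have hsub1 : uIcc (z.im) (0) ⊆ uIcc (z.im) (w.im) := uIcc_subset_uIcc_left h0
      have hsub2 : uIcc (0) (w.im) ⊆ uIcc (z.im) (w.im) := uIcc_subset_uIcc_right h0
      have k1 := key z ⟨w.re, 0⟩ (by
        refine Subset.trans ?_ hzw
        rintro x ⟨hx1, hx2⟩
        exact ⟨hx1, hsub1 hx2⟩) (by
        rcases le_total 0 z.im with h | h
        · exact Or.inl ⟨h, le_rfl⟩
        · exact Or.inr ⟨h, le_rfl⟩)
      have k2 := key ⟨z.re, 0⟩ w (by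
        refine Subset.trans ?_ hzw
        rintro x ⟨hx1, hx2⟩
        exact ⟨hx1, hsub2 hx2⟩) (by
        rcases le_total 0 w.im with h | h
        · exact Or.inl ⟨le_rfl, h⟩
        · exact Or.inr ⟨le_rfl, h⟩)
      have hvert : ∀ a ∈ uIcc (z.re) (w.re), ∀ p q : ℝ, uIcc (p) (q) ⊆ uIcc (z.im) (w.im) →
          IntervalIntegrable (fun y : ℝ => f (a + y * I)) MeasureTheory.volume p q := by
        intro a ha p q hpq
        apply ContinuousOn.intervalIntegrable
        refine hf.comp (by fun_prop) ?_
        intro y hy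
        apply hzw
        exact ⟨by simpa using ha, by simpa using hpq hy⟩
      have e1 := intervalIntegral.integral_add_adjacent_intervals
        (hvert w.re right_mem_uIcc z.im 0 hsub1) (hvert w.re right_mem_uIcc 0 w.im hsub2)
      have e2 := intervalIntegral.integral_add_adjacent_intervals
        (hvert z.re left_mem_uIcc z.im 0 hsub1) (hvert z.re left_mem_uIcc 0 w.im hsub2)
      rw [← e1, ← e2]
      simp only [smul_eq_mul] at *
      linear_combination k1 + k2
  exact (hcons.isExactOn_ball hf).differentiableOn isOpen_ball

/-- half ball -/
def HB (a r : ℝ) : Set ℂ := ball (a : ℂ) r ∩ UHP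

lemma isOpen_HB (a r : ℝ) : IsOpen (HB a r) := isOpen_ball.inter isOpen_UHP
lemma convex_HB (a r : ℝ) : Convex ℝ (HB a r) := (convex_ball _ _).inter convex_UHP

lemma HB_mem_nhdsWithin {a r x : ℝ} (h : |x - a| < r) : HB a r ∈ 𝓝[UHP] (x : ℂ) := by
  unfold HB
  rw [inter_comm]
  apply inter_mem self_mem_nhdsWithin
  apply mem_nhdsWithin_of_mem_nhds
  apply isOpen_ball.mem_nhds
  rw [mem_ball, Complex.dist_eq, ← Complex.ofReal_sub, Complex.norm_real]
  exact h

instance nhdsWithin_UHP_neBot (x : ℝ) : (𝓝[UHP] (x : ℂ)).NeBot := by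
  rw [← mem_closure_iff_nhdsWithin_neBot]
  have : closure UHP = {z : ℂ | 0 ≤ z.im} := Complex.closure_setOfPred_lt_im 0
  rw [this]; simp

lemma mem_HB_of_box {x0 ρ : ℝ} {z : ℂ} (hz : z ∈ UHP) (h1 : |z.re - x0| ≤ ρ)
    (h2 : z.im < ρ) (hρ : 0 < ρ) : z ∈ HB x0 (2 * ρ) := by
  refine ⟨?_, hz⟩
  rw [mem_ball, Complex.dist_eq]
  have hz' : 0 < z.im := hz
  calc ‖z - x0‖ ≤ |(z - x0).re| + |(z - x0).im| := Complex.norm_le_abs_re_add_abs_im _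
    _ < 2 * ρ := by
      simp only [sub_re, ofReal_re, sub_im, ofReal_im, sub_zero]
      rw [abs_of_pos hz']; linarith

lemma box_bound (x0 ρ M : ℝ) (hρ : 0 < ρ) (f : ℂ → ℂ) (hf : DifferentiableOn ℂ f (HB x0 (2 * ρ)))
    (hM : ∀ z ∈ HB x0 (2 * ρ), (f z).im ≤ M) (hM0 : 0 ≤ M)
    (hlim : ∀ x : ℝ, x ≠ x0 → |x - x0| < 2 * ρ →
      Tendsto (fun z => (f z).im) (𝓝[UHP] (x : ℂ)) (𝓝 0)) :
    ∀ z ∈ UHP, |z.re - x0| < ρ → z.im < ρ / 2 →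
      (f z).im ≤ 4 * M / ρ ^ 2 * ((z.re - x0) ^ 2 - z.im ^ 2 + ρ * z.im) := by
  set A := 4 * M / ρ ^ 2 with hA
  have hA0 : 0 ≤ A := by positivity
  have hAρ : A * ρ ^ 2 = 4 * M := by rw [hA]; field_simp
  set U : Set ℂ := Ioo (x0 - ρ) (x0 + ρ) ×ℂ Ioo 0 (ρ / 2) with hU
  have hUopen : IsOpen U := isOpen_Ioo.reProdIm isOpen_Ioo
  have hUb : Bornology.IsBounded U := (Metric.isBounded_Ioo _ _).reProdIm (Metric.isBounded_Ioo _ _)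
  have hUc : IsPreconnected U := by
    have h1 : Convex ℝ U := by
      rw [hU]
      exact ((convex_Ioo (x0 - ρ) (x0 + ρ)).is_linear_preimage Complex.reLm.isLinear).inter
        ((convex_Ioo 0 (ρ / 2)).is_linear_preimage Complex.imLm.isLinear)
    exact h1.isPreconnected
  have hUsub : U ⊆ HB x0 (2 * ρ) := by
    rintro z ⟨h1, h2⟩
    simp only [mem_preimage, mem_Ioo] at h1 h2
    exact mem_HB_of_box h2.1 (by rw [abs_le]; constructor <;> linarith) (by linarith) hρ
  have hUUHP : U ⊆ UHP := fun z hz => (hUsub hz).2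
  -- main estimate with a logarithmic term
  have main : ∀ ε > 0, ∀ z ∈ U,
      (f z).im ≤ A * ((z.re - x0) ^ 2 - z.im ^ 2 + ρ * z.im)
        + ε * (Real.log (2 * ρ) - Real.log ‖z - x0‖) := by
    intro ε hε
    set F : ℂ → ℂ := fun z => f z - A * (I * (z - x0) ^ 2 + ρ * (z - x0))
      + ε * I * (Complex.log (z - x0) - Real.log (2 * ρ)) with hF
    have hFim : ∀ z, (F z).im = (f z).im - A * ((z.re - x0) ^ 2 - z.im ^ 2 + ρ * z.im)
        + ε * (Real.log ‖z - x0‖ - Real.log (2 * ρ)) := by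
      intro z
      simp only [hF, pow_two]
      simp [Complex.log_re]
    have hFd : DifferentiableOn ℂ F U := by
      have h1 : DifferentiableOn ℂ f U := hf.mono hUsub
      have h2 : DifferentiableOn ℂ (fun z : ℂ => Complex.log (z - x0)) U := by
        intro z hz
        apply DifferentiableAt.differentiableWithinAt
        apply DifferentiableAt.clog (by fun_prop)
        right
        have : 0 < z.im := hUUHP hz
        simp [this.ne']
      fun_prop
    have := max_principle_im U hUopen hUb hUc F hFd ?_
    · intro z hz
      have h := this z hz
      rw [hFim] at h
      nlinarith [h]
    intro ζ hζ ε' hε'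
    rw [hUopen.frontier_eq, hU, Complex.closure_reProdIm, closure_Ioo (by linarith),
      closure_Ioo (by linarith)] at hζ
    obtain ⟨⟨⟨h1, h2⟩, h3, h4⟩, h5⟩ := hζ
    have hlog : ∀ z ∈ U, Real.log ‖z - x0‖ - Real.log (2 * ρ) ≤ 0 := by
      intro z hz
      have hz1 := (hUsub hz).1
      rw [mem_ball, Complex.dist_eq] at hz1
      have hne : z - x0 ≠ 0 := by
        intro h0
        have : 0 < z.im := hUUHP hz
        have h6 : (z - x0).im = 0 := by rw [h0]; simp
        simp at h6; linarith
      have := Real.log_le_log (norm_pos_iff.2 hne) hz1.le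
      linarith
    have hBnonneg : ∀ z ∈ U, 0 ≤ (z.re - x0) ^ 2 - z.im ^ 2 + ρ * z.im := by
      rintro z ⟨-, hz⟩
      simp only [mem_preimage, mem_Ioo] at hz
      nlinarith [sq_nonneg (z.re - x0)]
    by_cases hζreal : ζ.im = 0 ∧ |ζ.re - x0| < ρ
    · obtain ⟨hi, ha⟩ := hζreal
      have hζ' : ζ = (ζ.re : ℂ) := by apply Complex.ext <;> simp [hi]
      by_cases hζx : ζ.re = x0
      · -- the exceptional point
        have hζ0 : ζ = (x0 : ℂ) := by rw [hζ', hζx]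
        have hlogt : Tendsto (fun z : ℂ => Real.log ‖z - x0‖) (𝓝[U] ζ) atBot := by
          apply Real.tendsto_log_nhdsGT_zero.comp
          rw [tendsto_nhdsWithin_iff]
          constructor
          · have : Tendsto (fun z : ℂ => ‖z - x0‖) (𝓝 ζ) (𝓝 ‖ζ - x0‖) := by
              apply Continuous.tendsto; fun_prop
            rw [hζ0] at this ⊢
            simp only [sub_self, norm_zero] at this
            exact this.mono_left nhdsWithin_le_nhds
          · filter_upwards [self_mem_nhdsWithin] with z hz
            have hne : z - x0 ≠ 0 := by
              intro h0
              have : 0 < z.im := hUUHP hz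
              have h6 : (z - x0).im = 0 := by rw [h0]; simp
              simp at h6; linarith
            exact norm_pos_iff.2 hne
        filter_upwards [hlogt.eventually_le_atBot (Real.log (2 * ρ) - M / ε), self_mem_nhdsWithin]
          with z hz1 hz2
        rw [hFim]
        have h7 := hM z (hUsub hz2)
        have h8 := mul_nonneg hA0 (hBnonneg z hz2)
        have h9 : ε * (Real.log ‖z - x0‖ - Real.log (2 * ρ)) ≤ ε * (- (M / ε)) := by
          apply mul_le_mul_of_nonneg_left _ hε.le; linarith
        have h10 : ε * (-(M / ε)) = -M := by field_simp
        linarith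
      · have := (hlim ζ.re hζx (by linarith)).eventually (gt_mem_nhds hε')
        rw [← hζ'] at this
        filter_upwards [nhdsWithin_mono ζ hUUHP this, self_mem_nhdsWithin] with z hz1 hz2
        rw [hFim]
        have h8 := mul_nonneg hA0 (hBnonneg z hz2)
        have h9 := mul_nonneg hε.le (neg_nonneg.2 (hlog z hz2))
        nlinarith
    · have hBζ : M ≤ A * ((ζ.re - x0) ^ 2 - ζ.im ^ 2 + ρ * ζ.im) := by
        by_cases hside : |ζ.re - x0| < ρ
        · have hi : ζ.im ≠ 0 := fun h => hζreal ⟨h, hside⟩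
          have hi' : 0 < ζ.im := lt_of_le_of_ne h3 (Ne.symm hi)
          have : ζ.im = ρ / 2 := by
            by_contra hne
            have hlt : ζ.im < ρ / 2 := lt_of_le_of_ne h4 hne
            apply h5
            rw [abs_lt] at hside
            exact ⟨⟨by linarith, by linarith⟩, hi', hlt⟩
          rw [this]
          have : A * ρ ^ 2 / 4 ≤ A * ((ζ.re - x0) ^ 2 - (ρ / 2) ^ 2 + ρ * (ρ / 2)) := by
            have := mul_nonneg hA0 (sq_nonneg (ζ.re - x0))
            nlinarith
          linarith
        · push Not at hside
          have h6 : ρ ^ 2 ≤ (ζ.re - x0) ^ 2 := by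
            rw [← sq_abs (ζ.re - x0)]; gcongr
          have h7 : ρ ^ 2 / 4 ≤ (ζ.re - x0) ^ 2 - ζ.im ^ 2 + ρ * ζ.im := by nlinarith
          have := mul_le_mul_of_nonneg_left h7 hA0
          linarith
      have hcont : Tendsto (fun z : ℂ => M - A * ((z.re - x0) ^ 2 - z.im ^ 2 + ρ * z.im)) (𝓝 ζ)
          (𝓝 (M - A * ((ζ.re - x0) ^ 2 - ζ.im ^ 2 + ρ * ζ.im))) := by
        apply Continuous.tendsto (f := fun z : ℂ => M - A * ((z.re - x0) ^ 2 - z.im ^ 2 + ρ * z.im))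
        fun_prop
      have hev := hcont.eventually (gt_mem_nhds (show _ < ε' by linarith))
      filter_upwards [nhdsWithin_le_nhds hev, self_mem_nhdsWithin] with z hz1 hz2
      rw [hFim]
      have h7 := hM z (hUsub hz2)
      have h9 := mul_nonneg hε.le (neg_nonneg.2 (hlog z hz2))
      nlinarith
  intro z hz h1 h2
  have hzU : z ∈ U := by
    rw [abs_lt] at h1
    exact ⟨⟨by linarith, by linarith⟩, hz, h2⟩
  have ht : Tendsto (fun ε : ℝ => A * ((z.re - x0) ^ 2 - z.im ^ 2 + ρ * z.im)
        + ε * (Real.log (2 * ρ) - Real.log ‖z - x0‖)) (𝓝[>] 0)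
      (𝓝 (A * ((z.re - x0) ^ 2 - z.im ^ 2 + ρ * z.im)
        + 0 * (Real.log (2 * ρ) - Real.log ‖z - x0‖))) := by
    apply Tendsto.mono_left _ nhdsWithin_le_nhds
    apply Continuous.tendsto (f := fun ε : ℝ => A * ((z.re - x0) ^ 2 - z.im ^ 2 + ρ * z.im)
        + ε * (Real.log (2 * ρ) - Real.log ‖z - x0‖))
    fun_prop
  rw [zero_mul, add_zero] at ht
  refine ge_of_tendsto ht ?_
  filter_upwards [self_mem_nhdsWithin] with ε hε
  exact main ε hε z hzU

lemma box_bound_abs (x0 ρ M : ℝ) (hρ : 0 < ρ) (f : ℂ → ℂ)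
    (hf : DifferentiableOn ℂ f (HB x0 (2 * ρ)))
    (hM : ∀ z ∈ HB x0 (2 * ρ), |(f z).im| ≤ M) (hM0 : 0 ≤ M)
    (hlim : ∀ x : ℝ, x ≠ x0 → |x - x0| < 2 * ρ →
      Tendsto (fun z => (f z).im) (𝓝[UHP] (x : ℂ)) (𝓝 0)) :
    ∀ z ∈ UHP, |z.re - x0| < ρ → z.im < ρ / 2 →
      |(f z).im| ≤ 4 * M / ρ ^ 2 * ((z.re - x0) ^ 2 - z.im ^ 2 + ρ * z.im) := by
  intro z hz h1 h2
  rw [abs_le]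
  have a1 := box_bound x0 ρ M hρ f hf (fun z hz => (abs_le.1 (hM z hz)).2) hM0 hlim z hz h1 h2
  have a2 := box_bound x0 ρ M hρ (fun z => - f z) hf.neg
    (fun z hz => by have := (abs_le.1 (hM z hz)).1; simp; linarith) hM0
    (fun x hx hx' => by simpa using (hlim x hx hx').neg) z hz h1 h2
  simp only [neg_im] at a2
  constructor <;> linarith

/-- Bounded imaginary part with zero boundary values except at the centre: also zero there. -/
lemma im_tendsto_center (a r M : ℝ) (hr : 0 < r) (f : ℂ → ℂ)
    (hf : DifferentiableOn ℂ f (HB a r)) (hM : ∀ z ∈ HB a r, |(f z).im| ≤ M) (hM0 : 0 ≤ M)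
    (hlim : ∀ x : ℝ, x ≠ a → |x - a| < r →
      Tendsto (fun z => (f z).im) (𝓝[UHP] (x : ℂ)) (𝓝 0)) :
    Tendsto (fun z => (f z).im) (𝓝[UHP] (a : ℂ)) (𝓝 0) := by
  have e : 2 * (r / 2) = r := by ring
  have key := box_bound_abs a (r / 2) M (by positivity) f (by rwa [e]) (by rwa [e]) hM0 (by rwa [e])
  have ht : Tendsto (fun z : ℂ => 4 * M / (r / 2) ^ 2 * ((z.re - a) ^ 2 - z.im ^ 2 + (r / 2) * z.im))
      (𝓝[UHP] (a : ℂ)) (𝓝 0) := by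
    have : Continuous (fun z : ℂ => 4 * M / (r / 2) ^ 2 * ((z.re - a) ^ 2 - z.im ^ 2 + (r / 2) * z.im)) := by
      fun_prop
    have := this.tendsto (a : ℂ)
    simp at this
    exact this.mono_left nhdsWithin_le_nhds
  apply squeeze_zero_norm' _ ht
  have hb : ball (a : ℂ) (r / 4) ∈ 𝓝[UHP] (a : ℂ) :=
    mem_nhdsWithin_of_mem_nhds (ball_mem_nhds _ (by positivity))
  filter_upwards [hb, self_mem_nhdsWithin] with z hz hz'
  rw [mem_ball, Complex.dist_eq] at hz
  have h1 := (Complex.abs_re_le_norm (z - a)).trans_lt hz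
  have h2 := (Complex.abs_im_le_norm (z - a)).trans_lt hz
  simp at h1 h2
  exact key z hz' (by linarith) (by linarith [le_abs_self z.im])

/-- Derivative bound by the imaginary part. -/
lemma deriv_bound_im (c : ℂ) (R M : ℝ) (hR : 0 < R) (hM : 0 < M) (f : ℂ → ℂ)
    (hf : DifferentiableOn ℂ f (ball c R)) (hb : ∀ z ∈ ball c R, |(f z).im| ≤ M) :
    ‖deriv f c‖ ≤ 8 * M / R := by
  set g : ℂ → ℂ := fun z => I * (f (c + z) - f c) with hg
  have hmaps : ∀ z ∈ ball (0:ℂ) R, c + z ∈ ball c R := by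
    intro z hz; simpa [mem_ball, Complex.dist_eq] using hz
  have hgd : DifferentiableOn ℂ g (ball 0 R) := by
    have : DifferentiableOn ℂ (fun z => f (c + z)) (ball 0 R) :=
      hf.comp (by fun_prop) hmaps
    exact (this.sub_const _).const_mul I
  have hgb : ∀ z ∈ ball (0:ℂ) R, ‖g z‖ ≤ 2 * (2 * M) * ‖z‖ / (R - ‖z‖) := by
    intro z hz
    apply Complex.borelCaratheodory_zero (by positivity) hgd _ hR hz (by simp [hg])
    intro z hz
    have h1 := hb _ (hmaps z hz)
    have h2 := hb c (mem_ball_self hR)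
    rw [abs_le] at h1 h2
    simp [hg]
    linarith
  have hd : ‖deriv f c‖ ≤ (4 * M) / (R / 2) := by
    have hder : deriv (fun z => f z - f c) c = deriv f c := by simp
    rw [← hder]
    apply Complex.norm_deriv_le_of_forall_mem_sphere_norm_le (by positivity)
    · apply DifferentiableOn.diffContOnCl
      rw [closure_ball _ (by positivity)]
      exact (hf.mono (closedBall_subset_ball (by linarith))).sub_const _
    · intro z hz
      have hz' : ‖z - c‖ = R / 2 := by simpa [Complex.dist_eq] using hz
      have := hgb (z - c) (by simp [hz']; linarith)
      rw [hz'] at this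
      have e : ‖g (z - c)‖ = ‖f z - f c‖ := by simp [hg]
      rw [e] at this
      refine this.trans (le_of_eq ?_)
      field_simp
      ring
  refine hd.trans (le_of_eq ?_)
  field_simp; ring

lemma mem_UHP {z : ℂ} : z ∈ UHP ↔ 0 < z.im := Iff.rfl

lemma mem_HB {a r : ℝ} {z : ℂ} : z ∈ HB a r ↔ ‖z - a‖ < r ∧ 0 < z.im := by
  unfold HB UHP; rw [mem_inter_iff, mem_ball, Complex.dist_eq]; rfl

lemma HB_mono {a r r' : ℝ} (h : r ≤ r') : HB a r ⊆ HB a r' := by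
  intro z hz; rw [mem_HB] at *; exact ⟨hz.1.trans_le h, hz.2⟩

lemma HB_subset_UHP {a r : ℝ} : HB a r ⊆ UHP := fun _ hz => hz.2

lemma conj_mem_ball_real {a r : ℝ} {z : ℂ} (hz : z ∈ ball (a:ℂ) r) :
    (starRingEnd ℂ) z ∈ ball (a:ℂ) r := by
  rw [mem_ball, Complex.dist_eq] at *
  have : (starRingEnd ℂ) z - a = (starRingEnd ℂ) (z - a) := by simp
  rw [this, Complex.norm_conj]; exact hz

lemma differentiableAt_conj_conj {f : ℂ → ℂ} {z : ℂ}
    (hf : DifferentiableAt ℂ f ((starRingEnd ℂ) z)) :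
    DifferentiableAt ℂ (fun z => (starRingEnd ℂ) (f ((starRingEnd ℂ) z))) z := by
  have := hf.hasDerivAt.conj_conj
  rw [Complex.conj_conj] at this
  exact this.differentiableAt

lemma linear_bound (a r M : ℝ) (hr : 0 < r) (f : ℂ → ℂ)
    (hf : DifferentiableOn ℂ f (HB a r)) (hM : ∀ z ∈ HB a r, |(f z).im| ≤ M) (hM0 : 0 ≤ M)
    (hlim : ∀ x : ℝ, |x - a| < r → Tendsto (fun z => (f z).im) (𝓝[UHP] (x : ℂ)) (𝓝 0)) :
    ∀ z ∈ HB a (r / 8), |(f z).im| ≤ 16 * M / r * z.im := by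
  intro z hz
  rw [mem_HB] at hz
  obtain ⟨h1, h2⟩ := hz
  have hre := (Complex.abs_re_le_norm (z - a)).trans_lt h1
  have him := (Complex.abs_im_le_norm (z - a)).trans_lt h1
  simp only [sub_re, ofReal_re, sub_im, ofReal_im, sub_zero] at hre him
  have e : 2 * (r / 4) = r / 2 := by ring
  have hsub : HB z.re (2 * (r / 4)) ⊆ HB a r := by
    intro ζ hζ
    rw [mem_HB] at hζ ⊢
    refine ⟨?_, hζ.2⟩
    have : ζ - a = (ζ - z.re) + ((z.re - a : ℝ) : ℂ) := by push_cast; ring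
    rw [this]
    refine (norm_add_le _ _).trans_lt ?_
    rw [Complex.norm_real, Real.norm_eq_abs]
    linarith [hζ.1]
  have key := box_bound_abs z.re (r / 4) M (by positivity) f (hf.mono hsub)
    (fun ζ hζ => hM ζ (hsub hζ)) hM0
    (fun x _ hx => hlim x (by
      have := abs_add_le (x - z.re) (z.re - a)
      rw [sub_add_sub_cancel] at this; linarith)) z h2 (by simp; positivity)
    (by linarith [le_abs_self z.im])
  refine key.trans ?_
  rw [sub_self]
  have : 4 * M / (r / 4) ^ 2 * (0 ^ 2 - z.im ^ 2 + r / 4 * z.im)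
    = 16 * M / r * z.im - 4 * M / (r / 4) ^ 2 * z.im ^ 2 := by field_simp; ring
  rw [this]
  have : 0 ≤ 4 * M / (r / 4) ^ 2 * z.im ^ 2 := by positivity
  linarith

/-- Schwarz reflection at a real point. -/
lemma lemma_A (a r M : ℝ) (hr : 0 < r) (f : ℂ → ℂ)
    (hf : DifferentiableOn ℂ f (HB a r)) (hM : ∀ z ∈ HB a r, |(f z).im| ≤ M)
    (hlim : ∀ x : ℝ, x ≠ a → |x - a| < r →
      Tendsto (fun z => (f z).im) (𝓝[UHP] (x : ℂ)) (𝓝 0)) :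
    ∃ g : ℂ → ℂ, DifferentiableOn ℂ g (ball (a:ℂ) (r / 16)) ∧ EqOn g f (HB a (r / 16)) ∧
      ∀ z ∈ ball (a:ℂ) (r / 16), g ((starRingEnd ℂ) z) = (starRingEnd ℂ) (g z) := by
  -- make M positive
  wlog hMpos : 0 < M generalizing M
  · exact this (|M| + 1) (fun z hz => (hM z hz).trans (by linarith [le_abs_self M]))
      (by positivity)
  have hlim' : ∀ x : ℝ, |x - a| < r → Tendsto (fun z => (f z).im) (𝓝[UHP] (x : ℂ)) (𝓝 0) := by
    intro x hx
    by_cases hxa : x = a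
    · rw [hxa]; exact im_tendsto_center a r M hr f hf hM hMpos.le hlim
    · exact hlim x hxa hx
  have hlin := linear_bound a r M hr f hf hM hMpos.le hlim'
  set C : ℝ := 16 * M / r with hC
  have hCpos : 0 < C := by positivity
  have hder : ∀ z ∈ HB a (r / 16), ‖deriv f z‖ ≤ 32 * C := by
    intro z hz
    rw [mem_HB] at hz
    obtain ⟨h1, h2⟩ := hz
    have him := (Complex.abs_im_le_norm (z - a)).trans_lt h1
    simp only [sub_im, ofReal_im, sub_zero] at him
    have him' := le_abs_self z.im
    have hsub : ball z (z.im / 2) ⊆ HB a (r / 8) := by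
      intro ζ hζ
      rw [mem_ball, Complex.dist_eq] at hζ
      rw [mem_HB]
      constructor
      · have : ζ - a = (ζ - z) + (z - a) := by ring
        rw [this]
        refine (norm_add_le _ _).trans_lt ?_
        linarith
      · have := (Complex.abs_im_le_norm (ζ - z)).trans_lt hζ
        simp only [sub_im] at this
        rw [abs_lt] at this; linarith
    have := deriv_bound_im z (z.im / 2) (2 * C * z.im) (by positivity) (by positivity) f
      (hf.mono (hsub.trans (HB_mono (by linarith)))) (fun ζ hζ => by
        refine (hlin ζ (hsub hζ)).trans ?_
        rw [mem_ball, Complex.dist_eq] at hζ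
        have := (Complex.abs_im_le_norm (ζ - z)).trans_lt hζ
        simp only [sub_im] at this
        rw [abs_lt] at this
        have : ζ.im ≤ 2 * z.im := by linarith
        calc C * ζ.im ≤ C * (2 * z.im) := by gcongr
          _ = _ := by ring)
    refine this.trans (le_of_eq ?_)
    field_simp; ring
  have hfd : ∀ z ∈ HB a (r / 16), DifferentiableAt ℂ f z := fun z hz =>
    hf.differentiableAt ((isOpen_HB a r).mem_nhds (HB_mono (by linarith) hz))
  have hlip : LipschitzOnWith (Real.toNNReal (32 * C)) f (HB a (r / 16)) := by
    apply (convex_HB a (r / 16)).lipschitzOnWith_of_nnnorm_deriv_le hfd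
    intro z hz
    rw [← NNReal.coe_le_coe, coe_nnnorm, Real.coe_toNNReal _ (by positivity)]
    exact hder z hz
  obtain ⟨g0, hg0lip, hg0⟩ := hlip.extend_finite_dimension
  have hg0c : Continuous g0 := hg0lip.continuous
  have hreal : ∀ x : ℝ, |x - a| < r / 16 → (g0 x).im = 0 := by
    intro x hx
    have h1 : Tendsto (fun z => (g0 z).im) (𝓝[UHP] (x:ℂ)) (𝓝 (g0 x).im) :=
      ((Complex.continuous_im.comp hg0c).tendsto _).mono_left nhdsWithin_le_nhds
    have h2 : Tendsto (fun z => (g0 z).im) (𝓝[UHP] (x:ℂ)) (𝓝 0) := by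
      apply (hlim' x (by linarith)).congr'
      filter_upwards [HB_mem_nhdsWithin hx] with z hz
      rw [hg0 hz]
    exact tendsto_nhds_unique h1 h2
  have hreal' : ∀ z ∈ ball (a:ℂ) (r / 16), z.im = 0 → (g0 z).im = 0 ∧ (starRingEnd ℂ) z = z := by
    intro z hz hzi
    have e : z = (z.re : ℂ) := by apply Complex.ext <;> simp [hzi]
    refine ⟨?_, Complex.conj_eq_iff_im.2 hzi⟩
    rw [e]; apply hreal
    rw [e, mem_ball, Complex.dist_eq, ← Complex.ofReal_sub, Complex.norm_real] at hz
    exact hz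
  classical
  set G : ℂ → ℂ := fun z => if 0 ≤ z.im then g0 z else (starRingEnd ℂ) (g0 ((starRingEnd ℂ) z))
    with hG
  have hGc : ContinuousOn G (ball (a:ℂ) (r / 16)) := by
    apply ContinuousOn.if
    · rintro z ⟨hz, hz'⟩
      have hz'' : z.im = 0 := by
        have : frontier {z : ℂ | 0 ≤ z.im} = {z : ℂ | z.im = 0} :=
          Complex.frontier_setOfPred_le_im 0
        rw [this] at hz'; exact hz'
      obtain ⟨h1, h2⟩ := hreal' z hz hz''
      rw [h2, Complex.conj_eq_iff_im.2 h1]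
    · exact hg0c.continuousOn
    · exact (Complex.continuous_conj.comp (hg0c.comp Complex.continuous_conj)).continuousOn
  have hGup : EqOn G f (HB a (r / 16)) := by
    intro z hz
    have : 0 ≤ z.im := (mem_HB.1 hz).2.le
    simp only [hG, if_pos this]
    exact (hg0 hz).symm
  refine ⟨G, ?_, hGup, ?_⟩
  · apply glue_real _ _ _ hGc
    intro z hz hzi
    rcases lt_or_gt_of_ne hzi with hneg | hpos
    · have hz' : (starRingEnd ℂ) z ∈ HB a (r / 16) :=
        ⟨conj_mem_ball_real hz, by rw [mem_UHP]; simpa using hneg⟩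
      have hd := differentiableAt_conj_conj (hfd _ hz')
      apply hd.congr_of_eventuallyEq
      have : {z : ℂ | z.im < 0} ∩ ball (a:ℂ) (r / 16) ∈ 𝓝 z :=
        inter_mem ((isOpen_lt Complex.continuous_im continuous_const).mem_nhds hneg)
          (isOpen_ball.mem_nhds hz)
      filter_upwards [this] with ζ hζ
      have h1 : ¬ (0 ≤ ζ.im) := not_le.2 hζ.1
      have h2 : (starRingEnd ℂ) ζ ∈ HB a (r / 16) :=
        ⟨conj_mem_ball_real hζ.2, by
          have := hζ.1
          rw [mem_UHP]; simpa using this⟩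
      simp only [hG, if_neg h1]
      rw [hg0 h2]
    · have hz' : z ∈ HB a (r / 16) := ⟨hz, hpos⟩
      apply (hfd z hz').congr_of_eventuallyEq
      filter_upwards [(isOpen_HB a (r/16)).mem_nhds hz'] with ζ hζ
      exact hGup hζ
  · intro z hz
    rcases lt_trichotomy z.im 0 with h | h | h
    · have h1 : ¬ (0 ≤ z.im) := not_le.2 h
      have h2 : 0 ≤ ((starRingEnd ℂ) z).im := by simp; linarith
      simp only [hG, if_neg h1, if_pos h2, Complex.conj_conj]
    · obtain ⟨h1, h2⟩ := hreal' z hz h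
      rw [h2]
      simp only [hG, if_pos h.ge]
      exact (Complex.conj_eq_iff_im.2 h1).symm
    · have h1 : ¬ (0 ≤ ((starRingEnd ℂ) z).im) := by simp; linarith
      simp only [hG, if_pos h.le, if_neg h1, Complex.conj_conj]

local notation "conj" => starRingEnd ℂ


def Reg (f g : ℂ → ℂ) (a r : ℝ) : Prop :=
  0 < r ∧ DifferentiableOn ℂ g (ball (a:ℂ) r) ∧ EqOn g f (HB a r)

lemma real_mem_ball {a r x : ℝ} : ((x:ℂ) ∈ ball (a:ℂ) r) ↔ |x - a| < r := by
  rw [mem_ball, Complex.dist_eq, ← Complex.ofReal_sub, Complex.norm_real, Real.norm_eq_abs]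

lemma Reg.diffAt {f g : ℂ → ℂ} {a r : ℝ} (h : Reg f g a r) {z : ℂ} (hz : z ∈ ball (a:ℂ) r) :
    DifferentiableAt ℂ g z := h.2.1.differentiableAt (isOpen_ball.mem_nhds hz)

lemma Reg.tendsto {f g : ℂ → ℂ} {a r : ℝ} (h : Reg f g a r) {x : ℝ} (hx : |x - a| < r) :
    Tendsto f (𝓝[UHP] (x:ℂ)) (𝓝 (g x)) := by
  have h1 : Tendsto g (𝓝[UHP] (x:ℂ)) (𝓝 (g x)) :=
    ((h.diffAt (real_mem_ball.2 hx)).continuousAt.tendsto).mono_left nhdsWithin_le_nhds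
  apply h1.congr'
  filter_upwards [HB_mem_nhdsWithin hx] with z hz using h.2.2 hz

lemma Reg.mono {f g : ℂ → ℂ} {a r r' : ℝ} (h : Reg f g a r) (hr : 0 < r') (hle : r' ≤ r) :
    Reg f g a r' :=
  ⟨hr, h.2.1.mono (ball_subset_ball hle), h.2.2.mono (HB_mono hle)⟩

lemma lemma_D (a r M d : ℝ) (hr : 0 < r) (f : ℂ → ℂ)
    (hf : DifferentiableOn ℂ f (HB a r)) (hM : ∀ z ∈ HB a r, |(f z).im| ≤ M)
    (hlim : ∀ x : ℝ, x ≠ a → |x - a| < r →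
      Tendsto (fun z => (f z).im) (𝓝[UHP] (x : ℂ)) (𝓝 d)) :
    ∃ g : ℂ → ℂ, Reg f g a (r / 16) ∧
      ∀ z ∈ ball (a:ℂ) (r / 16), g (conj z) = conj (g z) + 2 * d * I := by
  obtain ⟨g, h1, h2, h3⟩ := lemma_A a r (M + |d|) hr (fun z => f z - d * I)
    (hf.sub_const _) (fun z hz => by
      have := hM z hz
      simp only [sub_im, mul_im, ofReal_re, I_im, ofReal_im, I_re, mul_one, mul_zero, add_zero]
      exact (abs_sub _ _).trans (by linarith)) (fun x hx hx' => by
      have := (hlim x hx hx').sub_const d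
      simpa using this)
  refine ⟨fun z => g z + d * I, ⟨by positivity, h1.add_const _, ?_⟩, ?_⟩
  · intro z hz
    simp [h2 hz]
  · intro z hz
    simp only [h3 z hz, map_add, map_mul, Complex.conj_ofReal, Complex.conj_I]
    ring

lemma im_of_symm {g : ℂ → ℂ} {a r d : ℝ}
    (h : ∀ z ∈ ball (a:ℂ) r, g (conj z) = conj (g z) + 2 * d * I) {x : ℝ} (hx : |x - a| < r) :
    (g x).im = d := by
  have := h x (real_mem_ball.2 hx)
  rw [Complex.conj_ofReal] at this
  have := congrArg Complex.im this
  simp at this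
  linarith

lemma re_of_symm {g : ℂ → ℂ} {a r c : ℝ}
    (h : ∀ z ∈ ball (a:ℂ) r, g (conj z) = 2 * c - conj (g z)) {x : ℝ} (hx : |x - a| < r) :
    (g x).re = c := by
  have := h x (real_mem_ball.2 hx)
  rw [Complex.conj_ofReal] at this
  have := congrArg Complex.re this
  simp at this
  linarith

lemma log_im_tendsto_right {a x : ℝ} (h : a < x) :
    Tendsto (fun z : ℂ => (Complex.log (z - a)).im) (𝓝[UHP] (x:ℂ)) (𝓝 0) := by
  have h1 : ContinuousAt (fun z : ℂ => (Complex.log (z - a)).im) (x:ℂ) := by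
    apply Complex.continuous_im.continuousAt.comp
    apply ContinuousAt.clog (by fun_prop)
    left; simp; linarith
  have h2 := h1.tendsto.mono_left (nhdsWithin_le_nhds (s := UHP))
  have h3 : (Complex.log ((x:ℂ) - a)).im = 0 := by
    rw [Complex.log_im, ← Complex.ofReal_sub]
    exact Complex.arg_ofReal_of_nonneg (by linarith)
  rwa [h3] at h2

lemma log_im_tendsto_left {a x : ℝ} (h : x < a) :
    Tendsto (fun z : ℂ => (Complex.log (z - a)).im) (𝓝[UHP] (x:ℂ)) (𝓝 Real.pi) := by
  have h1 : ContinuousAt (fun z : ℂ => (Complex.log (a - z)).im + Real.pi) (x:ℂ) := by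
    apply ContinuousAt.add _ continuousAt_const
    apply Complex.continuous_im.continuousAt.comp
    apply ContinuousAt.clog (by fun_prop)
    left; simp; linarith
  have h2 := h1.tendsto.mono_left (nhdsWithin_le_nhds (s := UHP))
  have h3 : (Complex.log ((a:ℂ) - x)).im = 0 := by
    rw [Complex.log_im, ← Complex.ofReal_sub]
    exact Complex.arg_ofReal_of_nonneg (by linarith)
  rw [h3, zero_add] at h2
  apply h2.congr'
  filter_upwards [self_mem_nhdsWithin] with z hz
  have hz' : 0 < z.im := hz
  rw [Complex.log_im, Complex.log_im]
  have : (a:ℂ) - z = -(z - a) := by ring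
  rw [this, Complex.arg_neg_eq_arg_sub_pi_of_im_pos (by simpa using hz')]
  ring

lemma diff_log {a : ℝ} : DifferentiableOn ℂ (fun z : ℂ => Complex.log (z - a)) UHP := by
  intro z hz
  apply DifferentiableAt.differentiableWithinAt
  apply DifferentiableAt.clog (by fun_prop)
  right
  have : 0 < z.im := hz
  simp [this.ne']

lemma log_im_mem {a : ℝ} {z : ℂ} (hz : z ∈ UHP) :
    0 ≤ (Complex.log (z - a)).im ∧ (Complex.log (z - a)).im ≤ Real.pi := by
  have hz' : 0 < z.im := hz
  rw [Complex.log_im]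
  exact ⟨Complex.arg_nonneg_iff.2 (by simpa using hz'.le), Complex.arg_le_pi _⟩

/-- Jump of the imaginary part: logarithmic singularity. -/
lemma lemma_T (a r M d d' : ℝ) (hr : 0 < r) (f : ℂ → ℂ)
    (hf : DifferentiableOn ℂ f (HB a r)) (hM : ∀ z ∈ HB a r, |(f z).im| ≤ M)
    (hlim1 : ∀ x : ℝ, x < a → |x - a| < r →
      Tendsto (fun z => (f z).im) (𝓝[UHP] (x : ℂ)) (𝓝 d))
    (hlim2 : ∀ x : ℝ, a < x → |x - a| < r →
      Tendsto (fun z => (f z).im) (𝓝[UHP] (x : ℂ)) (𝓝 d')) :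
    ∃ g : ℂ → ℂ, Reg (fun z => f z + (((d' - d) / Real.pi : ℝ) : ℂ) * Complex.log (z - a)) g a (r / 16) ∧
      ∀ z ∈ ball (a:ℂ) (r / 16), g (conj z) = conj (g z) + 2 * d' * I := by
  have him : ∀ z, (f z + (((d' - d) / Real.pi : ℝ) : ℂ) * Complex.log (z - a)).im
      = (f z).im + (d' - d) / Real.pi * (Complex.log (z - a)).im := by
    intro z; rw [add_im, Complex.im_ofReal_mul]
  apply lemma_D a r (M + |(d' - d) / Real.pi| * Real.pi) d' hr
  · exact hf.add ((diff_log.mono HB_subset_UHP).const_mul _)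
  · intro z hz
    rw [him]
    refine (abs_add_le _ _).trans ?_
    apply add_le_add (hM z hz)
    rw [abs_mul]
    gcongr
    obtain ⟨h1, h2⟩ := log_im_mem (a := a) (HB_subset_UHP hz)
    rw [abs_of_nonneg h1]; exact h2
  · intro x hxa hx
    simp only [him]
    rcases lt_or_gt_of_ne hxa with h | h
    · have := (hlim1 x h hx).add ((log_im_tendsto_left h).const_mul ((d' - d) / Real.pi))
      convert this using 2
      field_simp; ring
    · have := (hlim2 x h hx).add ((log_im_tendsto_right h).const_mul ((d' - d) / Real.pi))
      simpa using this

/-- Neumann-type reflection: constant real part, bounded imaginary part. -/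
lemma lemma_N (a r M c : ℝ) (hr : 0 < r) (f : ℂ → ℂ)
    (hf : DifferentiableOn ℂ f (HB a r)) (hM : ∀ z ∈ HB a r, |(f z).im| ≤ M)
    (hlim : ∀ x : ℝ, x ≠ a → |x - a| < r →
      Tendsto (fun z => (f z).re) (𝓝[UHP] (x : ℂ)) (𝓝 c)) :
    ∃ (g : ℂ → ℂ) (ρ : ℝ), Reg f g a ρ ∧
      ∀ z ∈ ball (a:ℂ) ρ, g (conj z) = 2 * c - conj (g z) := by
  set E : ℂ → ℂ := fun z => Complex.exp (I * (f z - c)) with hE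
  have hEim : ∀ z, (E z).im = Real.exp (-(f z).im) * Real.sin ((f z).re - c) := by
    intro z; simp [hE, Complex.exp_im]
  have hEnorm : ∀ z, ‖E z‖ = Real.exp (-(f z).im) := by
    intro z; simp [hE, Complex.norm_exp]
  have hEd : DifferentiableOn ℂ E (HB a r) := ((hf.sub_const _).const_mul I).cexp
  obtain ⟨G, hG1, hG2, hG3⟩ := lemma_A a r (Real.exp M) hr E hEd (fun z hz => by
    refine (Complex.abs_im_le_norm _).trans ?_
    rw [hEnorm]
    apply Real.exp_le_exp.2
    have := abs_le.1 (hM z hz); linarith) (fun x hxa hx => by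
    have h1 : Tendsto (fun z => Real.sin ((f z).re - c)) (𝓝[UHP] (x:ℂ)) (𝓝 0) := by
      have := (Real.continuous_sin.tendsto _).comp ((hlim x hxa hx).sub_const c)
      simp only [sub_self, Real.sin_zero] at this
      exact this
    rw [tendsto_zero_iff_norm_tendsto_zero]
    have h2 := (h1.norm.const_mul (Real.exp M))
    simp only [norm_zero, mul_zero] at h2
    apply squeeze_zero' (Eventually.of_forall fun z => norm_nonneg _) _ h2
    filter_upwards [HB_mem_nhdsWithin hx] with z hz
    rw [hEim, norm_mul]
    gcongr
    rw [Real.norm_eq_abs, Real.abs_exp]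
    apply Real.exp_le_exp.2
    have := abs_le.1 (hM z hz); linarith)
  have haball : (a:ℂ) ∈ ball (a:ℂ) (r / 16) := mem_ball_self (by positivity)
  have hRG : Reg E G a (r / 16) := ⟨by positivity, hG1, hG2⟩
  have hGa : G a ≠ 0 := by
    have h1 := hRG.tendsto (x := a) (by simp; positivity)
    have h2 : Real.exp (-M) ≤ ‖G a‖ := by
      apply ge_of_tendsto h1.norm
      filter_upwards [HB_mem_nhdsWithin (a := a) (r := r) (x := a) (by simpa using hr)] with z hz
      rw [hEnorm]
      apply Real.exp_le_exp.2
      have := abs_le.1 (hM z hz); linarith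
    intro h0
    rw [h0, norm_zero] at h2
    exact absurd h2 (not_le.2 (Real.exp_pos _))
  have hGareal : conj (G a) = G a := by
    have := hG3 a haball
    rw [Complex.conj_ofReal] at this; exact this.symm
  have hcont : ContinuousAt (fun z => G z / G a) (a:ℂ) :=
    (hRG.diffAt haball).continuousAt.div_const _
  have hslit : ∀ᶠ z in 𝓝 (a:ℂ), G z / G a ∈ Complex.slitPlane := by
    apply hcont.eventually_mem
    apply Complex.isOpen_slitPlane.mem_nhds
    simp only [div_self hGa]
    exact Complex.one_mem_slitPlane
  obtain ⟨ρ0, hρ0, hρ0'⟩ := Metric.eventually_nhds_iff_ball.1 hslit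
  set ρ := min ρ0 (r / 16) with hρ
  have hρpos : 0 < ρ := by positivity
  have hsl : ∀ z ∈ ball (a:ℂ) ρ, G z / G a ∈ Complex.slitPlane := fun z hz =>
    hρ0' z (ball_subset_ball (min_le_left _ _) hz)
  have hsub : ball (a:ℂ) ρ ⊆ ball (a:ℂ) (r / 16) := ball_subset_ball (min_le_right _ _)
  set L : ℂ → ℂ := fun z => Complex.log (G z / G a) with hL
  have hLd : DifferentiableOn ℂ L (ball (a:ℂ) ρ) := by
    apply DifferentiableOn.clog ((hG1.mono hsub).div_const _) hsl
  have hLconj : ∀ z ∈ ball (a:ℂ) ρ, L (conj z) = conj (L z) := by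
    intro z hz
    simp only [hL]
    rw [hG3 z (hsub hz)]
    conv_lhs => rw [← hGareal]
    rw [← map_div₀, Complex.log_conj _ (Complex.slitPlane_arg_ne_pi (hsl z hz))]
  have hexpL : ∀ z ∈ ball (a:ℂ) ρ, Complex.exp (L z) = G z / G a := by
    intro z hz
    exact Complex.exp_log (Complex.slitPlane_ne_zero (hsl z hz))
  -- f + i L is constant on HB a ρ
  have hHsub : HB a ρ ⊆ HB a (r / 16) := HB_mono (min_le_right _ _)
  have hHball : HB a ρ ⊆ ball (a:ℂ) ρ := fun z hz => hz.1
  have hexp : ∀ z ∈ HB a ρ, Complex.exp (I * (f z - c) - L z) = G a := by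
    intro z hz
    rw [Complex.exp_sub, hexpL z (hHball hz), hG2 (hHsub hz)]
    show E z / (E z / G a) = G a
    have : E z ≠ 0 := Complex.exp_ne_zero _
    field_simp
  have hPd : DifferentiableOn ℂ (fun z => I * (f z - c) - L z) (HB a ρ) :=
    (((hf.mono (hHsub.trans (HB_mono (by linarith)))).sub_const _).const_mul I).sub
      (hLd.mono hHball)
  obtain ⟨z0, hz0⟩ : (HB a ρ).Nonempty := by
    refine ⟨a + (ρ / 2 : ℝ) * I, mem_HB.2 ⟨?_, ?_⟩⟩
    · simp [abs_of_pos hρpos]; linarith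
    · simp; exact hρpos
  have hconst : ∀ z ∈ HB a ρ, I * (f z - c) - L z = I * (f z0 - c) - L z0 := by
    intro z hz
    have hder : ∀ z ∈ HB a ρ, fderivWithin ℂ (fun z => I * (f z - c) - L z) (HB a ρ) z = 0 := by
      intro z hz
      have hd := (hPd.differentiableAt ((isOpen_HB a ρ).mem_nhds hz))
      rw [fderivWithin_of_isOpen (isOpen_HB a ρ) hz]
      have h1 : HasDerivAt (fun z => Complex.exp (I * (f z - c) - L z))
        (Complex.exp (I * (f z - c) - L z) * deriv (fun z => I * (f z - c) - L z) z) z :=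
        hd.hasDerivAt.cexp
      have h2 : HasDerivAt (fun z => Complex.exp (I * (f z - c) - L z)) 0 z := by
        apply (hasDerivAt_const z (G a)).congr_of_eventuallyEq
        filter_upwards [(isOpen_HB a ρ).mem_nhds hz] with ζ hζ using hexp ζ hζ
      have h3 := h1.unique h2
      have h4 : deriv (fun z => I * (f z - c) - L z) z = 0 :=
        (mul_eq_zero.1 h3).resolve_left (Complex.exp_ne_zero _)
      ext
      simp [h4]
    exact (convex_HB a ρ).is_const_of_fderivWithin_eq_zero hPd hder hz hz0
  set κ : ℂ := I * (f z0 - c) - L z0 with hκ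
  have hfe : ∀ z ∈ HB a ρ, f z = c - I * (κ + L z) := by
    intro z hz
    rw [← hconst z hz]
    ring_nf
    simp
  set g : ℂ → ℂ := fun z => c - I * (κ + L z) with hg
  have hReg : Reg f g a ρ := ⟨hρpos, ((hLd.const_add _).const_mul I).const_sub _,
    fun z hz => (hfe z hz).symm⟩
  have hκr : conj κ = κ := by
    rw [Complex.conj_eq_iff_im]
    have hx : |(a + ρ / 2) - a| < ρ := by
      rw [add_sub_cancel_left, abs_of_pos (by positivity)]; linarith
    have h1 := (Complex.continuous_re.tendsto _).comp (hReg.tendsto hx)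
    have h2 := hlim (a + ρ / 2) (by linarith) (hx.trans_le ((min_le_right _ _).trans (by linarith)))
    have h3 := tendsto_nhds_unique h1 h2
    have h4 := hLconj _ (real_mem_ball.2 hx)
    rw [Complex.conj_ofReal, eq_comm, Complex.conj_eq_iff_im] at h4
    simp only [hg, sub_re, ofReal_re, mul_re, I_re, I_im, add_im, add_re] at h3
    rw [h4] at h3
    linarith
  refine ⟨g, ρ, hReg, ?_⟩
  intro z hz
  simp only [hg, hLconj z hz, map_sub, map_mul, map_add, hκr, Complex.conj_I, Complex.conj_ofReal]
  ring

/-- `f` has a square-root type expansion at `a`. -/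
def RegY (f K : ℂ → ℂ) (a ρ : ℝ) : Prop :=
  0 < ρ ∧ DifferentiableOn ℂ K (ball (0:ℂ) ρ) ∧
    ∀ ζ ∈ ball (0:ℂ) ρ, 0 < ζ.re → 0 < ζ.im → f (a + ζ ^ 2) = K ζ

lemma sq_im' (ζ : ℂ) : (ζ ^ 2).im = 2 * ζ.re * ζ.im := by rw [pow_two, mul_im]; ring
lemma sq_re' (ζ : ℂ) : (ζ ^ 2).re = ζ.re ^ 2 - ζ.im ^ 2 := by rw [pow_two, mul_re]; ring

lemma lemma_Y_left (a r M c d : ℝ) (hr : 0 < r) (f : ℂ → ℂ)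
    (hf : DifferentiableOn ℂ f (HB a r)) (hM : ∀ z ∈ HB a r, |(f z).im| ≤ M)
    (hlim1 : ∀ x : ℝ, x < a → |x - a| < r →
      Tendsto (fun z => (f z).re) (𝓝[UHP] (x : ℂ)) (𝓝 c))
    (hlim2 : ∀ x : ℝ, a < x → |x - a| < r →
      Tendsto (fun z => (f z).im) (𝓝[UHP] (x : ℂ)) (𝓝 d)) :
    ∃ (K : ℂ → ℂ) (ρ : ℝ), RegY f K a ρ ∧ K 0 = c + d * I := by
  set f1 : ℂ → ℂ := fun z => f z - (c + d * I) with hf1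
  set M1 := M + |d| with hM1
  have hf1d : DifferentiableOn ℂ f1 (HB a r) := hf.sub_const _
  have hf1re : ∀ z, (f1 z).re = (f z).re - c := by intro z; simp [hf1]
  have hf1im : ∀ z, (f1 z).im = (f z).im - d := by intro z; simp [hf1]
  have hf1b : ∀ z ∈ HB a r, |(f1 z).im| ≤ M1 := by
    intro z hz; rw [hf1im]; exact (abs_sub _ _).trans (by linarith [hM z hz])
  have hl1 : ∀ x : ℝ, x < a → |x - a| < r →
      Tendsto (fun z => (f1 z).re) (𝓝[UHP] (x : ℂ)) (𝓝 0) := by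
    intro x hx hx'
    have := (hlim1 x hx hx').sub_const c
    simpa only [hf1re, sub_self] using this
  have hl2 : ∀ x : ℝ, a < x → |x - a| < r →
      Tendsto (fun z => (f1 z).im) (𝓝[UHP] (x : ℂ)) (𝓝 0) := by
    intro x hx hx'
    have := (hlim2 x hx hx').sub_const d
    simpa only [hf1im, sub_self] using this
  classical
  set F1 : ℂ → ℂ := fun z => if 0 < z.im then f1 z else if z.im < 0 then - conj (f1 (conj z))
    else limUnder (𝓝[UHP] z) f1 with hF1
  have hF1up : ∀ z : ℂ, 0 < z.im → F1 z = f1 z := fun z hz => by simp only [hF1, if_pos hz]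
  have hF1dn : ∀ z : ℂ, z.im < 0 → F1 z = - conj (f1 (conj z)) := fun z hz => by
    simp only [hF1, if_neg (not_lt.2 hz.le), if_pos hz]
  have hF1re : ∀ (x : ℝ) (L : ℂ), Tendsto f1 (𝓝[UHP] (x:ℂ)) (𝓝 L) → F1 x = L := by
    intro x L hL
    simp only [hF1, ofReal_im, lt_irrefl, if_false]
    exact hL.limUnder_eq
  -- Neumann points
  have hNeu : ∀ x : ℝ, x < a → |x - a| < r → DifferentiableAt ℂ F1 x ∧ |(F1 x).im| ≤ M1 := by
    intro x hx hx'
    set r1 := min (a - x) (r - |x - a|) with hr1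
    have hr1pos : 0 < r1 := lt_min (by linarith) (by linarith)
    have hsub : HB x r1 ⊆ HB a r := by
      intro z hz
      rw [mem_HB] at hz ⊢
      refine ⟨?_, hz.2⟩
      have : z - a = (z - x) + ((x - a : ℝ) : ℂ) := by push_cast; ring
      rw [this]
      refine (norm_add_le _ _).trans_lt ?_
      rw [Complex.norm_real, Real.norm_eq_abs]
      have := min_le_right (a - x) (r - |x - a|)
      linarith [hz.1]
    obtain ⟨g, ρ, hg, hgs⟩ := lemma_N x r1 M1 0 hr1pos f1 (hf1d.mono hsub)
      (fun z hz => hf1b z (hsub hz)) (fun x' _ hx'' => by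
        have h1 := min_le_left (a - x) (r - |x - a|)
        have h2 := min_le_right (a - x) (r - |x - a|)
        have h3 := abs_add_le (x' - x) (x - a)
        rw [sub_add_sub_cancel] at h3
        apply hl1 x' _ (by linarith)
        have := le_abs_self (x' - x); linarith)
    have heq : ∀ z ∈ ball (x:ℂ) ρ, F1 z = g z := by
      intro z hz
      rcases lt_trichotomy z.im 0 with h | h | h
      · rw [hF1dn z h, ← hg.2.2 (show conj z ∈ HB x ρ from ⟨conj_mem_ball_real hz, by
          rw [mem_UHP]; simpa using h⟩)]
        rw [hgs z hz]; simp
      · have e : z = (z.re : ℂ) := by apply Complex.ext <;> simp [h]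
        rw [e] at hz ⊢
        exact hF1re _ _ (hg.tendsto (real_mem_ball.1 hz))
      · rw [hF1up z h, hg.2.2 ⟨hz, h⟩]
    refine ⟨?_, ?_⟩
    · apply (hg.diffAt (mem_ball_self hg.1)).congr_of_eventuallyEq
      filter_upwards [ball_mem_nhds (x:ℂ) hg.1] with z hz using heq z hz
    · rw [heq x (mem_ball_self hg.1)]
      have h1 := (Complex.continuous_im.tendsto _).comp (hg.tendsto (x := x) (by simpa using hg.1))
      apply le_of_tendsto h1.abs
      filter_upwards [HB_mem_nhdsWithin hx'] with z hz using hf1b z hz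
  have hall : ∀ z ∈ ball (a:ℂ) r, (z.im ≠ 0 ∨ z.re < a) →
      DifferentiableAt ℂ F1 z ∧ |(F1 z).im| ≤ M1 := by
    intro z hz hz'
    rcases lt_trichotomy z.im 0 with h | h | h
    · have hc : conj z ∈ HB a r := ⟨conj_mem_ball_real hz, by
          rw [mem_UHP]; simpa using h⟩
      refine ⟨?_, ?_⟩
      · have hd := (differentiableAt_conj_conj
          (hf1d.differentiableAt ((isOpen_HB a r).mem_nhds hc))).neg
        apply hd.congr_of_eventuallyEq
        filter_upwards [(isOpen_lt Complex.continuous_im continuous_const).mem_nhds h] with ζ hζ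
        exact hF1dn ζ hζ
      · rw [hF1dn z h]
        simpa using hf1b _ hc
    · have e : z = (z.re : ℂ) := by apply Complex.ext <;> simp [h]
      rw [e] at hz ⊢
      exact hNeu _ (hz'.resolve_left (fun h' => h' h)) (real_mem_ball.1 hz)
    · refine ⟨?_, ?_⟩
      · apply (hf1d.differentiableAt ((isOpen_HB a r).mem_nhds ⟨hz, h⟩)).congr_of_eventuallyEq
        filter_upwards [isOpen_UHP.mem_nhds h] with ζ hζ using hF1up ζ hζ
      · rw [hF1up z h]; exact hf1b z ⟨hz, h⟩
  -- the square root coordinate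
  set R := Real.sqrt r with hR
  have hRpos : 0 < R := Real.sqrt_pos.2 hr
  have hR2 : R ^ 2 = r := Real.sq_sqrt hr.le
  set K0 : ℂ → ℂ := fun ζ => F1 (a + ζ ^ 2) with hK0
  have hsq : ∀ ζ ∈ ball (0:ℂ) R, (a:ℂ) + ζ ^ 2 ∈ ball (a:ℂ) r := by
    intro ζ hζ
    rw [mem_ball, Complex.dist_eq] at hζ ⊢
    rw [sub_zero] at hζ
    rw [add_sub_cancel_left, norm_pow, ← hR2]
    gcongr
  have hcond : ∀ ζ ∈ HB 0 R, ((a:ℂ) + ζ ^ 2 ∈ ball (a:ℂ) r) ∧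
      (((a:ℂ) + ζ ^ 2).im ≠ 0 ∨ ((a:ℂ) + ζ ^ 2).re < a) := by
    intro ζ hζ
    have h0 := mem_HB.1 hζ
    refine ⟨hsq ζ (by simpa using h0.1), ?_⟩
    simp only [add_im, ofReal_im, zero_add, add_re, ofReal_re, sq_im', sq_re']
    by_cases h : ζ.re = 0
    · right; rw [h]; nlinarith [h0.2]
    · left
      have := h0.2.ne'
      positivity
  obtain ⟨K, hK1, hK2, hK3⟩ := lemma_A 0 R M1 hRpos K0 (fun ζ hζ => by
      obtain ⟨h1, h2⟩ := hcond ζ hζ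
      apply DifferentiableAt.differentiableWithinAt
      exact DifferentiableAt.comp (f := fun ζ : ℂ => (a:ℂ) + ζ ^ 2) (g := F1) ζ (hall _ h1 h2).1
        (by fun_prop)) (fun ζ hζ => by
      obtain ⟨h1, h2⟩ := hcond ζ hζ
      exact (hall _ h1 h2).2) (fun x hx0 hx => by
      have hpt : |(a + x ^ 2) - a| < r := by
        rw [add_sub_cancel_left, abs_pow, ← hR2]
        rw [sub_zero] at hx
        gcongr
      have hlt : a < a + x ^ 2 := by have : 0 < x ^ 2 := by positivity
                                     linarith
      have hct : Tendsto (fun ζ : ℂ => (a:ℂ) + ζ ^ 2) (𝓝[UHP] (x:ℂ)) (𝓝 ((a + x ^ 2 : ℝ) : ℂ)) := by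
        have h1 : Continuous (fun ζ : ℂ => (a:ℂ) + ζ ^ 2) := by fun_prop
        have := h1.tendsto (x:ℂ)
        push_cast
        exact this.mono_left nhdsWithin_le_nhds
      have hret : Tendsto Complex.re (𝓝[UHP] (x:ℂ)) (𝓝 x) :=
        (Complex.continuous_re.tendsto (x:ℂ)).mono_left nhdsWithin_le_nhds
      rcases lt_or_gt_of_ne hx0 with h | h
      · have hct2 : Tendsto (fun ζ : ℂ => conj ((a:ℂ) + ζ ^ 2)) (𝓝[UHP] (x:ℂ))
            (𝓝[UHP] ((a + x ^ 2 : ℝ) : ℂ)) := by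
          rw [tendsto_nhdsWithin_iff]
          constructor
          · have := (Complex.continuous_conj.tendsto _).comp hct
            rw [Complex.conj_ofReal] at this; exact this
          · filter_upwards [self_mem_nhdsWithin, hret.eventually (gt_mem_nhds h)] with ζ h1 h2
            have h1' : 0 < ζ.im := h1
            rw [mem_UHP, Complex.conj_im]
            simp only [add_im, ofReal_im, zero_add, sq_im']
            nlinarith
        apply ((hl2 _ hlt hpt).comp hct2).congr'
        filter_upwards [self_mem_nhdsWithin, hret.eventually (gt_mem_nhds h)] with ζ h1 h2
        have h1' : 0 < ζ.im := h1
        have : ((a:ℂ) + ζ ^ 2).im < 0 := by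
          simp only [add_im, ofReal_im, zero_add, sq_im']
          nlinarith
        simp only [hK0, Function.comp, hF1dn _ this, neg_im, Complex.conj_im, neg_neg]
      · have hct2 : Tendsto (fun ζ : ℂ => (a:ℂ) + ζ ^ 2) (𝓝[UHP] (x:ℂ))
            (𝓝[UHP] ((a + x ^ 2 : ℝ) : ℂ)) := by
          rw [tendsto_nhdsWithin_iff]
          refine ⟨hct, ?_⟩
          filter_upwards [self_mem_nhdsWithin, hret.eventually (lt_mem_nhds h)] with ζ h1 h2
          have h1' : 0 < ζ.im := h1
          rw [mem_UHP]
          simp only [add_im, ofReal_im, zero_add, sq_im']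
          positivity
        apply ((hl2 _ hlt hpt).comp hct2).congr'
        filter_upwards [self_mem_nhdsWithin, hret.eventually (lt_mem_nhds h)] with ζ h1 h2
        have h1' : 0 < ζ.im := h1
        have : 0 < ((a:ℂ) + ζ ^ 2).im := by
          simp only [add_im, ofReal_im, zero_add, sq_im']
          positivity
        simp only [hK0, Function.comp, hF1up _ this])
  rw [Complex.ofReal_zero] at hK1 hK3
  have h0ball : (0:ℂ) ∈ ball (0:ℂ) (R / 16) := mem_ball_self (by positivity)
  have hK0im : (K 0).im = 0 := by
    have := hK3 0 h0ball
    rw [map_zero] at this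
    exact Complex.conj_eq_iff_im.1 this.symm
  have hmemHB : ∀ ζ ∈ ball (0:ℂ) (R / 16), 0 < ζ.im → ζ ∈ HB 0 (R / 16) := by
    intro ζ hζ h; exact ⟨by simpa using hζ, h⟩
  have hKq : ∀ ζ ∈ ball (0:ℂ) (R / 16), 0 < ζ.re → 0 < ζ.im → K ζ = f1 (a + ζ ^ 2) := by
    intro ζ hζ h1 h2
    rw [hK2 (hmemHB ζ hζ h2)]
    apply hF1up
    simp only [add_im, ofReal_im, zero_add, sq_im']
    positivity
  have hKq2 : ∀ ζ ∈ ball (0:ℂ) (R / 16), 0 < ζ.re → 0 < ζ.im → K (- conj ζ) = - conj (K ζ) := by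
    intro ζ hζ h1 h2
    have hmem : - conj ζ ∈ ball (0:ℂ) (R / 16) := by simpa using hζ
    rw [hK2 (hmemHB _ hmem (by simpa using h2)), hKq ζ hζ h1 h2]
    have hneg : ((a:ℂ) + (- conj ζ) ^ 2).im < 0 := by
      simp only [add_im, ofReal_im, zero_add, sq_im', neg_re, neg_im, Complex.conj_re,
        Complex.conj_im]
      nlinarith [mul_pos h1 h2]
    simp only [hK0]
    rw [hF1dn _ hneg]
    simp
  have hKc : ContinuousAt K 0 := (hK1.differentiableAt (isOpen_ball.mem_nhds h0ball)).continuousAt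
  have hK0re : (K 0).re = 0 := by
    set γ : ℝ → ℂ := fun τ => τ * (1 + I) with hγ
    have hγc : Continuous γ := by simp only [hγ]; fun_prop
    have hγ0 : Tendsto γ (𝓝[>] 0) (𝓝 0) := by
      have := hγc.tendsto 0
      simp only [hγ, ofReal_zero, zero_mul] at this
      exact this.mono_left nhdsWithin_le_nhds
    have t1 : Tendsto (fun τ => - conj (K (γ τ))) (𝓝[>] 0) (𝓝 (- conj (K 0))) :=
      ((Complex.continuous_conj.tendsto _).comp (hKc.tendsto.comp hγ0)).neg
    have t2 : Tendsto (fun τ => K (- conj (γ τ))) (𝓝[>] 0) (𝓝 (K 0)) := by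
      apply hKc.tendsto.comp
      have := ((Complex.continuous_conj.tendsto _).comp hγ0).neg
      simpa [Function.comp_def] using this
    have t3 : Tendsto (fun τ => K (- conj (γ τ))) (𝓝[>] 0) (𝓝 (- conj (K 0))) := by
      apply t1.congr'
      filter_upwards [self_mem_nhdsWithin, hγ0.eventually (isOpen_ball.mem_nhds h0ball)] with τ h1 h2
      have h1' : 0 < τ := h1
      rw [hKq2 _ h2 (by simp [hγ, h1']) (by simp [hγ, h1'])]
    have := congrArg Complex.re (tendsto_nhds_unique t2 t3)
    simp at this
    linarith
  refine ⟨fun ζ => K ζ + (c + d * I), R / 16, ⟨by positivity, hK1.add_const _, ?_⟩, ?_⟩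
  · intro ζ hζ h1 h2
    simp only [hKq ζ hζ h1 h2, hf1]
    ring
  · have : K 0 = 0 := Complex.ext hK0re hK0im
    simp only [this, zero_add]

lemma tendsto_neg_conj (x : ℝ) :
    Tendsto (fun z : ℂ => - conj z) (𝓝[UHP] (x:ℂ)) (𝓝[UHP] ((-x : ℝ) : ℂ)) := by
  rw [tendsto_nhdsWithin_iff]
  constructor
  · have h : Continuous (fun z : ℂ => - conj z) := Complex.continuous_conj.neg
    have := (h.tendsto (x:ℂ)).mono_left (nhdsWithin_le_nhds (s := UHP))
    simpa using this
  · filter_upwards [self_mem_nhdsWithin] with z hz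
    have hz' : 0 < z.im := hz
    rw [mem_UHP]; simpa using hz'

lemma lemma_Y_right (a r M c d : ℝ) (hr : 0 < r) (f : ℂ → ℂ)
    (hf : DifferentiableOn ℂ f (HB a r)) (hM : ∀ z ∈ HB a r, |(f z).im| ≤ M)
    (hlim1 : ∀ x : ℝ, a < x → |x - a| < r →
      Tendsto (fun z => (f z).re) (𝓝[UHP] (x : ℂ)) (𝓝 c))
    (hlim2 : ∀ x : ℝ, x < a → |x - a| < r →
      Tendsto (fun z => (f z).im) (𝓝[UHP] (x : ℂ)) (𝓝 d)) :
    ∃ (K : ℂ → ℂ) (ρ : ℝ), RegY f K a ρ ∧ K 0 = c + d * I := by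
  have hmap : ∀ z ∈ HB (-a) r, - conj z ∈ HB a r := by
    intro z hz
    rw [mem_HB] at hz ⊢
    refine ⟨?_, by simpa using hz.2⟩
    have : - conj z - (a:ℂ) = - conj (z - ((-a : ℝ) : ℂ)) := by simp; ring
    rw [this, norm_neg, Complex.norm_conj]
    exact hz.1
  have habs : ∀ x : ℝ, |x - -a| < r → |-x - a| < r := by
    intro x hx
    have : -x - a = -(x - -a) := by ring
    rw [this, abs_neg]; exact hx
  obtain ⟨K, ρ, ⟨hρ, hK1, hK2⟩, hK0⟩ := lemma_Y_left (-a) r M (-c) d hr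
    (fun z => - conj (f (- conj z))) (fun z hz => by
      apply DifferentiableAt.differentiableWithinAt
      have h1 : DifferentiableAt ℂ (fun z => f (-z)) (conj z) := by
        have : DifferentiableAt ℂ f (- conj z) :=
          hf.differentiableAt ((isOpen_HB a r).mem_nhds (hmap z hz))
        exact DifferentiableAt.comp (f := fun z : ℂ => -z) (g := f) (conj z) this (by fun_prop)
      exact (differentiableAt_conj_conj h1).neg) (fun z hz => by
      have := hM _ (hmap z hz)
      simpa using this) (fun x hx hx' => by
      have := ((hlim1 (-x) (by linarith) (habs x hx')).comp (tendsto_neg_conj x)).neg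
      simpa [Function.comp_def] using this) (fun x hx hx' => by
      have := ((hlim2 (-x) (by linarith) (habs x hx')).comp (tendsto_neg_conj x))
      simpa [Function.comp_def] using this)
  have hb : ∀ ζ ∈ ball (0:ℂ) ρ, I * conj ζ ∈ ball (0:ℂ) ρ := by
    intro ζ hζ; simpa using hζ
  refine ⟨fun ζ => - conj (K (I * conj ζ)), ρ, ⟨hρ, ?_, ?_⟩, ?_⟩
  · intro ζ hζ
    apply DifferentiableAt.differentiableWithinAt
    have h1 : DifferentiableAt ℂ (fun z => K (I * z)) (conj ζ) := by
      have : DifferentiableAt ℂ K (I * conj ζ) :=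
        hK1.differentiableAt (isOpen_ball.mem_nhds (hb ζ hζ))
      exact DifferentiableAt.comp (f := fun z : ℂ => I * z) (g := K) (conj ζ) this (by fun_prop)
    exact (differentiableAt_conj_conj h1).neg
  · intro ζ hζ h1 h2
    show f (a + ζ ^ 2) = -conj (K (I * conj ζ))
    rw [← hK2 _ (hb ζ hζ) (by simpa using h2) (by simpa using h1)]
    simp [mul_pow, add_comm]
  · simp [hK0]; ring

lemma exists_sqrt {z : ℂ} (hz : 0 < z.im) : ∃ ζ : ℂ, ζ ^ 2 = z ∧ 0 < ζ.re ∧ 0 < ζ.im := by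
  have hz0 : z ≠ 0 := by rintro rfl; simp at hz
  have harg0 : 0 < z.arg := by
    rcases (Complex.arg_nonneg_iff.2 hz.le).lt_or_eq with h | h
    · exact h
    · exact absurd (Complex.arg_eq_zero_iff.1 h.symm).2 hz.ne'
  have hargpi : z.arg ≤ Real.pi := Complex.arg_le_pi z
  have hargpi' : z.arg < Real.pi := by
    rcases hargpi.lt_or_eq with h | h
    · exact h
    · exact absurd (Complex.arg_eq_pi_iff.1 h).2 hz.ne'
  refine ⟨Complex.exp (Complex.log z / 2), ?_, ?_, ?_⟩
  · rw [← Complex.exp_nat_mul]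
    push_cast
    rw [mul_div_cancel₀ _ (two_ne_zero), Complex.exp_log hz0]
  · have e : (Complex.log z / 2).im = z.arg / 2 := by simp [Complex.log_im]
    rw [Complex.exp_re, e]
    apply mul_pos (Real.exp_pos _)
    apply Real.cos_pos_of_mem_Ioo; constructor <;> linarith
  · have e : (Complex.log z / 2).im = z.arg / 2 := by simp [Complex.log_im]
    rw [Complex.exp_im, e]
    apply mul_pos (Real.exp_pos _)
    apply Real.sin_pos_of_pos_of_lt_pi <;> linarith

lemma RegY.tendsto {f K : ℂ → ℂ} {a ρ : ℝ} (h : RegY f K a ρ) :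
    Tendsto f (𝓝[UHP] (a:ℂ)) (𝓝 (K 0)) := by
  obtain ⟨hρ, h1, h2⟩ := h
  have hc : ContinuousAt K 0 :=
    (h1.differentiableAt (isOpen_ball.mem_nhds (mem_ball_self hρ))).continuousAt
  rw [Metric.tendsto_nhds]
  intro ε hε
  obtain ⟨δ, hδ, hδ'⟩ := Metric.continuousAt_iff.1 hc ε hε
  set η := min δ ρ with hη
  have hηpos : 0 < η := lt_min hδ hρ
  have hb : ball (a:ℂ) (η ^ 2) ∈ 𝓝[UHP] (a:ℂ) :=
    mem_nhdsWithin_of_mem_nhds (ball_mem_nhds _ (by positivity))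
  filter_upwards [hb, self_mem_nhdsWithin] with z hz hz'
  have hz0 : 0 < (z - a).im := by simpa using mem_UHP.1 hz'
  obtain ⟨ζ, e1, e2, e3⟩ := exists_sqrt hz0
  have hn : ‖ζ‖ < η := by
    rw [mem_ball, Complex.dist_eq, ← e1, norm_pow] at hz
    exact lt_of_pow_lt_pow_left₀ 2 hηpos.le hz
  have e4 : z = a + ζ ^ 2 := by rw [e1]; ring
  rw [e4, h2 ζ (by simpa using hn.trans_le (min_le_right _ _)) e2 e3]
  apply hδ'
  simpa using hn.trans_le (min_le_left _ _)

lemma convex_quadrant (ρ : ℝ) : Convex ℝ (ball (0:ℂ) ρ ∩ ({z | 0 < z.re} ∩ {z | 0 < z.im})) :=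
  (convex_ball _ _).inter ((convex_halfSpace_re_gt 0).inter (convex_halfSpace_im_gt 0))

lemma isOpen_quadrant (ρ : ℝ) : IsOpen (ball (0:ℂ) ρ ∩ ({z | 0 < z.re} ∩ {z | 0 < z.im})) :=
  isOpen_ball.inter ((isOpen_lt continuous_const Complex.continuous_re).inter
    (isOpen_lt continuous_const Complex.continuous_im))

/-- Two functions with the same derivative on an open convex set. -/
lemma const_of_deriv_eq {U : Set ℂ} (hU : IsOpen U) (hc : Convex ℝ U) {f g f' : ℂ → ℂ}
    (hf : ∀ z ∈ U, HasDerivAt f (f' z) z) (hg : ∀ z ∈ U, HasDerivAt g (f' z) z) :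
    ∃ κ : ℂ, ∀ z ∈ U, f z = g z + κ := by
  rcases U.eq_empty_or_nonempty with h | ⟨z0, hz0⟩
  · exact ⟨0, by simp [h]⟩
  refine ⟨f z0 - g z0, fun z hz => ?_⟩
  have hd : DifferentiableOn ℂ (fun z => f z - g z) U := fun z hz =>
    ((hf z hz).sub (hg z hz)).differentiableAt.differentiableWithinAt
  have : f z - g z = f z0 - g z0 := by
    refine hc.is_const_of_fderivWithin_eq_zero (f := fun z => f z - g z) hd ?_ hz hz0
    intro z hz
    rw [fderivWithin_of_isOpen hU hz]
    have h1 := ((hf z hz).sub (hg z hz)).deriv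
    rw [sub_self] at h1
    ext
    have : deriv (fun z => f z - g z) z = 0 := h1
    simp [this]
  linear_combination this

lemma RegY_prim {f f2 K K2 W : ℂ → ℂ} {a ρ ρ2 : ℝ} (h : RegY f K a ρ) (h2 : RegY f2 K2 a ρ2)
    (hf2 : DifferentiableOn ℂ f2 UHP)
    (hW : ∀ z ∈ UHP, HasDerivAt W (f z * deriv f2 z) z) :
    ∃ L : ℂ, Tendsto W (𝓝[UHP] (a:ℂ)) (𝓝 L) := by
  set η := min ρ ρ2 with hη
  have hηpos : 0 < η := lt_min h.1 h2.1
  have hK1 : DifferentiableOn ℂ K (ball 0 η) := h.2.1.mono (ball_subset_ball (min_le_left _ _))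
  have hK2 : DifferentiableOn ℂ K2 (ball 0 η) := h2.2.1.mono (ball_subset_ball (min_le_right _ _))
  have hp : DifferentiableOn ℂ (fun ζ => K ζ * deriv K2 ζ) (ball 0 η) :=
    hK1.mul (hK2.deriv isOpen_ball)
  obtain ⟨P, hP⟩ := hp.isExactOn_ball
  set Q := ball (0:ℂ) η ∩ ({z | 0 < z.re} ∩ {z | 0 < z.im}) with hQ
  have hup : ∀ ζ ∈ Q, (a:ℂ) + ζ ^ 2 ∈ UHP := by
    intro ζ hζ
    have h3 : 0 < ζ.re := hζ.2.1
    have h4 : 0 < ζ.im := hζ.2.2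
    rw [mem_UHP]
    simp only [add_im, ofReal_im, zero_add, sq_im']
    positivity
  have hdsq : ∀ ζ : ℂ, HasDerivAt (fun ζ : ℂ => (a:ℂ) + ζ ^ 2) (2 * ζ) ζ := by
    intro ζ
    have := (hasDerivAt_pow 2 ζ).const_add (a:ℂ)
    simpa using this
  obtain ⟨κ, hκ⟩ := const_of_deriv_eq (isOpen_quadrant η) (convex_quadrant η)
    (f := fun ζ => W (a + ζ ^ 2)) (g := P) (f' := fun ζ => K ζ * deriv K2 ζ) (by
      intro ζ hζ
      have h3 := (hW _ (hup ζ hζ)).comp ζ (hdsq ζ)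
      have h4 : HasDerivAt (fun ζ => f2 (a + ζ ^ 2)) (deriv f2 (a + ζ ^ 2) * (2 * ζ)) ζ :=
        (hf2.differentiableAt (isOpen_UHP.mem_nhds (hup ζ hζ))).hasDerivAt.comp ζ (hdsq ζ)
      have h5 : deriv K2 ζ = deriv f2 (a + ζ ^ 2) * (2 * ζ) := by
        rw [← h4.deriv]
        apply Filter.EventuallyEq.deriv_eq
        filter_upwards [(isOpen_quadrant η).mem_nhds hζ] with ξ hξ
        exact (h2.2.2 ξ (ball_subset_ball (min_le_right _ _) hξ.1) hξ.2.1 hξ.2.2).symm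
      have h6 : K ζ * deriv K2 ζ = f (a + ζ ^ 2) * deriv f2 (a + ζ ^ 2) * (2 * ζ) := by
        rw [h5, ← h.2.2 ζ (ball_subset_ball (min_le_left _ _) hζ.1) hζ.2.1 hζ.2.2]
        ring
      show HasDerivAt _ (K ζ * deriv K2 ζ) ζ
      rw [h6]
      exact h3) (fun ζ hζ => hP ζ hζ.1)
  have : RegY W (fun ζ => P ζ + κ) a η := by
    refine ⟨hηpos, ?_, ?_⟩
    · intro ζ hζ
      exact ((hP ζ hζ).differentiableAt.add_const _).differentiableWithinAt
    · intro ζ hζ h3 h4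
      exact hκ ζ ⟨hζ, h3, h4⟩
  exact ⟨_, this.tendsto⟩

lemma uhp_primitive (f : ℂ → ℂ) (hf : DifferentiableOn ℂ f UHP) :
    ∃ W : ℂ → ℂ, ∀ z ∈ UHP, HasDerivAt W (f z) z := by
  set φ : ℂ → ℂ := fun ω => I * (1 + ω) / (1 - ω) with hφ
  have hne : ∀ ω ∈ ball (0:ℂ) 1, 1 - ω ≠ 0 := by
    intro ω hω h0
    have : ω = 1 := by linear_combination -h0
    rw [this] at hω; simp at hω
  have hφup : ∀ ω ∈ ball (0:ℂ) 1, φ ω ∈ UHP := by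
    intro ω hω
    have h1 := hne ω hω
    have h2 : 0 < Complex.normSq (1 - ω) := Complex.normSq_pos.2 h1
    have h3 : Complex.normSq ω < 1 := by
      rw [Complex.normSq_eq_norm_sq]
      have : ‖ω‖ < 1 := by simpa using hω
      nlinarith [norm_nonneg ω]
    rw [mem_UHP]
    have : (φ ω).im = (1 - Complex.normSq ω) / Complex.normSq (1 - ω) := by
      simp only [hφ, Complex.div_im, Complex.normSq_apply] at *
      simp
      field_simp
      ring
    rw [this]; apply div_pos _ h2; linarith
  have hφd : DifferentiableOn ℂ φ (ball 0 1) := by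
    simp only [hφ]
    apply DifferentiableOn.div (by fun_prop) (by fun_prop) hne
  have hF : DifferentiableOn ℂ (fun ω => f (φ ω) * (2 * I / (1 - ω) ^ 2)) (ball 0 1) := by
    apply (hf.comp hφd hφup).mul
    apply DifferentiableOn.div (by fun_prop) (by fun_prop)
    intro ω hω; exact pow_ne_zero _ (hne ω hω)
  obtain ⟨P, hP⟩ := hF.isExactOn_ball
  refine ⟨fun z => P ((z - I) / (z + I)), fun z hz => ?_⟩
  have hz' : 0 < z.im := hz
  have hzI : z + I ≠ 0 := by
    intro h; have := congrArg Complex.im h; simp at this; linarith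
  have hmem : (z - I) / (z + I) ∈ ball (0:ℂ) 1 := by
    rw [mem_ball_zero_iff, norm_div, div_lt_one (norm_pos_iff.2 hzI)]
    rw [← sq_lt_sq₀ (norm_nonneg _) (norm_nonneg _), ← Complex.normSq_eq_norm_sq,
      ← Complex.normSq_eq_norm_sq, Complex.normSq_apply, Complex.normSq_apply]
    simp
    nlinarith
  have e1 : 1 - (z - I) / (z + I) = 2 * I / (z + I) := by field_simp; ring
  have e2 : φ ((z - I) / (z + I)) = z := by
    simp only [hφ]; rw [e1]
    have := I_ne_zero
    field_simp; ring
  have hd : HasDerivAt (fun z : ℂ => (z - I) / (z + I)) (2 * I / (z + I) ^ 2) z := by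
    have := ((hasDerivAt_id z).sub_const I).div ((hasDerivAt_id z).add_const I) hzI
    have e : (1 * (id z + I) - (id z - I) * 1) / (id z + I) ^ 2 = 2 * I / (z + I) ^ 2 := by
      simp only [id]; ring
    rw [← e]
    exact this
  have := (hP _ hmem).comp z hd
  beta_reduce at this
  rw [e2, e1] at this
  have e3 : f z * (2 * I / (2 * I / (z + I)) ^ 2) * (2 * I / (z + I) ^ 2) = f z := by
    have := I_ne_zero
    field_simp
  rw [e3] at this
  exact this

/-- Locally constant boundary values. -/
def LC (E : ℂ → ℝ) (a : ℝ) : Prop :=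
  ∃ κ : ℝ, ∀ᶠ x : ℝ in 𝓝 a, Tendsto E (𝓝[UHP] (x:ℂ)) (𝓝 κ)

lemma LC.add {E E' : ℂ → ℝ} {a : ℝ} (h : LC E a) (h' : LC E' a) :
    LC (fun z => E z + E' z) a := by
  obtain ⟨κ, h⟩ := h
  obtain ⟨κ', h'⟩ := h'
  refine ⟨κ + κ', ?_⟩
  filter_upwards [h, h'] with x h1 h2 using h1.add h2

lemma LC.const_mul {E : ℂ → ℝ} {a : ℝ} (h : LC E a) (c : ℝ) : LC (fun z => c * E z) a := by
  obtain ⟨κ, h⟩ := h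
  refine ⟨c * κ, ?_⟩
  filter_upwards [h] with x h1 using h1.const_mul c

lemma LC_log {a x : ℝ} (h : x ≠ a) : LC (fun z => (Complex.log (z - a)).im) x := by
  rcases lt_or_gt_of_ne h with h | h
  · refine ⟨Real.pi, ?_⟩
    filter_upwards [gt_mem_nhds h] with y hy using log_im_tendsto_left hy
  · refine ⟨0, ?_⟩
    filter_upwards [lt_mem_nhds h] with y hy using log_im_tendsto_right hy

lemma seg_const (E : ℂ → ℝ) (A B EA EB : ℝ) (hAB : A < B) (h : ∀ x ∈ Ioo A B, LC E x)
    (hA : Tendsto E (𝓝[UHP] (A:ℂ)) (𝓝 EA)) (hB : Tendsto E (𝓝[UHP] (B:ℂ)) (𝓝 EB)) :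
    EA = EB := by
  set β : ℝ → ℝ := fun x => limUnder (𝓝[UHP] (x:ℂ)) E with hβ
  have hβ1 : ∀ x ∈ Ioo A B, Tendsto E (𝓝[UHP] (x:ℂ)) (𝓝 (β x)) := by
    intro x hx
    obtain ⟨κ, hκ⟩ := h x hx
    exact tendsto_nhds_limUnder ⟨κ, hκ.self_of_nhds⟩
  have hder : ∀ x ∈ Ioo A B, HasDerivAt β 0 x := by
    intro x hx
    obtain ⟨κ, hκ⟩ := h x hx
    apply (hasDerivAt_const x κ).congr_of_eventuallyEq
    filter_upwards [hκ] with y hy using hy.limUnder_eq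
  have hconst : ∀ x ∈ Ioo A B, ∀ x' ∈ Ioo A B, β x = β x' := by
    intro x hx x' hx'
    refine (convex_Ioo A B).is_const_of_fderivWithin_eq_zero (𝕜 := ℝ) (f := β)
      (fun z hz => (hder z hz).differentiableAt.differentiableWithinAt) ?_ hx hx'
    intro z hz
    rw [fderivWithin_of_isOpen isOpen_Ioo hz]
    ext
    simp [(hder z hz).deriv]
  have gen : ∀ C EC : ℝ, C ∈ Icc A B → Tendsto E (𝓝[UHP] (C:ℂ)) (𝓝 EC) →
      EC = β ((A + B) / 2) := by
    intro C EC hC hE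
    have hmid : (A + B) / 2 ∈ Ioo A B := ⟨by linarith, by linarith⟩
    by_contra hne
    have hpos : 0 < |β ((A + B) / 2) - EC| / 2 := by
      have : 0 < |β ((A + B) / 2) - EC| := abs_pos.2 (fun h0 => hne (by linarith))
      positivity
    have hev := (Metric.tendsto_nhds.1 hE) _ hpos
    rw [eventually_nhdsWithin_iff] at hev
    obtain ⟨δ, hδ, hδ'⟩ := Metric.eventually_nhds_iff_ball.1 hev
    obtain ⟨x, hx, hxC⟩ : ∃ x ∈ Ioo A B, |x - C| < δ := by
      have hcl : C ∈ closure (Ioo A B) := by rw [closure_Ioo hAB.ne]; exact hC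
      obtain ⟨x, hx, hd⟩ := Metric.mem_closure_iff.1 hcl δ hδ
      refine ⟨x, hx, ?_⟩
      rw [dist_comm, Real.dist_eq] at hd; exact hd
    have h1 := hβ1 x hx
    rw [hconst x hx _ hmid] at h1
    have h2 : |β ((A + B) / 2) - EC| ≤ |β ((A + B) / 2) - EC| / 2 := by
      apply le_of_tendsto (h1.sub_const EC).abs
      filter_upwards [HB_mem_nhdsWithin hxC] with z hz
      have := hδ' z hz.1 hz.2
      rw [Real.dist_eq] at this
      exact this.le
    linarith
  rw [gen A EA ⟨le_rfl, hAB.le⟩ hA, gen B EB ⟨hAB.le, le_rfl⟩ hB]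

lemma Reg_LC {F P P' : ℂ → ℂ} {a ρ : ℝ} (h : Reg F P a ρ)
    (hd : ∀ x : ℝ, |x - a| < ρ → HasDerivAt P (P' x) x)
    (hr : ∀ x : ℝ, |x - a| < ρ → (P' x).im = 0) : LC (fun z => (F z).im) a := by
  refine ⟨(P a).im, ?_⟩
  have hmem : Ioo (a - ρ) (a + ρ) ∈ 𝓝 a := Ioo_mem_nhds (by linarith [h.1]) (by linarith [h.1])
  have habs : ∀ x ∈ Ioo (a - ρ) (a + ρ), |x - a| < ρ := by
    intro x hx; rw [abs_lt]; constructor <;> linarith [hx.1, hx.2]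
  have hder : ∀ x ∈ Ioo (a - ρ) (a + ρ), HasDerivAt (fun x : ℝ => (P x).im) 0 x := by
    intro x hx
    have h1 : HasDerivAt (fun x : ℝ => P x) (P' x) x := (hd x (habs x hx)).comp_ofReal
    have h2 := Complex.imCLM.hasFDerivAt.comp_hasDerivAt x h1
    have h3 : Complex.imCLM (P' x) = 0 := hr x (habs x hx)
    rw [h3] at h2
    exact h2
  filter_upwards [hmem] with x hx
  have : (P x).im = (P a).im := by
    refine (convex_Ioo (a - ρ) (a + ρ)).is_const_of_fderivWithin_eq_zero (𝕜 := ℝ)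
      (f := fun x : ℝ => (P x).im)
      (fun z hz => (hder z hz).differentiableAt.differentiableWithinAt) ?_ hx (mem_of_mem_nhds hmem)
    intro z hz
    rw [fderivWithin_of_isOpen isOpen_Ioo hz]
    ext
    simp [(hder z hz).deriv]
  rw [← this]
  exact (Complex.continuous_im.tendsto _).comp (h.tendsto (habs x hx))

lemma Reg_prim {f f2 g g2 W : ℂ → ℂ} {a ρ : ℝ} (h : Reg f g a ρ) (h2 : Reg f2 g2 a ρ)
    (hW : ∀ z ∈ UHP, HasDerivAt W (f z * deriv f2 z) z) :
    ∃ P : ℂ → ℂ, Reg W P a ρ ∧ ∀ z ∈ ball (a:ℂ) ρ, HasDerivAt P (g z * deriv g2 z) z := by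
  have hp : DifferentiableOn ℂ (fun ζ => g ζ * deriv g2 ζ) (ball (a:ℂ) ρ) :=
    h.2.1.mul (h2.2.1.deriv isOpen_ball)
  obtain ⟨P, hP⟩ := hp.isExactOn_ball
  obtain ⟨κ, hκ⟩ := const_of_deriv_eq (isOpen_HB a ρ) (convex_HB a ρ)
    (f := W) (g := P) (f' := fun ζ => g ζ * deriv g2 ζ) (by
      intro z hz
      have e : deriv g2 z = deriv f2 z := by
        apply Filter.EventuallyEq.deriv_eq
        filter_upwards [(isOpen_HB a ρ).mem_nhds hz] with ξ hξ using h2.2.2 hξ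
      show HasDerivAt W (g z * deriv g2 z) z
      rw [e, h.2.2 hz]
      exact hW z hz.2) (fun z hz => hP z hz.1)
  have hP2 : ∀ z ∈ ball (a:ℂ) ρ, HasDerivAt (fun z => P z + κ) (g z * deriv g2 z) z :=
    fun z hz => (hP z hz).add_const κ
  refine ⟨fun z => P z + κ, ⟨h.1, ?_, fun z hz => (hκ z hz).symm⟩, hP2⟩
  intro z hz
  exact (hP2 z hz).differentiableAt.differentiableWithinAt

/-- derivative along the reals of a function with constant imaginary part on the reals -/
lemma deriv_im_zero {g : ℂ → ℂ} {a ρ d : ℝ} (hg : DifferentiableOn ℂ g (ball (a:ℂ) ρ))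
    (him : ∀ x : ℝ, |x - a| < ρ → (g x).im = d) {x : ℝ} (hx : |x - a| < ρ) :
    (deriv g x).im = 0 := by
  have hd := (hg.differentiableAt (isOpen_ball.mem_nhds (real_mem_ball.2 hx))).hasDerivAt
  have h2 := Complex.imCLM.hasFDerivAt.comp_hasDerivAt x hd.comp_ofReal
  have h3 : HasDerivAt (fun x : ℝ => (g x).im) 0 x := by
    apply (hasDerivAt_const x d).congr_of_eventuallyEq
    have : {x : ℝ | |x - a| < ρ} ∈ 𝓝 x :=
      (isOpen_lt (by fun_prop) continuous_const).mem_nhds hx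
    filter_upwards [this] with y hy using him y hy
  exact h2.unique h3

lemma deriv_re_zero {g : ℂ → ℂ} {a ρ d : ℝ} (hg : DifferentiableOn ℂ g (ball (a:ℂ) ρ))
    (him : ∀ x : ℝ, |x - a| < ρ → (g x).re = d) {x : ℝ} (hx : |x - a| < ρ) :
    (deriv g x).re = 0 := by
  have hd := (hg.differentiableAt (isOpen_ball.mem_nhds (real_mem_ball.2 hx))).hasDerivAt
  have h2 := Complex.reCLM.hasFDerivAt.comp_hasDerivAt x hd.comp_ofReal
  have h3 : HasDerivAt (fun x : ℝ => (g x).re) 0 x := by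
    apply (hasDerivAt_const x d).congr_of_eventuallyEq
    have : {x : ℝ | |x - a| < ρ} ∈ 𝓝 x :=
      (isOpen_lt (by fun_prop) continuous_const).mem_nhds hx
    filter_upwards [this] with y hy using him y hy
  exact h2.unique h3

/-- Regular points: `W - κ f2` has locally constant imaginary part if `(g-κ) g2'` is real. -/
lemma LC_regular {f f2 g g2 W : ℂ → ℂ} {a ρ : ℝ} (κ : ℂ) (h : Reg f g a ρ) (h2 : Reg f2 g2 a ρ)
    (hW : ∀ z ∈ UHP, HasDerivAt W (f z * deriv f2 z) z)
    (hr : ∀ x : ℝ, |x - a| < ρ → ((g x - κ) * deriv g2 x).im = 0) :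
    LC (fun z => (W z - κ * f2 z).im) a := by
  obtain ⟨P, hP, hPd⟩ := Reg_prim h h2 hW
  have hR : Reg (fun z => W z - κ * f2 z) (fun z => P z - κ * g2 z) a ρ :=
    ⟨h.1, hP.2.1.sub (h2.2.1.const_mul κ), fun z hz => by simp only [hP.2.2 hz, h2.2.2 hz]⟩
  apply Reg_LC (P' := fun z => (g z - κ) * deriv g2 z) hR _ hr
  intro x hx
  have := (hPd x (real_mem_ball.2 hx)).sub ((h2.diffAt (real_mem_ball.2 hx)).hasDerivAt.const_mul κ)
  have e : (g x - κ) * deriv g2 x = g x * deriv g2 x - κ * deriv g2 x := by ring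
  show HasDerivAt _ ((g x - κ) * deriv g2 x) _
  rw [e]
  exact this

/-- Jump points. -/
lemma LC_jump {f f2 g g2 W : ℂ → ℂ} {a ρ d σ : ℝ} (h : Reg f g a ρ)
    (h2 : Reg (fun z => f2 z + (σ : ℂ) * Complex.log (z - a)) g2 a ρ)
    (hf2 : DifferentiableOn ℂ f2 UHP)
    (hW : ∀ z ∈ UHP, HasDerivAt W (f z * deriv f2 z) z)
    (h0 : ∀ x : ℝ, |x - a| < ρ → (g x).im = 0)
    (hd : ∀ x : ℝ, |x - a| < ρ → (g2 x).im = d) :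
    LC (fun z => (W z).im + σ * (g a).re * (Complex.log (z - a)).im) a := by
  have ha : |a - a| < ρ := by simpa using h.1
  have hga : g a = ((g a).re : ℂ) := by
    apply Complex.ext
    · simp
    · simp [h0 a ha]
  set Q : ℂ → ℂ := fun z => g z * deriv g2 z - σ * dslope g a z with hQ
  have hds : DifferentiableOn ℂ (dslope g a) (ball (a:ℂ) ρ) :=
    (Complex.differentiableOn_dslope (isOpen_ball.mem_nhds (mem_ball_self h.1))).2 h.2.1
  have hQd : DifferentiableOn ℂ Q (ball (a:ℂ) ρ) :=
    (h.2.1.mul (h2.2.1.deriv isOpen_ball)).sub (hds.const_mul _)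
  obtain ⟨P, hP⟩ := hQd.isExactOn_ball
  set F : ℂ → ℂ := fun z => W z + ((σ * (g a).re : ℝ) : ℂ) * Complex.log (z - a) with hF
  have hlog : ∀ z ∈ UHP, HasDerivAt (fun z : ℂ => Complex.log (z - a)) (1 / (z - a)) z := by
    intro z hz
    apply ((hasDerivAt_id z).sub_const _).clog
    right
    have : 0 < z.im := hz
    simp [this.ne']
  obtain ⟨κ, hκ⟩ := const_of_deriv_eq (isOpen_HB a ρ) (convex_HB a ρ)
    (f := F) (g := P) (f' := Q) (by
      intro z hz
      have hz' := HB_subset_UHP hz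
      have hne : z - a ≠ 0 := by
        intro h; have := congrArg Complex.im h
        have h1 : 0 < z.im := hz'
        simp at this; linarith
      have e : deriv g2 z = deriv f2 z + σ * (1 / (z - a)) := by
        have e1 : deriv g2 z = deriv (fun z => f2 z + (σ : ℂ) * Complex.log (z - a)) z := by
          apply Filter.EventuallyEq.deriv_eq
          filter_upwards [(isOpen_HB a ρ).mem_nhds hz] with ξ hξ using h2.2.2 hξ
        rw [e1]
        exact (((hf2.differentiableAt (isOpen_UHP.mem_nhds hz')).hasDerivAt).add
          ((hlog z hz').const_mul _)).deriv
      have h3 := (hW z hz').add ((hlog z hz').const_mul (((σ * (g a).re : ℝ) : ℂ)))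
      have e2 : Q z = f z * deriv f2 z + ((σ * (g a).re : ℝ) : ℂ) * (1 / (z - a)) := by
        simp only [hQ]
        rw [dslope_of_ne _ (sub_ne_zero.1 hne), slope_def_field, e, h.2.2 hz, hga]
        push_cast
        simp
        field_simp
        ring
      rw [e2]
      exact h3) (fun z hz => hP z hz.1)
  have hP2 : ∀ z ∈ ball (a:ℂ) ρ, HasDerivAt (fun z => P z + κ) (Q z) z :=
    fun z hz => (hP z hz).add_const κ
  have hR : Reg F (fun z => P z + κ) a ρ :=
    ⟨h.1, fun z hz => (hP2 z hz).differentiableAt.differentiableWithinAt,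
      fun z hz => (hκ z hz).symm⟩
  have key := Reg_LC (P' := Q) hR (fun x hx => hP2 x (real_mem_ball.2 hx)) (by
    intro x hx
    have e1 := deriv_im_zero h2.2.1 hd hx
    have e2 : (dslope g a x).im = 0 := by
      by_cases hxa : x = a
      · rw [hxa, dslope_same]
        exact deriv_im_zero h.2.1 h0 ha
      · have hxa' : (x:ℂ) ≠ a := by exact_mod_cast hxa
        rw [dslope_of_ne _ hxa', slope_def_field, ← Complex.ofReal_sub, Complex.div_ofReal_im]
        simp [h0 x hx, h0 a ha]
    simp only [hQ, sub_im, mul_im, e1, e2, h0 x hx, ofReal_im]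
    ring)
  obtain ⟨κ', hκ'⟩ := key
  refine ⟨κ', ?_⟩
  filter_upwards [hκ'] with x hx
  apply hx.congr
  intro z
  simp only [hF, add_im, Complex.im_ofReal_mul]

structure BV (N : ℕ) (y : ℕ → ℝ) (j : ℕ) (t s : ℝ) (h : ℂ → ℂ) (c : ℝ) (v : ℕ → ℝ) (M : ℝ) :
    Prop where
  hN : 2 ≤ N
  hy : ∀ i j : ℕ, 1 ≤ i → i < j → j ≤ 2 * N → y i < y j
  hj : j = 1 ∨ j = N
  ht : y (2 * j - 1) < t
  hts : t < s
  hs : s < y (2 * j)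
  diff : DifferentiableOn ℂ h UHP
  outer : ∀ p : ℝ, (p < y 1 ∨ y (2 * N) < p) →
    Tendsto (fun z => (h z).re) (𝓝[UHP] (p : ℂ)) (𝓝 0)
  inner : ∀ i : ℕ, 1 ≤ i → i ≤ N - 1 → ∀ p ∈ Set.Ioo (y (2 * i)) (y (2 * i + 1)),
    Tendsto (fun z => (h z).re) (𝓝[UHP] (p : ℂ)) (𝓝 c)
  dir : ∀ i : ℕ, 1 ≤ i → i ≤ N → i ≠ j → ∀ p ∈ Set.Ioo (y (2 * i - 1)) (y (2 * i)),
    Tendsto (fun z => (h z).im) (𝓝[UHP] (p : ℂ)) (𝓝 (v i))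
  win0 : ∀ p : ℝ, (p ∈ Ioo (y (2 * j - 1)) t ∨ p ∈ Ioo s (y (2 * j))) →
    Tendsto (fun z => (h z).im) (𝓝[UHP] (p : ℂ)) (𝓝 0)
  win1 : ∀ p ∈ Ioo t s, Tendsto (fun z => (h z).im) (𝓝[UHP] (p : ℂ)) (𝓝 1)
  v1 : v 1 = 0
  vN : v N = 0
  bdd : ∀ z ∈ UHP, |(h z).im| ≤ M

lemma BV_of_SolvesBVP {N : ℕ} (hN : 2 ≤ N) {y : ℕ → ℝ}
    (hy : ∀ i j : ℕ, 1 ≤ i → i < j → j ≤ 2 * N → y i < y j) {t s : ℝ} {h : ℂ → ℂ}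
    (ht : y (2 * N - 1) < t) (hts : t < s) (hs : s < y (2 * N)) (H : SolvesBVP N y t s h) :
    ∃ c v M, BV N y N t s h c v M := by
  obtain ⟨h1, h2, ⟨c, h3⟩, h4, h5, h6, ⟨M, h7⟩, -⟩ := H
  choose! v hv using h4
  refine ⟨c, fun i => if i = 1 ∨ i = N then 0 else v i, M,
    ⟨hN, hy, Or.inr rfl, ht, hts, hs, h1, h2, h3, ?_, ?_, h6, by simp, by simp, h7⟩⟩
  · intro i hi hiN hij p hp
    by_cases hi1 : i = 1
    · subst hi1
      simp only [true_or, if_true]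
      exact h5 p (Or.inl (Or.inl (by simpa using hp)))
    · rw [if_neg (by tauto)]
      exact hv i hi (by omega) p hp
  · rintro p (hp | hp)
    · exact h5 p (Or.inl (Or.inr hp))
    · exact h5 p (Or.inr hp)

lemma BV_of_SolvesBVP' {N : ℕ} (hN : 2 ≤ N) {y : ℕ → ℝ}
    (hy : ∀ i j : ℕ, 1 ≤ i → i < j → j ≤ 2 * N → y i < y j) {t s : ℝ} {h : ℂ → ℂ}
    (ht : y 1 < t) (hts : t < s) (hs : s < y 2) (H : SolvesBVP' N y t s h) :
    ∃ c v M, BV N y 1 t s h c v M := by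
  obtain ⟨h1, h2, ⟨c, h3⟩, h4, h5, h6, ⟨M, h7⟩, -⟩ := H
  choose! v hv using h4
  refine ⟨c, fun i => if i = 1 ∨ i = N then 0 else v i, M,
    ⟨hN, hy, Or.inl rfl, ht, hts, hs, h1, h2, h3, ?_, ?_, h6, by simp, by simp, h7⟩⟩
  · intro i hi hiN hij p hp
    by_cases hi1 : i = N
    · subst hi1
      simp only [or_true, if_true]
      exact h5 p (Or.inl (Or.inl (by simpa using hp)))
    · rw [if_neg (by tauto)]
      exact hv i (by omega) (by omega) p hp
  · rintro p (hp | hp)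
    · exact h5 p (Or.inl (Or.inr hp))
    · exact h5 p (Or.inr hp)

lemma exists_radius {A B a : ℝ} (h : a ∈ Ioo A B) :
    ∃ r : ℝ, 0 < r ∧ ∀ x : ℝ, |x - a| < r → x ∈ Ioo A B := by
  refine ⟨min (a - A) (B - a), lt_min (by linarith [h.1]) (by linarith [h.2]), fun x hx => ?_⟩
  rw [lt_min_iff, abs_lt, abs_lt] at hx
  constructor <;> linarith [hx.1.1, hx.2.2]

namespace BV
variable {N : ℕ} {y : ℕ → ℝ} {j : ℕ} {t s : ℝ} {h : ℂ → ℂ} {c : ℝ} {v : ℕ → ℝ} {M : ℝ}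

lemma vj (B : BV N y j t s h c v M) : v j = 0 := by
  rcases B.hj with h | h
  · rw [h]; exact B.v1
  · rw [h]; exact B.vN

lemma j_range (B : BV N y j t s h c v M) : 1 ≤ j ∧ j ≤ N := by
  have := B.hN
  rcases B.hj with h | h <;> omega

lemma bddHB (B : BV N y j t s h c v M) (a r : ℝ) : ∀ z ∈ HB a r, |(h z).im| ≤ M :=
  fun z hz => B.bdd z (HB_subset_UHP hz)

lemma regN (B : BV N y j t s h c v M) {i : ℕ} (hi : 1 ≤ i) (hi' : i ≤ N - 1) {a : ℝ}
    (ha : a ∈ Ioo (y (2 * i)) (y (2 * i + 1))) :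
    ∃ (g : ℂ → ℂ) (ρ : ℝ), Reg h g a ρ ∧ ∀ z ∈ ball (a:ℂ) ρ, g (conj z) = 2 * c - conj (g z) := by
  obtain ⟨r, hr, hr'⟩ := exists_radius ha
  exact lemma_N a r M c hr h (B.diff.mono HB_subset_UHP) (B.bddHB a r)
    (fun x _ hx => B.inner i hi hi' x (hr' x hx))

lemma regD (B : BV N y j t s h c v M) {i : ℕ} (hi : 1 ≤ i) (hi' : i ≤ N) (hij : i ≠ j) {a : ℝ}
    (ha : a ∈ Ioo (y (2 * i - 1)) (y (2 * i))) :
    ∃ (g : ℂ → ℂ) (ρ : ℝ), Reg h g a ρ ∧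
      ∀ z ∈ ball (a:ℂ) ρ, g (conj z) = conj (g z) + 2 * (v i) * I := by
  obtain ⟨r, hr, hr'⟩ := exists_radius ha
  obtain ⟨g, hg⟩ := lemma_D a r M (v i) hr h (B.diff.mono HB_subset_UHP) (B.bddHB a r)
    (fun x _ hx => B.dir i hi hi' hij x (hr' x hx))
  exact ⟨g, _, hg⟩

lemma regD0 (B : BV N y j t s h c v M) {a : ℝ}
    (ha : a ∈ Ioo (y (2 * j - 1)) (y (2 * j))) (hat : a ≠ t) (has : a ≠ s) :
    ∃ (g : ℂ → ℂ) (ρ d : ℝ), (d = 0 ∨ d = 1) ∧ Reg h g a ρ ∧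
      ∀ z ∈ ball (a:ℂ) ρ, g (conj z) = conj (g z) + 2 * d * I := by
  have hd := B.diff
  rcases lt_or_gt_of_ne hat with h1 | h1
  · obtain ⟨r, hr, hr'⟩ := exists_radius (show a ∈ Ioo (y (2 * j - 1)) t from ⟨ha.1, h1⟩)
    obtain ⟨g, hg⟩ := lemma_D a r M 0 hr h (B.diff.mono HB_subset_UHP) (B.bddHB a r)
      (fun x _ hx => B.win0 x (Or.inl (hr' x hx)))
    exact ⟨g, _, 0, Or.inl rfl, hg⟩
  rcases lt_or_gt_of_ne has with h2 | h2
  · obtain ⟨r, hr, hr'⟩ := exists_radius (show a ∈ Ioo t s from ⟨h1, h2⟩)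
    obtain ⟨g, hg⟩ := lemma_D a r M 1 hr h (B.diff.mono HB_subset_UHP) (B.bddHB a r)
      (fun x _ hx => B.win1 x (hr' x hx))
    exact ⟨g, _, 1, Or.inr rfl, hg⟩
  · obtain ⟨r, hr, hr'⟩ := exists_radius (show a ∈ Ioo s (y (2 * j)) from ⟨h2, ha.2⟩)
    obtain ⟨g, hg⟩ := lemma_D a r M 0 hr h (B.diff.mono HB_subset_UHP) (B.bddHB a r)
      (fun x _ hx => B.win0 x (Or.inr (hr' x hx)))
    exact ⟨g, _, 0, Or.inl rfl, hg⟩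

lemma regt (B : BV N y j t s h c v M) :
    ∃ (g : ℂ → ℂ) (ρ : ℝ),
      Reg (fun z => h z + ((1 / Real.pi : ℝ) : ℂ) * Complex.log (z - t)) g t ρ ∧
      ∀ x : ℝ, |x - t| < ρ → (g x).im = 1 := by
  obtain ⟨r, hr, hr'⟩ := exists_radius (show t ∈ Ioo (y (2 * j - 1)) s from ⟨B.ht, B.hts⟩)
  obtain ⟨g, hg1, hg2⟩ := lemma_T t r M 0 1 hr h (B.diff.mono HB_subset_UHP) (B.bddHB t r)
    (fun x h1 hx => B.win0 x (Or.inl ⟨(hr' x hx).1, h1⟩))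
    (fun x h1 hx => B.win1 x ⟨h1, (hr' x hx).2⟩)
  rw [sub_zero] at hg1
  exact ⟨g, _, hg1, fun x hx => im_of_symm hg2 hx⟩

lemma regs (B : BV N y j t s h c v M) :
    ∃ (g : ℂ → ℂ) (ρ : ℝ),
      Reg (fun z => h z + ((-1 / Real.pi : ℝ) : ℂ) * Complex.log (z - s)) g s ρ ∧
      ∀ x : ℝ, |x - s| < ρ → (g x).im = 0 := by
  obtain ⟨r, hr, hr'⟩ := exists_radius (show s ∈ Ioo t (y (2 * j)) from ⟨B.hts, B.hs⟩)
  obtain ⟨g, hg1, hg2⟩ := lemma_T s r M 1 0 hr h (B.diff.mono HB_subset_UHP) (B.bddHB s r)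
    (fun x h1 hx => B.win1 x ⟨(hr' x hx).1, h1⟩)
    (fun x h1 hx => B.win0 x (Or.inr ⟨h1, (hr' x hx).2⟩))
  rw [zero_sub] at hg1
  exact ⟨g, _, hg1, fun x hx => im_of_symm hg2 hx⟩

lemma regYl (B : BV N y j t s h c v M) {i : ℕ} (hi : 1 ≤ i) (hi' : i ≤ N) :
    ∃ (K : ℂ → ℂ) (ρ : ℝ), RegY h K (y (2 * i - 1)) ρ ∧
      K 0 = ((if i = 1 then 0 else c : ℝ) : ℂ) + (v i) * I := by
  obtain ⟨A, hA, hA'⟩ : ∃ A < y (2 * i - 1), ∀ x ∈ Ioo A (y (2 * i - 1)),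
      Tendsto (fun z => (h z).re) (𝓝[UHP] (x : ℂ)) (𝓝 (if i = 1 then 0 else c : ℝ)) := by
    by_cases h1 : i = 1
    · subst h1
      refine ⟨y 1 - 1, by simp, fun x hx => ?_⟩
      simp only [if_true]
      exact B.outer x (Or.inl (by simpa using hx.2))
    · refine ⟨y (2 * (i - 1)), B.hy _ _ (by omega) (by omega) (by omega), fun x hx => ?_⟩
      rw [if_neg h1]
      apply B.inner (i - 1) (by omega) (by omega) x
      have : 2 * (i - 1) + 1 = 2 * i - 1 := by omega
      rw [this]; exact hx
  obtain ⟨A2, hA2, hA2'⟩ : ∃ A > y (2 * i - 1), ∀ x ∈ Ioo (y (2 * i - 1)) A,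
      Tendsto (fun z => (h z).im) (𝓝[UHP] (x : ℂ)) (𝓝 (v i)) := by
    by_cases h1 : i = j
    · subst h1
      refine ⟨t, B.ht, fun x hx => ?_⟩
      rw [B.vj]; exact B.win0 x (Or.inl hx)
    · exact ⟨y (2 * i), B.hy _ _ (by omega) (by omega) (by omega),
        fun x hx => B.dir i hi hi' h1 x hx⟩
  obtain ⟨r, hr, hr'⟩ := exists_radius (show y (2 * i - 1) ∈ Ioo A A2 from ⟨hA, hA2⟩)
  exact lemma_Y_left _ r M _ _ hr h (B.diff.mono HB_subset_UHP) (B.bddHB _ r)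
    (fun x h1 hx => hA' x ⟨(hr' x hx).1, h1⟩) (fun x h1 hx => hA2' x ⟨h1, (hr' x hx).2⟩)

lemma regYr (B : BV N y j t s h c v M) {i : ℕ} (hi : 1 ≤ i) (hi' : i ≤ N) :
    ∃ (K : ℂ → ℂ) (ρ : ℝ), RegY h K (y (2 * i)) ρ ∧
      K 0 = ((if i = N then 0 else c : ℝ) : ℂ) + (v i) * I := by
  obtain ⟨A, hA, hA'⟩ : ∃ A > y (2 * i), ∀ x ∈ Ioo (y (2 * i)) A,
      Tendsto (fun z => (h z).re) (𝓝[UHP] (x : ℂ)) (𝓝 (if i = N then 0 else c : ℝ)) := by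
    by_cases h1 : i = N
    · subst h1
      refine ⟨y (2 * i) + 1, by simp, fun x hx => ?_⟩
      simp only [if_true]
      exact B.outer x (Or.inr (by simpa using hx.1))
    · refine ⟨y (2 * i + 1), B.hy _ _ (by omega) (by omega) (by omega), fun x hx => ?_⟩
      rw [if_neg h1]
      exact B.inner i (by omega) (by omega) x hx
  obtain ⟨A2, hA2, hA2'⟩ : ∃ A < y (2 * i), ∀ x ∈ Ioo A (y (2 * i)),
      Tendsto (fun z => (h z).im) (𝓝[UHP] (x : ℂ)) (𝓝 (v i)) := by
    by_cases h1 : i = j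
    · subst h1
      refine ⟨s, B.hs, fun x hx => ?_⟩
      rw [B.vj]; exact B.win0 x (Or.inr hx)
    · exact ⟨y (2 * i - 1), B.hy _ _ (by omega) (by omega) (by omega),
        fun x hx => B.dir i hi hi' h1 x hx⟩
  obtain ⟨r, hr, hr'⟩ := exists_radius (show y (2 * i) ∈ Ioo A2 A from ⟨hA2, hA⟩)
  exact lemma_Y_right _ r M _ _ hr h (B.diff.mono HB_subset_UHP) (B.bddHB _ r)
    (fun x h1 hx => hA' x ⟨h1, (hr' x hx).2⟩) (fun x h1 hx => hA2' x ⟨(hr' x hx).1, h1⟩)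

end BV

/-- The inversion `z ↦ w - 1/z`. -/
def inv' (w : ℝ) (z : ℂ) : ℂ := w - 1 / z

lemma inv'_mem {w : ℝ} {z : ℂ} (hz : z ∈ UHP) : inv' w z ∈ UHP := by
  have hz' : 0 < z.im := hz
  have h0 : z ≠ 0 := by rintro rfl; simp at hz'
  rw [mem_UHP]
  have h2 : 0 < Complex.normSq z := Complex.normSq_pos.2 h0
  have : (inv' w z).im = z.im / Complex.normSq z := by
    simp [inv', Complex.inv_im, neg_div]
  rw [this]; positivity

lemma inv'_hasDerivAt {w : ℝ} {z : ℂ} (hz : z ≠ 0) : HasDerivAt (inv' w) (1 / z ^ 2) z := by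
  have := ((hasDerivAt_inv hz)).const_sub (w:ℂ)
  have e : inv' w = fun z => (w:ℂ) - z⁻¹ := by funext z; simp [inv']
  rw [e]
  simpa using this

lemma UHP_ne_zero {z : ℂ} (hz : z ∈ UHP) : z ≠ 0 := by
  rintro rfl; rw [mem_UHP] at hz; simp at hz

lemma inv'_tendsto {w x : ℝ} (hx : x ≠ 0) :
    Tendsto (inv' w) (𝓝[UHP] (x:ℂ)) (𝓝[UHP] ((w - 1 / x : ℝ) : ℂ)) := by
  rw [tendsto_nhdsWithin_iff]
  constructor
  · have h1 : ContinuousAt (inv' w) (x:ℂ) :=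
      (inv'_hasDerivAt (by exact_mod_cast hx)).continuousAt
    have := h1.tendsto.mono_left (nhdsWithin_le_nhds (s := UHP))
    simpa [inv'] using this
  · filter_upwards [self_mem_nhdsWithin] with z hz using inv'_mem hz

lemma BV.regInf {N : ℕ} {y : ℕ → ℝ} {j : ℕ} {t s : ℝ} {h : ℂ → ℂ} {c : ℝ} {v : ℕ → ℝ} {M : ℝ}
    (B : BV N y j t s h c v M) {w : ℝ} (h1 : y 1 < w) (h2 : w < y (2 * N)) {x0 : ℝ}
    (hx0 : x0 ∈ Ioo (-(1 / (y (2 * N) - w))) (1 / (w - y 1))) :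
    ∃ (g : ℂ → ℂ) (ρ : ℝ), Reg (fun z => h (inv' w z)) g x0 ρ ∧
      ∀ z ∈ ball (x0:ℂ) ρ, g (conj z) = 2 * (0:ℝ) - conj (g z) := by
  obtain ⟨r, hr, hr'⟩ : ∃ r : ℝ, 0 < r ∧ ∀ x : ℝ, x ≠ x0 → |x - x0| < r →
      x ∈ Ioo (-(1 / (y (2 * N) - w))) (1 / (w - y 1)) ∧ x ≠ 0 := by
    obtain ⟨r, hr, hr'⟩ := exists_radius hx0
    by_cases h0 : x0 = 0
    · exact ⟨r, hr, fun x hx hxr => ⟨hr' x hxr, by rw [h0] at hx; exact hx⟩⟩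
    · refine ⟨min r |x0|, lt_min hr (abs_pos.2 h0), fun x hx hxr => ?_⟩
      rw [lt_min_iff] at hxr
      refine ⟨hr' x hxr.1, ?_⟩
      rintro rfl
      rw [zero_sub, abs_neg] at hxr
      exact lt_irrefl _ hxr.2
  apply lemma_N x0 r M 0 hr
  · intro z hz
    have hz' := HB_subset_UHP hz
    exact ((B.diff.differentiableAt (isOpen_UHP.mem_nhds (inv'_mem hz'))).comp z
      (inv'_hasDerivAt (UHP_ne_zero hz')).differentiableAt).differentiableWithinAt
  · intro z hz
    exact B.bdd _ (inv'_mem (HB_subset_UHP hz))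
  · intro x hx hxr
    obtain ⟨⟨h3, h4⟩, h5⟩ := hr' x hx hxr
    refine (B.outer (w - 1 / x) ?_).comp (inv'_tendsto h5)
    rcases lt_or_gt_of_ne h5 with h6 | h6
    · right
      have : 1 / (y (2 * N) - w) > -x := by linarith
      have h7 : 0 < y (2 * N) - w := by linarith
      rw [gt_iff_lt, lt_div_iff₀ h7] at this
      have h8 : y (2 * N) - w < 1 / (-x) := by rw [lt_div_iff₀ (by linarith)]; linarith
      have h9 : 1 / (-x) = - (1 / x) := by rw [one_div_neg_eq_neg_one_div]
      linarith
    · left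
      have h7 : 0 < w - y 1 := by linarith
      rw [lt_div_iff₀ h7] at h4
      have h8 : w - y 1 < 1 / x := by rw [lt_div_iff₀ h6]; linarith
      linarith

lemma green_window {N : ℕ} {y : ℕ → ℝ} {j : ℕ} {t s : ℝ} {f f2 W : ℂ → ℂ} {c : ℝ} {v : ℕ → ℝ}
    {M : ℝ} (B : BV N y j t s f2 c v M)
    (hf : ∀ a ∈ Ioo (y (2 * j - 1)) (y (2 * j)), ∃ g ρ, Reg f g a ρ ∧
      ∀ x : ℝ, |x - a| < ρ → (g x).im = 0)
    (hW : ∀ z ∈ UHP, HasDerivAt W (f z * deriv f2 z) z) {ωA ωB : ℂ} {a1 a2 : ℝ}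
    (hA : Tendsto W (𝓝[UHP] (y (2 * j - 1) : ℂ)) (𝓝 ωA))
    (hB : Tendsto W (𝓝[UHP] (y (2 * j) : ℂ)) (𝓝 ωB))
    (h1 : Tendsto (fun z => (f z).re) (𝓝[UHP] (t : ℂ)) (𝓝 a1))
    (h2 : Tendsto (fun z => (f z).re) (𝓝[UHP] (s : ℂ)) (𝓝 a2)) :
    ωB.im - ωA.im = a1 - a2 := by
  have hAB : y (2 * j - 1) < y (2 * j) := B.ht.trans (B.hts.trans B.hs)
  have htm : t ∈ Ioo (y (2 * j - 1)) (y (2 * j)) := ⟨B.ht, B.hts.trans B.hs⟩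
  have hsm : s ∈ Ioo (y (2 * j - 1)) (y (2 * j)) := ⟨B.ht.trans B.hts, B.hs⟩
  have key := seg_const
    (fun z => (W z).im + (1 / Real.pi) * a1 * (Complex.log (z - t)).im
      + (-1 / Real.pi) * a2 * (Complex.log (z - s)).im)
    (y (2 * j - 1)) (y (2 * j)) (ωA.im + (1 / Real.pi) * a1 * Real.pi
      + (-1 / Real.pi) * a2 * Real.pi)
    (ωB.im + (1 / Real.pi) * a1 * 0 + (-1 / Real.pi) * a2 * 0) hAB ?_ ?_ ?_
  · have hpi := Real.pi_ne_zero
    field_simp at key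
    nlinarith [Real.pi_pos, key]
  · intro x hx
    by_cases hxt : x = t
    · subst hxt
      obtain ⟨g, ρ, hr, hg0⟩ := hf x hx
      obtain ⟨g2, ρ2, hr2, hg2⟩ := B.regt
      have hm : 0 < min ρ ρ2 := lt_min hr.1 hr2.1
      have e : (g x).re = a1 := by
        have := (Complex.continuous_re.tendsto _).comp (hr.tendsto (x := x) (by simpa using hr.1))
        exact tendsto_nhds_unique this h1
      have := LC_jump (hr.mono hm (min_le_left _ _)) (hr2.mono hm (min_le_right _ _)) B.diff hW
        (fun x hx => hg0 x (hx.trans_le (min_le_left _ _)))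
        (fun x hx => hg2 x (hx.trans_le (min_le_right _ _)))
      rw [e] at this
      exact this.add ((LC_log B.hts.ne).const_mul _)
    by_cases hxs : x = s
    · subst hxs
      obtain ⟨g, ρ, hr, hg0⟩ := hf x hx
      obtain ⟨g2, ρ2, hr2, hg2⟩ := B.regs
      have hm : 0 < min ρ ρ2 := lt_min hr.1 hr2.1
      have e : (g x).re = a2 := by
        have := (Complex.continuous_re.tendsto _).comp (hr.tendsto (x := x) (by simpa using hr.1))
        exact tendsto_nhds_unique this h2
      have := LC_jump (hr.mono hm (min_le_left _ _)) (hr2.mono hm (min_le_right _ _)) B.diff hW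
        (fun x hx => hg0 x (hx.trans_le (min_le_left _ _)))
        (fun x hx => hg2 x (hx.trans_le (min_le_right _ _)))
      rw [e] at this
      have h3 := this.add ((LC_log (a := t) (x := x) B.hts.ne').const_mul (1 / Real.pi * a1))
      refine (congrArg (fun E => LC E x) ?_).mp h3
      funext z; ring
    · obtain ⟨g, ρ, hr, hg0⟩ := hf x hx
      obtain ⟨g2, ρ2, d, -, hr2, hg2⟩ := B.regD0 hx hxt hxs
      have hm : 0 < min ρ ρ2 := lt_min hr.1 hr2.1
      have h3 := LC_regular 0 (hr.mono hm (min_le_left _ _)) (hr2.mono hm (min_le_right _ _)) hW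
        (fun x hx => by
          rw [sub_zero, Complex.mul_im, hg0 x (hx.trans_le (min_le_left _ _)),
            deriv_im_zero hr2.2.1 (fun x hx => im_of_symm hg2 hx) (hx.trans_le (min_le_right _ _))]
          ring)
      have h4 := (h3.add ((LC_log hxt).const_mul (1 / Real.pi * a1))).add
        ((LC_log hxs).const_mul (-1 / Real.pi * a2))
      refine (congrArg (fun E => LC E x) ?_).mp h4
      funext z; simp
  · exact (((Complex.continuous_im.tendsto _).comp hA).add
      ((log_im_tendsto_left htm.1).const_mul _)).add ((log_im_tendsto_left hsm.1).const_mul _)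
  · exact (((Complex.continuous_im.tendsto _).comp hB).add
      ((log_im_tendsto_right htm.2).const_mul _)).add ((log_im_tendsto_right hsm.2).const_mul _)

/-- Generic segment lemma. -/
lemma green_seg {A B : ℝ} (hAB : A < B) {f f2 W : ℂ → ℂ} (κ : ℂ)
    (hreg : ∀ a ∈ Ioo A B, ∃ g g2 ρ ρ2, Reg f g a ρ ∧ Reg f2 g2 a ρ2 ∧
      ∀ x : ℝ, |x - a| < ρ → |x - a| < ρ2 → ((g x - κ) * deriv g2 x).im = 0)
    (hW : ∀ z ∈ UHP, HasDerivAt W (f z * deriv f2 z) z) {ωA ωB eA eB : ℂ}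
    (hA : Tendsto W (𝓝[UHP] (A : ℂ)) (𝓝 ωA))
    (hB : Tendsto W (𝓝[UHP] (B : ℂ)) (𝓝 ωB))
    (hA2 : Tendsto f2 (𝓝[UHP] (A : ℂ)) (𝓝 eA))
    (hB2 : Tendsto f2 (𝓝[UHP] (B : ℂ)) (𝓝 eB)) :
    (ωA - κ * eA).im = (ωB - κ * eB).im := by
  refine seg_const (fun z => (W z - κ * f2 z).im) A B _ _ hAB ?_ ?_ ?_
  · intro a ha
    obtain ⟨g, g2, ρ, ρ2, hr, hr2, h⟩ := hreg a ha
    have hm : 0 < min ρ ρ2 := lt_min hr.1 hr2.1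
    exact LC_regular κ (hr.mono hm (min_le_left _ _)) (hr2.mono hm (min_le_right _ _)) hW
      (fun x hx => h x (hx.trans_le (min_le_left _ _)) (hx.trans_le (min_le_right _ _)))
  · exact (Complex.continuous_im.tendsto _).comp (hA.sub (hA2.const_mul κ))
  · exact (Complex.continuous_im.tendsto _).comp (hB.sub (hB2.const_mul κ))

theorem green {N : ℕ} {y : ℕ → ℝ} {t s t' s' : ℝ} {h h' : ℂ → ℂ} {c c' : ℝ} {v v' : ℕ → ℝ}
    {M M' : ℝ} (B : BV N y N t s h c v M) (B' : BV N y 1 t' s' h' c' v' M') {a1 a2 b1 b2 : ℝ}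
    (ha1 : Tendsto (fun z => (h z).re) (𝓝[UHP] (t' : ℂ)) (𝓝 a1))
    (ha2 : Tendsto (fun z => (h z).re) (𝓝[UHP] (s' : ℂ)) (𝓝 a2))
    (hb1 : Tendsto (fun z => (h' z).re) (𝓝[UHP] (t : ℂ)) (𝓝 b1))
    (hb2 : Tendsto (fun z => (h' z).re) (𝓝[UHP] (s : ℂ)) (𝓝 b2)) :
    a2 - a1 = b2 - b1 := by
  have hN := B.hN
  have hN1 : N ≠ 1 := by omega
  have d1 : ∀ z ∈ UHP, HasDerivAt h (deriv h z) z := fun z hz =>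
    (B.diff.differentiableAt (isOpen_UHP.mem_nhds hz)).hasDerivAt
  have d2 : ∀ z ∈ UHP, HasDerivAt h' (deriv h' z) z := fun z hz =>
    (B'.diff.differentiableAt (isOpen_UHP.mem_nhds hz)).hasDerivAt
  obtain ⟨W, hW⟩ := uhp_primitive (fun z => h z * deriv h' z)
    (B.diff.mul (B'.diff.deriv isOpen_UHP))
  -- limits at the corner points
  have hL : ∀ i, 1 ≤ i → i ≤ N → ∃ L, Tendsto W (𝓝[UHP] (y (2 * i - 1) : ℂ)) (𝓝 L) := by
    intro i hi hi'
    obtain ⟨K, ρ, hK, -⟩ := B.regYl hi hi'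
    obtain ⟨K', ρ', hK', -⟩ := B'.regYl hi hi'
    exact RegY_prim hK hK' B'.diff hW
  have hR : ∀ i, 1 ≤ i → i ≤ N → ∃ L, Tendsto W (𝓝[UHP] (y (2 * i) : ℂ)) (𝓝 L) := by
    intro i hi hi'
    obtain ⟨K, ρ, hK, -⟩ := B.regYr hi hi'
    obtain ⟨K', ρ', hK', -⟩ := B'.regYr hi hi'
    exact RegY_prim hK hK' B'.diff hW
  choose! P hP using hL
  choose! Q hQ using hR
  have hl : ∀ i, 1 ≤ i → i ≤ N → Tendsto h (𝓝[UHP] (y (2 * i - 1) : ℂ))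
      (𝓝 (((if i = 1 then 0 else c : ℝ) : ℂ) + v i * I)) := by
    intro i hi hi'
    obtain ⟨K, ρ, hK, e⟩ := B.regYl hi hi'
    rw [← e]; exact hK.tendsto
  have hr : ∀ i, 1 ≤ i → i ≤ N → Tendsto h (𝓝[UHP] (y (2 * i) : ℂ))
      (𝓝 (((if i = N then 0 else c : ℝ) : ℂ) + v i * I)) := by
    intro i hi hi'
    obtain ⟨K, ρ, hK, e⟩ := B.regYr hi hi'
    rw [← e]; exact hK.tendsto
  have hl' : ∀ i, 1 ≤ i → i ≤ N → Tendsto h' (𝓝[UHP] (y (2 * i - 1) : ℂ))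
      (𝓝 (((if i = 1 then 0 else c' : ℝ) : ℂ) + v' i * I)) := by
    intro i hi hi'
    obtain ⟨K, ρ, hK, e⟩ := B'.regYl hi hi'
    rw [← e]; exact hK.tendsto
  have hr' : ∀ i, 1 ≤ i → i ≤ N → Tendsto h' (𝓝[UHP] (y (2 * i) : ℂ))
      (𝓝 (((if i = N then 0 else c' : ℝ) : ℂ) + v' i * I)) := by
    intro i hi hi'
    obtain ⟨K, ρ, hK, e⟩ := B'.regYr hi hi'
    rw [← e]; exact hK.tendsto
  -- inner Dirichlet
  have eD : ∀ i, 2 ≤ i → i ≤ N - 1 → (P i).im = (Q i).im := by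
    intro i hi hi'
    have := green_seg (B.hy (2 * i - 1) (2 * i) (by omega) (by omega) (by omega)) (v i * I)
      (fun a ha => by
        obtain ⟨g, ρ, hg, hs⟩ := B.regD (i := i) (by omega) (by omega) (by omega) ha
        obtain ⟨g2, ρ2, hg2, hs2⟩ := B'.regD (i := i) (by omega) (by omega) (by omega) ha
        refine ⟨g, g2, ρ, ρ2, hg, hg2, fun x hx hx2 => ?_⟩
        rw [Complex.mul_im, deriv_im_zero hg2.2.1 (fun x hx => im_of_symm hs2 hx) hx2,
          Complex.sub_im, im_of_symm hs hx]
        simp) hW (hP i (by omega) (by omega)) (hQ i (by omega) (by omega))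
        (hl' i (by omega) (by omega)) (hr' i (by omega) (by omega))
    rw [if_neg (by omega), if_neg (by omega)] at this
    simpa using this
  -- Neumann
  have eN : ∀ i, 1 ≤ i → i ≤ N - 1 → (P (i + 1)).im - (Q i).im = c * (v' (i + 1) - v' i) := by
    intro i hi hi'
    have e1 : 2 * (i + 1) - 1 = 2 * i + 1 := by omega
    have hP1 := hP (i + 1) (by omega) (by omega)
    have hl1 := hl' (i + 1) (by omega) (by omega)
    rw [e1] at hP1 hl1
    have := green_seg (B.hy (2 * i) (2 * i + 1) (by omega) (by omega) (by omega)) (c : ℂ)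
      (fun a ha => by
        obtain ⟨g, ρ, hg, hs⟩ := B.regN (i := i) (by omega) (by omega) ha
        obtain ⟨g2, ρ2, hg2, hs2⟩ := B'.regN (i := i) (by omega) (by omega) ha
        refine ⟨g, g2, ρ, ρ2, hg, hg2, fun x hx hx2 => ?_⟩
        rw [Complex.mul_im, deriv_re_zero hg2.2.1 (fun x hx => re_of_symm hs2 hx) hx2,
          Complex.sub_re, re_of_symm hs hx]
        simp) hW (hQ i (by omega) (by omega)) hP1
        (hr' i (by omega) (by omega)) hl1
    simp at this
    linarith
  -- outer
  have eO : (P 1).im = (Q N).im := by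
    have hw1 := B'.ht
    have hw2 : t' < y (2 * N) := (B'.hts.trans B'.hs).trans (B.hy _ _ (by omega) (by omega) le_rfl)
    simp only [mul_one, Nat.reduceSub] at hw1
    have p1 : 0 < t' - y 1 := by linarith
    have p2 : 0 < y (2 * N) - t' := by linarith
    have q1 : 0 < 1 / (t' - y 1) := by positivity
    have q2 : 0 < 1 / (y (2 * N) - t') := by positivity
    have hV : ∀ z ∈ UHP, HasDerivAt (fun z => W (inv' t' z))
        (h (inv' t' z) * deriv (fun z => h' (inv' t' z)) z) z := by
      intro z hz
      have i1 := inv'_hasDerivAt (w := t') (UHP_ne_zero hz)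
      have i2 := (d2 _ (inv'_mem (w := t') hz)).comp z i1
      have i3 := (hW _ (inv'_mem (w := t') hz)).comp z i1
      have e : deriv (fun z => h' (inv' t' z)) z = deriv h' (inv' t' z) * (1 / z ^ 2) := i2.deriv
      rw [e, ← mul_assoc]
      exact i3
    have tA := inv'_tendsto (w := t') (x := -(1 / (y (2 * N) - t'))) (by linarith)
    have tB := inv'_tendsto (w := t') (x := 1 / (t' - y 1)) (by linarith)
    have eA : t' - 1 / -(1 / (y (2 * N) - t')) = y (2 * N) := by field_simp; ring
    have eB : t' - 1 / (1 / (t' - y 1)) = y (2 * 1 - 1) := by simp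
    rw [eA] at tA
    rw [eB] at tB
    have := green_seg (A := -(1 / (y (2 * N) - t'))) (B := 1 / (t' - y 1)) (by linarith)
      (f := fun z => h (inv' t' z)) (f2 := fun z => h' (inv' t' z)) 0
      (fun a ha => by
        obtain ⟨g, ρ, hg, hs⟩ := B.regInf hw1 hw2 ha
        obtain ⟨g2, ρ2, hg2, hs2⟩ := B'.regInf hw1 hw2 ha
        refine ⟨g, g2, ρ, ρ2, hg, hg2, fun x hx hx2 => ?_⟩
        rw [sub_zero, Complex.mul_im, deriv_re_zero hg2.2.1 (fun x hx => re_of_symm hs2 hx) hx2,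
          re_of_symm hs hx]
        simp) hV ((hQ N (by omega) le_rfl).comp tA) ((hP 1 le_rfl (by omega)).comp tB)
        ((hr' N (by omega) le_rfl).comp tA) ((hl' 1 le_rfl (by omega)).comp tB)
    simp at this
    exact this.symm
  -- windows
  have w1 : (Q 1).im - (P 1).im = a1 - a2 :=
    green_window B' (fun a ha => by
        obtain ⟨g, ρ, hg, hs⟩ := B.regD (i := 1) le_rfl (by omega) (by omega) ha
        exact ⟨g, ρ, hg, fun x hx => by rw [im_of_symm hs hx, B.v1]⟩) hW
      (hP 1 le_rfl (by omega)) (hQ 1 le_rfl (by omega)) ha1 ha2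
  have w2 : -(Q N).im + (P N).im = b1 - b2 := by
    have hV : ∀ z ∈ UHP, HasDerivAt (fun z => h z * h' z - W z) (h' z * deriv h z) z := by
      intro z hz
      have := ((d1 z hz).mul (d2 z hz)).sub (hW z hz)
      have e : h' z * deriv h z = deriv h z * h' z + h z * deriv h' z - h z * deriv h' z := by ring
      rw [e]; exact this
    have := green_window B (fun a ha => by
        obtain ⟨g, ρ, hg, hs⟩ := B'.regD (i := N) (by omega) (by omega) (by omega) ha
        exact ⟨g, ρ, hg, fun x hx => by rw [im_of_symm hs hx, B'.vN]⟩) hV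
      (((hl N (by omega) le_rfl).mul (hl' N (by omega) le_rfl)).sub (hP N (by omega) le_rfl))
      (((hr N (by omega) le_rfl).mul (hr' N (by omega) le_rfl)).sub (hQ N (by omega) le_rfl))
      hb1 hb2
    rw [B.vN, B'.vN] at this
    simp [hN1] at this
    linarith
  -- telescoping
  have tel : ∀ i, 1 ≤ i → i ≤ N - 1 → (Q i).im - c * v' i = (Q 1).im - c * v' 1 := by
    intro i hi
    induction i, hi using Nat.le_induction with
    | base => intro _; rfl
    | succ n hn ih =>
      intro hn'
      have := ih (by omega)
      have a := eN n hn (by omega)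
      have b := eD (n + 1) (by omega) hn'
      linarith
  have a := tel (N - 1) (by omega) le_rfl
  have b := eN (N - 1) (by omega) le_rfl
  rw [show N - 1 + 1 = N by omega, B'.vN] at b
  rw [B'.v1] at a
  linarith

lemma const_of_min_im {U : Set ℂ} (hU : IsOpen U) (hc : IsPreconnected U) {f : ℂ → ℂ}
    (hf : DifferentiableOn ℂ f U) {a : ℂ} (ha : a ∈ U) {m : ℝ} (hm : ∀ z ∈ U, m ≤ (f z).im)
    (hfa : (f a).im = m) : ∀ z ∈ U, f z = f a := by
  rcases (hf.analyticOnNhd hU).is_constant_or_isOpen hc with ⟨κ, h⟩ | h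
  · intro z hz; rw [h z hz, h a ha]
  · exfalso
    have h1 := h U le_rfl hU
    have h2 : f '' U ∈ 𝓝 (f a) := h1.mem_nhds ⟨a, ha, rfl⟩
    obtain ⟨ε, hε, hb⟩ := Metric.mem_nhds_iff.1 h2
    have : f a - ((ε / 2 : ℝ) : ℂ) * I ∈ ball (f a) ε := by
      rw [mem_ball, dist_eq_norm]
      simp only [sub_sub_cancel_left, norm_neg, norm_mul, norm_I, mul_one, norm_real, Real.norm_eq_abs]
      rw [abs_of_pos (by linarith)]; linarith
    obtain ⟨z, hz, e⟩ := hb this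
    have h3 := hm z hz
    rw [e] at h3
    simp [hfa] at h3
    linarith

lemma eqOn_UHP_of_const {f : ℂ → ℂ} (hf : DifferentiableOn ℂ f UHP) {a ρ : ℝ} (hρ : 0 < ρ) {κ : ℂ}
    (h : ∀ z ∈ HB a ρ, f z = κ) : ∀ z ∈ UHP, f z = κ := by
  have hb : ((a : ℂ) + ((ρ / 2 : ℝ) : ℂ) * I) ∈ HB a ρ := by
    rw [mem_HB]
    constructor
    · simp only [add_sub_cancel_left, norm_mul, norm_I, mul_one, norm_real, Real.norm_eq_abs]
      rw [abs_of_pos (by linarith)]; linarith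
    · simp; linarith
  have := (hf.analyticOnNhd isOpen_UHP).eqOn_of_preconnected_of_eventuallyEq
    (g := fun _ => κ) analyticOnNhd_const convex_UHP.isPreconnected
    (HB_subset_UHP hb) (by
      filter_upwards [(isOpen_HB a ρ).mem_nhds hb] with z hz using h z hz)
  exact this

lemma BV.nonconst {N : ℕ} {y : ℕ → ℝ} {j : ℕ} {t s : ℝ} {h : ℂ → ℂ} {c : ℝ} {v : ℕ → ℝ}
    {M : ℝ} (B : BV N y j t s h c v M) {κ : ℂ} (hc : ∀ z ∈ UHP, h z = κ) : False := by
  have key : ∀ (p d : ℝ), Tendsto (fun z => (h z).im) (𝓝[UHP] (p : ℂ)) (𝓝 d) → κ.im = d := by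
    intro p d hd
    refine tendsto_nhds_unique (tendsto_const_nhds.congr' ?_) hd
    filter_upwards [self_mem_nhdsWithin] with z hz
    rw [hc z hz]
  have h1 := key _ _ (B.win0 ((y (2 * j - 1) + t) / 2)
    (Or.inl ⟨by linarith [B.ht], by linarith [B.ht]⟩))
  have h2 := key _ _ (B.win1 ((t + s) / 2) ⟨by linarith [B.hts], by linarith [B.hts]⟩)
  linarith

lemma real_mem_closure_UHP (x : ℝ) : (x : ℂ) ∈ closure UHP := by
  rw [mem_closure_iff_nhdsWithin_neBot]; exact nhdsWithin_UHP_neBot x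

lemma Reg.im_ge {f g : ℂ → ℂ} {a ρ m : ℝ} (h : Reg f g a ρ) (hm : ∀ z ∈ UHP, m ≤ (f z).im)
    {x : ℝ} (hx : |x - a| < ρ) : m ≤ (g x).im := by
  refine ge_of_tendsto ((Complex.continuous_im.tendsto _).comp (h.tendsto hx)) ?_
  filter_upwards [self_mem_nhdsWithin] with z hz using hm z hz

/-- At a Neumann point the infimum is not attained. -/
lemma neumann_gt {f g : ℂ → ℂ} {a ρ m c : ℝ} (hf : DifferentiableOn ℂ f UHP) (h : Reg f g a ρ)
    (hs : ∀ z ∈ ball (a : ℂ) ρ, g (conj z) = 2 * c - conj (g z))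
    (hm : ∀ z ∈ UHP, m ≤ (f z).im) (hnc : ∀ κ, ¬ ∀ z ∈ UHP, f z = κ) : m < (g a).im := by
  have hb : ∀ z ∈ ball (a : ℂ) ρ, m ≤ (g z).im := by
    intro z hz
    rcases lt_trichotomy z.im 0 with h0 | h0 | h0
    · have e := hs z hz
      have e2 : (g (conj z)).im = (g z).im := by rw [e]; simp
      rw [← e2]
      have hz' : conj z ∈ HB a ρ := ⟨conj_mem_ball_real hz, by rw [mem_UHP]; simpa using h0⟩
      rw [h.2.2 hz']
      exact hm _ hz'.2
    · have e : z = ((z.re : ℝ) : ℂ) := by apply Complex.ext <;> simp [h0]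
      rw [e]
      exact h.im_ge hm (by rw [e] at hz; exact real_mem_ball.1 hz)
    · have hz' : z ∈ HB a ρ := ⟨hz, by rwa [mem_UHP]⟩
      rw [h.2.2 hz']
      exact hm _ hz'.2
  refine lt_of_le_of_ne (hb a (mem_ball_self h.1)) fun e => ?_
  have := const_of_min_im isOpen_ball (convex_ball _ _).isPreconnected h.2.1
    (mem_ball_self h.1) hb e.symm
  refine hnc (g a) (eqOn_UHP_of_const hf h.1 (a := a) (ρ := ρ) fun z hz => ?_)
  rw [← h.2.2 hz]; exact this z hz.1

/-- On a Dirichlet arc where the infimum is attained, the derivative along the arc is `≥ 0`. -/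
lemma dir_deriv_nonneg {f g : ℂ → ℂ} {a ρ m : ℝ} (h : Reg f g a ρ)
    (hm : ∀ z ∈ UHP, m ≤ (f z).im) (hga : (g a).im = m) : 0 ≤ (deriv g a).re := by
  have hd : HasDerivAt g (deriv g a) (a : ℂ) :=
    (h.2.1.differentiableAt (isOpen_ball.mem_nhds (mem_ball_self h.1))).hasDerivAt
  have hl : HasDerivAt (fun ε : ℝ => (a : ℂ) + (ε : ℂ) * I) I 0 := by
    have := ((Complex.ofRealCLM.hasDerivAt (x := (0:ℝ))).mul_const I).const_add (a : ℂ)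
    simpa using this
  have hd' : HasDerivAt g (deriv g a) ((fun ε : ℝ => (a : ℂ) + (ε : ℂ) * I) 0) := by simpa using hd
  have hc := hd'.scomp (0:ℝ) hl
  have hc2 := Complex.imCLM.hasFDerivAt.comp_hasDerivAt (0:ℝ) hc
  have e : Complex.imCLM (I • deriv g a) = (deriv g a).re := by simp
  rw [e] at hc2
  have ht := hc2.tendsto_slope_zero_right
  refine ge_of_tendsto ht ?_
  filter_upwards [Ioo_mem_nhdsGT h.1] with ε hε
  have hz : (a : ℂ) + (ε : ℂ) * I ∈ HB a ρ := by
    rw [mem_HB]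
    constructor
    · simp only [add_sub_cancel_left, norm_mul, norm_I, mul_one, norm_real, Real.norm_eq_abs]
      rw [abs_of_pos hε.1]; exact hε.2
    · simpa using hε.1
  have h1 := hm _ hz.2
  rw [← h.2.2 hz] at h1
  simp only [Function.comp_apply, zero_add, Complex.imCLM_apply, ofReal_zero, zero_mul, add_zero, hga,
    smul_eq_mul]
  have := hε.1
  exact mul_nonneg (by positivity) (by linarith)

lemma BV.dir_gt {N : ℕ} {y : ℕ → ℝ} {j : ℕ} {t s : ℝ} {h : ℂ → ℂ} {c : ℝ} {v : ℕ → ℝ}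
    {M : ℝ} (B : BV N y j t s h c v M) {m : ℝ} (hm0 : m < 0) (hm : ∀ z ∈ UHP, m ≤ (h z).im)
    {i : ℕ} (hi : 1 ≤ i) (hi' : i ≤ N) : m < v i := by
  have hN := B.hN
  by_cases hi1 : i = 1
  · rw [hi1, B.v1]; exact hm0
  by_cases hiN : i = N
  · rw [hiN, B.vN]; exact hm0
  have hij : i ≠ j := by rcases B.hj with e | e <;> omega
  have hAB : y (2 * i - 1) < y (2 * i) := B.hy _ _ (by omega) (by omega) (by omega)
  set A := y (2 * i - 1) with hA
  set C := y (2 * i) with hC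
  have hge : m ≤ v i := by
    obtain ⟨g, ρ, hg, hs⟩ := B.regD hi hi' hij (a := (A + C) / 2) ⟨by linarith, by linarith⟩
    have := hg.im_ge hm (x := (A + C) / 2) (by simpa using hg.1)
    rwa [im_of_symm hs (by simpa using hg.1)] at this
  refine lt_of_le_of_ne hge fun hvm => ?_
  -- boundary values
  have tA : Tendsto (fun z => (h z).re) (𝓝[UHP] (A : ℂ)) (𝓝 c) := by
    obtain ⟨K, ρ, hK, e⟩ := B.regYl hi hi'
    have := (Complex.continuous_re.tendsto _).comp hK.tendsto
    rw [e, if_neg hi1] at this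
    simpa [Function.comp_def] using this
  have tC : Tendsto (fun z => (h z).re) (𝓝[UHP] (C : ℂ)) (𝓝 c) := by
    obtain ⟨K, ρ, hK, e⟩ := B.regYr hi hi'
    have := (Complex.continuous_re.tendsto _).comp hK.tendsto
    rw [e, if_neg hiN] at this
    simpa [Function.comp_def] using this
  have hreg : ∀ a ∈ Ioo A C, ∃ g ρ, Reg h g a ρ ∧
      ∀ z ∈ ball (a : ℂ) ρ, g (conj z) = conj (g z) + 2 * (v i) * I :=
    fun a ha => B.regD hi hi' hij ha
  set u : ℝ → ℝ := fun x => extendFrom UHP (fun z => (h z).re) (x : ℂ) with hu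
  have uval : ∀ x d : ℝ, Tendsto (fun z => (h z).re) (𝓝[UHP] (x : ℂ)) (𝓝 d) → u x = d :=
    fun x d hd => extendFrom_eq (real_mem_closure_UHP x) hd
  have uA := uval A c tA
  have uC := uval C c tC
  have hcont : ContinuousOn u (Icc A C) := by
    have h1 : ContinuousOn (extendFrom UHP (fun z => (h z).re)) ((fun x : ℝ => (x : ℂ)) '' Icc A C) := by
      refine continuousOn_extendFrom ?_ ?_
      · rintro _ ⟨x, -, rfl⟩; exact real_mem_closure_UHP x
      · rintro _ ⟨x, hx, rfl⟩
        rcases eq_or_lt_of_le hx.1 with e | e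
        · exact ⟨c, by rw [← e]; exact tA⟩
        rcases eq_or_lt_of_le hx.2 with e' | e'
        · exact ⟨c, by rw [e']; exact tC⟩
        obtain ⟨g, ρ, hg, -⟩ := hreg x ⟨e, e'⟩
        exact ⟨_, (Complex.continuous_re.tendsto _).comp (hg.tendsto (x := x) (by simpa using hg.1))⟩
    exact h1.comp Complex.continuous_ofReal.continuousOn (mapsTo_image _ _)
  have uloc : ∀ {a ρ : ℝ} {g : ℂ → ℂ}, Reg h g a ρ → ∀ x : ℝ, |x - a| < ρ → u x = (g x).re := by
    intro a ρ g hg x hx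
    exact uval x _ ((Complex.continuous_re.tendsto _).comp (hg.tendsto hx))
  have hder : ∀ a ∈ Ioo A C, ∃ d, 0 ≤ d ∧ HasDerivAt u d a := by
    intro a ha
    obtain ⟨g, ρ, hg, hs⟩ := hreg a ha
    refine ⟨(deriv g a).re, dir_deriv_nonneg hg hm ?_, ?_⟩
    · rw [im_of_symm hs (by simpa using hg.1), ← hvm]
    · have hd : HasDerivAt g (deriv g a) (a : ℂ) :=
        (hg.2.1.differentiableAt (isOpen_ball.mem_nhds (mem_ball_self hg.1))).hasDerivAt
      have h2 := hd.real_of_complex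
      refine h2.congr_of_eventuallyEq ?_
      filter_upwards [Metric.ball_mem_nhds a hg.1] with x hx
      exact uloc hg x (by simpa [Real.dist_eq] using hx)
  have hmono : MonotoneOn u (Icc A C) := by
    refine monotoneOn_of_deriv_nonneg (convex_Icc _ _) hcont ?_ ?_
    · rw [interior_Icc]
      intro x hx
      obtain ⟨d, -, hd⟩ := hder x hx
      exact hd.differentiableAt.differentiableWithinAt
    · rw [interior_Icc]
      intro x hx
      obtain ⟨d, hd0, hd⟩ := hder x hx
      rw [hd.deriv]; exact hd0
  have uconst : ∀ x ∈ Icc A C, u x = c := by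
    intro x hx
    apply le_antisymm
    · rw [← uC]; exact hmono hx ⟨hAB.le, le_rfl⟩ hx.2
    · rw [← uA]; exact hmono ⟨le_rfl, hAB.le⟩ hx hx.1
  have ha : (A + C) / 2 ∈ Ioo A C := ⟨by linarith, by linarith⟩
  obtain ⟨g, ρ, hg, hs⟩ := hreg _ ha
  set a := (A + C) / 2
  have hfreq : ∃ᶠ z in 𝓝[≠] (a : ℂ), g z = (fun _ => (c : ℂ) + m * I) z := by
    have ht : Tendsto (fun x : ℝ => (x : ℂ)) (𝓝[≠] a) (𝓝[≠] (a : ℂ)) := by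
      refine tendsto_nhdsWithin_of_tendsto_nhds_of_eventually_within _
        ((Complex.continuous_ofReal.tendsto a).mono_left nhdsWithin_le_nhds) ?_
      filter_upwards [self_mem_nhdsWithin] with x hx
      simpa using hx
    refine ht.frequently (Eventually.frequently ?_)
    have e1 : ∀ᶠ x in 𝓝[≠] a, x ∈ Ioo A C := nhdsWithin_le_nhds (isOpen_Ioo.mem_nhds ha)
    have e2 : ∀ᶠ x in 𝓝[≠] a, x ∈ ball a ρ := nhdsWithin_le_nhds (ball_mem_nhds a hg.1)
    filter_upwards [e1, e2] with x hx hx2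
    have hx2 : |x - a| < ρ := by simpa [Real.dist_eq] using hx2
    apply Complex.ext
    · rw [← uloc hg x hx2, uconst x ⟨hx.1.le, hx.2.le⟩]; simp
    · rw [im_of_symm hs hx2, ← hvm]; simp
  have hgc := (hg.2.1.analyticOnNhd isOpen_ball).eqOn_of_preconnected_of_frequently_eq
    analyticOnNhd_const (convex_ball _ _).isPreconnected (mem_ball_self hg.1) hfreq
  refine B.nonconst (eqOn_UHP_of_const B.diff hg.1 (a := a) (κ := (c : ℂ) + m * I) fun z hz => ?_)
  rw [← hg.2.2 hz]; exact hgc hz.1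

lemma locate {n : ℕ} (y : ℕ → ℝ) (a : ℝ) (hn : 1 ≤ n) (h1 : y 1 ≤ a) (h2 : a ≤ y n) :
    (∃ k, 1 ≤ k ∧ k ≤ n ∧ a = y k) ∨ (∃ k, 1 ≤ k ∧ k + 1 ≤ n ∧ a ∈ Ioo (y k) (y (k + 1))) := by
  induction n, hn using Nat.le_induction with
  | base => exact Or.inl ⟨1, le_rfl, le_rfl, le_antisymm h2 h1⟩
  | succ n hn ih =>
    rcases le_or_gt a (y n) with h | h
    · rcases ih h with ⟨k, a1, a2, a3⟩ | ⟨k, a1, a2, a3⟩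
      · exact Or.inl ⟨k, a1, by omega, a3⟩
      · exact Or.inr ⟨k, a1, by omega, a3⟩
    · rcases eq_or_lt_of_le h2 with e | e
      · exact Or.inl ⟨n + 1, by omega, le_rfl, e⟩
      · exact Or.inr ⟨n, hn, le_rfl, h, e⟩

theorem BV.pos {N : ℕ} {y : ℕ → ℝ} {j : ℕ} {t s : ℝ} {h : ℂ → ℂ} {c : ℝ} {v : ℕ → ℝ}
    {M : ℝ} (B : BV N y j t s h c v M) : ∀ z ∈ UHP, 0 ≤ (h z).im := by
  by_contra hneg
  push Not at hneg
  obtain ⟨z1, hz1, hz1n⟩ := hneg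
  set S := (fun z => (h z).im) '' UHP with hS
  have hbdd : BddBelow S := ⟨-M, by rintro _ ⟨z, hz, rfl⟩; exact (abs_le.1 (B.bdd z hz)).1⟩
  set m := sInf S with hmdef
  have hm : ∀ z ∈ UHP, m ≤ (h z).im := fun z hz => csInf_le hbdd ⟨z, hz, rfl⟩
  have hm0 : m < 0 := (hm z1 hz1).trans_lt hz1n
  have hcl : m ∈ closure S := csInf_mem_closure ⟨_, z1, hz1, rfl⟩ hbdd
  obtain ⟨u, hSu, hum⟩ := mem_closure_iff_ultrafilter.1 hcl
  set 𝒰 := Ultrafilter.ofComapInfPrincipal hSu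
  have hU : UHP ∈ 𝒰 := Ultrafilter.ofComapInfPrincipal_mem hSu
  have hmap : Tendsto (fun z => (h z).im) 𝒰 (𝓝 m) := by
    have e := Ultrafilter.ofComapInfPrincipal_eq_of_map hSu
    have e2 : Filter.map (fun z => (h z).im) (𝒰 : Filter ℂ) = (u : Filter ℝ) := by
      rw [← Ultrafilter.coe_map, e]
    rw [Tendsto, e2]; exact hum
  have bad : ∀ (δ : ℝ), m < δ → (∀ᶠ z in (𝒰 : Filter ℂ), δ ≤ (h z).im) → False := by
    intro δ hδ hev
    have := ge_of_tendsto hmap hev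
    linarith
  have bad2 : ∀ (a : ℂ) (d : ℝ), m < d → Tendsto (fun z => (h z).im) (𝓝[UHP] a) (𝓝 d) →
      (𝒰 : Filter ℂ) ≤ 𝓝 a → False := by
    intro a d hd ht hle
    have hle' : (𝒰 : Filter ℂ) ≤ 𝓝[UHP] a := le_inf hle (le_principal_iff.2 hU)
    have := tendsto_nhds_unique hmap (ht.mono_left hle')
    linarith
  have bad3 : ∀ {a ρ : ℝ} {g : ℂ → ℂ}, Reg h g a ρ → m < (g a).im → (𝒰 : Filter ℂ) ≤ 𝓝 (a : ℂ) →
      False := fun hg hlt hle => bad2 _ _ hlt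
        ((Complex.continuous_im.tendsto _).comp (hg.tendsto (by simpa using hg.1))) hle
  have hN := B.hN
  have hnc : ∀ κ, ¬ ∀ z ∈ UHP, h z = κ := fun κ hκ => B.nonconst hκ
  -- inversion
  have hyy : y 1 < y (2 * N) := B.hy _ _ le_rfl (by omega) le_rfl
  set w := (y 1 + y (2 * N)) / 2 with hw
  have hw1 : y 1 < w := by linarith
  have hw2 : w < y (2 * N) := by linarith
  have badinv : ∀ x0 ∈ Ioo (-(1 / (y (2 * N) - w))) (1 / (w - y 1)),
      Tendsto (fun z : ℂ => 1 / (w - z)) 𝒰 (𝓝 (x0 : ℂ)) → False := by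
    intro x0 hx0 ht
    obtain ⟨g, ρ, hg, hs⟩ := B.regInf hw1 hw2 hx0
    have hgt : m < (g x0).im := by
      refine neumann_gt (c := 0) (fun z hz => ?_) hg hs (fun z hz => hm _ (inv'_mem hz)) ?_
      · have i1 := (inv'_hasDerivAt (w := w) (UHP_ne_zero hz)).differentiableAt
        have i2 := B.diff.differentiableAt (isOpen_UHP.mem_nhds (inv'_mem (w := w) hz))
        exact (DifferentiableAt.comp (f := inv' w) (g := h) z i2 i1).differentiableWithinAt
      · intro κ hκ
        refine hnc κ fun z hz => ?_
        have hz' : (1 : ℂ) / (w - z) ∈ UHP := by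
          rw [mem_UHP] at hz ⊢
          rw [one_div, Complex.inv_im]
          have : ((w : ℂ) - z) ≠ 0 := by
            intro e; have := congrArg Complex.im e; simp at this; linarith
          have := Complex.normSq_pos.2 this
          simp; positivity
        have := hκ _ hz'
        rwa [show inv' w (1 / (w - z)) = z by simp [inv']] at this
    have ht' : Tendsto (fun z : ℂ => 1 / (w - z)) 𝒰 (𝓝[UHP] (x0 : ℂ)) := by
      refine tendsto_nhdsWithin_of_tendsto_nhds_of_eventually_within _ ht ?_
      filter_upwards [hU] with z hz
      rw [mem_UHP] at hz ⊢
      rw [one_div, Complex.inv_im]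
      have : ((w : ℂ) - z) ≠ 0 := by
        intro e; have := congrArg Complex.im e; simp at this; linarith
      have := Complex.normSq_pos.2 this
      simp; positivity
    have h1 := (Complex.continuous_im.tendsto _).comp
      ((hg.tendsto (x := x0) (by simpa using hg.1)).comp ht')
    have h2 : Tendsto (fun z => (h z).im) 𝒰 (𝓝 (g x0).im) := by
      refine h1.congr fun z => ?_
      simp [inv']
    have := tendsto_nhds_unique hmap h2
    linarith
  have p1 : 0 < w - y 1 := by linarith
  have p2 : 0 < y (2 * N) - w := by linarith
  have q1 : 0 < 1 / (w - y 1) := by positivity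
  have q2 : 0 < 1 / (y (2 * N) - w) := by positivity
  by_cases hbd : ∃ R : ℝ, closedBall (0 : ℂ) R ∈ 𝒰
  · obtain ⟨R, hR⟩ := hbd
    obtain ⟨z0, -, hz0⟩ := (isCompact_closedBall (0 : ℂ) R).ultrafilter_le_nhds 𝒰
      (le_principal_iff.2 hR)
    have him : 0 ≤ z0.im := by
      refine ge_of_tendsto ((Complex.continuous_im.tendsto z0).mono_left hz0) ?_
      filter_upwards [hU] with z hz
      exact (mem_UHP.1 hz).le
    rcases eq_or_lt_of_le him with h0 | h0
    swap
    · have hz0U : z0 ∈ UHP := mem_UHP.2 h0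
      have ht := ((B.diff.differentiableAt (isOpen_UHP.mem_nhds hz0U)).continuousAt).tendsto
      have := tendsto_nhds_unique hmap (((Complex.continuous_im.tendsto _).comp ht).mono_left hz0)
      exact hnc _ (const_of_min_im isOpen_UHP convex_UHP.isPreconnected B.diff hz0U hm this.symm)
    have e0 : z0 = ((z0.re : ℝ) : ℂ) := by apply Complex.ext <;> simp [← h0]
    set a := z0.re
    rw [e0] at hz0
    by_cases hout : a < y 1 ∨ y (2 * N) < a
    · have hne : w - a ≠ 0 := by rcases hout with h | h <;> intro e <;> linarith
      refine badinv (1 / (w - a)) ?_ ?_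
      · rcases hout with h | h
        · exact ⟨by have : 0 < 1 / (w - a) := by apply one_div_pos.2; linarith
                    linarith,
            one_div_lt_one_div_of_lt (by linarith) (by linarith)⟩
        · refine ⟨?_, ?_⟩
          · rw [show w - a = -(a - w) by ring, one_div_neg_eq_neg_one_div, neg_lt_neg_iff]
            exact one_div_lt_one_div_of_lt (by linarith) (by linarith)
          · have : 1 / (w - a) < 0 := by apply one_div_neg.2; linarith
            linarith
      · have hne' : (w : ℂ) - a ≠ 0 := by exact_mod_cast hne
        have hc : ContinuousAt (fun z : ℂ => 1 / (w - z)) (a : ℂ) :=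
          continuousAt_const.div (continuousAt_const.sub continuousAt_id) hne'
        have := hc.tendsto.mono_left hz0
        push_cast; exact this
    push Not at hout
    rcases locate y a (by omega) hout.1 hout.2 with ⟨k, k1, k2, ek⟩ | ⟨k, k1, k2, hk⟩
    · rcases Nat.even_or_odd' k with ⟨i, e | e⟩
      · obtain ⟨K, ρ, hK, eK⟩ := B.regYr (i := i) (by omega) (by omega)
        have := (Complex.continuous_im.tendsto _).comp hK.tendsto
        rw [eK] at this
        refine bad2 _ (v i) (B.dir_gt hm0 hm (by omega) (by omega)) ?_ hz0
        rw [ek, e]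
        simpa [Function.comp_def] using this
      · obtain ⟨K, ρ, hK, eK⟩ := B.regYl (i := i + 1) (by omega) (by omega)
        have := (Complex.continuous_im.tendsto _).comp hK.tendsto
        rw [eK] at this
        refine bad2 _ (v (i + 1)) (B.dir_gt hm0 hm (by omega) (by omega)) ?_ hz0
        rw [ek, e]
        rw [show 2 * (i + 1) - 1 = 2 * i + 1 by omega] at this
        simpa [Function.comp_def] using this
    · rcases Nat.even_or_odd' k with ⟨i, e | e⟩
      · rw [e] at hk
        obtain ⟨g, ρ, hg, hs⟩ := B.regN (i := i) (by omega) (by omega) hk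
        exact bad3 hg (neumann_gt B.diff hg hs hm hnc) hz0
      · rw [e] at hk
        have hk' : a ∈ Ioo (y (2 * (i + 1) - 1)) (y (2 * (i + 1))) := by
          rw [show 2 * (i + 1) - 1 = 2 * i + 1 by omega]; exact hk
        by_cases hij : i + 1 = j
        · subst hij
          by_cases hat : a = t
          · obtain ⟨g, ρ, hg, hs⟩ := B.regt
            have h1 := (Complex.continuous_im.tendsto _).comp
              ((hg.tendsto (x := t) (by simpa using hg.1)).mono_left
                (le_inf (hat ▸ hz0) (le_principal_iff.2 hU)))
            rw [hs t (by simpa using hg.1)] at h1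
            refine bad (m / 2) (by linarith) ?_
            filter_upwards [h1 (Ioi_mem_nhds (show 1 + m / 2 < 1 by linarith))] with z hz
            have h3 : 1 + m / 2 < (h z + ((1 / Real.pi : ℝ) : ℂ) * Complex.log (z - t)).im := hz
            rw [Complex.add_im, Complex.im_ofReal_mul, Complex.log_im] at h3
            have h4 := Complex.arg_le_pi (z - t)
            have h5 : 1 / Real.pi * (z - t).arg ≤ 1 := by
              rw [one_div_mul_eq_div, div_le_one Real.pi_pos]; exact h4
            linarith
          by_cases has : a = s
          · obtain ⟨g, ρ, hg, hs⟩ := B.regs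
            have h1 := (Complex.continuous_im.tendsto _).comp
              ((hg.tendsto (x := s) (by simpa using hg.1)).mono_left
                (le_inf (has ▸ hz0) (le_principal_iff.2 hU)))
            rw [hs s (by simpa using hg.1)] at h1
            refine bad (m / 2) (by linarith) ?_
            filter_upwards [h1 (Ioi_mem_nhds (show m / 2 < 0 by linarith)), hU] with z hz hzU
            have h3 : m / 2 < (h z + ((-1 / Real.pi : ℝ) : ℂ) * Complex.log (z - s)).im := hz
            rw [Complex.add_im, Complex.im_ofReal_mul, Complex.log_im] at h3
            have h4 : 0 ≤ (z - s).arg := Complex.arg_nonneg_iff.2 (by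
              simpa using (mem_UHP.1 hzU).le)
            have h5 : 0 ≤ 1 / Real.pi * (z - s).arg := by have := Real.pi_pos; positivity
            rw [neg_div] at h3
            linarith
          · obtain ⟨g, ρ, d, hd, hg, hs⟩ := B.regD0 hk' hat has
            refine bad3 hg ?_ hz0
            rw [im_of_symm hs (by simpa using hg.1)]
            rcases hd with rfl | rfl <;> linarith
        · refine bad2 _ _ (B.dir_gt hm0 hm (i := i + 1) (by omega) (by omega))
            (B.dir (i + 1) (by omega) (by omega) hij a hk') hz0
  · push Not at hbd
    refine badinv 0 ⟨by linarith, by linarith⟩ ?_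
    have hcob : Tendsto (fun z : ℂ => (w : ℂ) - z) 𝒰 (Bornology.cobounded ℂ) := by
      rw [← tendsto_norm_atTop_iff_cobounded]
      rw [Filter.tendsto_atTop]
      intro R
      have := Ultrafilter.compl_mem_iff_notMem.2 (hbd (R + ‖(w : ℂ)‖))
      filter_upwards [this] with z hz
      have hz : R + ‖(w : ℂ)‖ < ‖z‖ := by simpa using hz
      have := norm_sub_norm_le z (w : ℂ)
      rw [norm_sub_rev] at this
      linarith
    have := Filter.tendsto_inv₀_cobounded.comp hcob
    simpa [Function.comp_def] using this

lemma typ_phi {w ρ : ℝ} (hρ : 0 < ρ) {f : ℂ → ℂ} (hf : DifferentiableOn ℂ f (ball (w:ℂ) (2 * ρ)))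
    (hpos : ∀ z ∈ ball (w:ℂ) (2 * ρ), 0 ≤ z.im * (f z - f w).im) {A : ℝ} (hA : 0 < A)
    (hfA : ‖deriv f w‖ ≤ A) : ∀ z ∈ ball (w:ℂ) (ρ / 2), ‖f z - f w‖ ≤ 4 * ρ * A := by
  have hwb : (w : ℂ) ∈ ball (w:ℂ) (2 * ρ) := mem_ball_self (by linarith)
  have hsl : DifferentiableOn ℂ (dslope f (w:ℂ)) (ball (w:ℂ) (2 * ρ)) :=
    (Complex.differentiableOn_dslope (isOpen_ball.mem_nhds hwb)).2 hf
  set φ : ℂ → ℂ := fun ζ => (ρ ^ 2 - ζ ^ 2) * dslope f (w:ℂ) (w + ζ) with hφ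
  have hmaps : MapsTo (fun ζ : ℂ => (w:ℂ) + ζ) (ball 0 (2 * ρ)) (ball (w:ℂ) (2 * ρ)) := by
    intro ζ hζ
    simpa [dist_eq_norm] using hζ
  have hφd : DifferentiableOn ℂ φ (ball 0 (2 * ρ)) := by
    refine DifferentiableOn.mul (by fun_prop) ?_
    exact hsl.comp (by fun_prop) hmaps
  have hφ0 : ∀ z ∈ ball (0:ℂ) ρ, 0 ≤ (φ z).re := by
    intro z hz
    have := max_principle_im (ball (0:ℂ) ρ) isOpen_ball isBounded_ball
      (convex_ball _ _).isPreconnected (fun z => -I * φ z)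
      ((hφd.mono (ball_subset_ball (by linarith))).const_mul _) ?_ z hz
    · simpa using this
    · intro ζ hζ ε hε
      rw [frontier_ball _ hρ.ne', mem_sphere_zero_iff_norm] at hζ
      have hζb : ζ ∈ ball (0:ℂ) (2 * ρ) := by rw [mem_ball_zero_iff]; linarith
      have hc : ContinuousAt (fun z => (-I * φ z).im) ζ :=
        Complex.continuous_im.continuousAt.comp
          (continuousAt_const.mul (hφd.differentiableAt (isOpen_ball.mem_nhds hζb)).continuousAt)
      have hζ0 : ζ ≠ 0 := by intro e; rw [e] at hζ; simp at hζ; linarith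
      have hval : φ ζ = (-2 * ζ.im * I) * (f (w + ζ) - f w) := by
        have h1 : dslope f (w:ℂ) (w + ζ) = (f (w + ζ) - f w) / ζ := by
          rw [dslope_of_ne _ (by simpa using hζ0), slope_def_field]; simp
        have h2 : (ρ:ℂ) ^ 2 = ζ * conj ζ := by
          rw [Complex.mul_conj, Complex.normSq_eq_norm_sq, hζ]; push_cast; ring
        have h3 : conj ζ - ζ = -2 * ζ.im * I := by
          apply Complex.ext <;> simp; ring
        simp only [hφ]
        rw [h1, h2, ← h3]
        field_simp
      have hle : (-I * φ ζ).im ≤ 0 := by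
        rw [hval]
        have := hpos _ (hmaps hζb)
        simp at this ⊢
        linarith
      have := hc.tendsto (Iio_mem_nhds (show (-I * φ ζ).im < ε by linarith))
      filter_upwards [nhdsWithin_le_nhds this] with z hz
      exact le_of_lt hz
  intro z hz
  set ζ := z - w with hζdef
  have hζn : ‖ζ‖ < ρ / 2 := by rw [mem_ball, dist_eq_norm] at hz; exact hz
  by_cases hζ0 : ζ = 0
  · have : z = w := sub_eq_zero.1 hζ0
    rw [this]; simp; positivity
  have hM : 0 < ρ ^ 2 * A := by positivity
  have hbc := Complex.borelCaratheodory (f := fun z => -φ z) (R := ρ) (z := ζ) hM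
    ((hφd.mono (ball_subset_ball (by linarith))).neg)
    (fun z hz => by
      have := hφ0 z hz
      rw [mem_ofPred_eq]; simp only [neg_re]; linarith) hρ
    (by rw [mem_ball_zero_iff]; linarith)
  have h0 : ‖-φ 0‖ ≤ ρ ^ 2 * A := by
    rw [norm_neg]
    simp only [hφ, add_zero, dslope_same]
    rw [norm_mul]
    have : ‖(ρ:ℂ) ^ 2 - 0 ^ 2‖ = ρ ^ 2 := by simp
    rw [this]; gcongr
  have hφζ : ‖φ ζ‖ ≤ 5 * (ρ ^ 2 * A) := by
    have hd : 0 < ρ - ‖ζ‖ := by linarith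
    have hn := norm_nonneg ζ
    rw [← norm_neg]
    refine hbc.trans ?_
    rw [← add_div, div_le_iff₀ hd]
    nlinarith [mul_le_mul_of_nonneg_right h0 (by linarith : 0 ≤ ρ + ‖ζ‖)]
  have hval : φ ζ * ζ = (ρ ^ 2 - ζ ^ 2) * (f z - f w) := by
    have h1 : dslope f (w:ℂ) (w + ζ) = (f z - f w) / ζ := by
      rw [dslope_of_ne _ (by simpa using hζ0), slope_def_field]; simp [hζdef]
    simp only [hφ]
    rw [h1]; field_simp
  have hlow : 3 / 4 * ρ ^ 2 ≤ ‖(ρ:ℂ) ^ 2 - ζ ^ 2‖ := by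
    have h1 := norm_sub_norm_le ((ρ:ℂ) ^ 2) (ζ ^ 2)
    have h2 : ‖(ρ:ℂ) ^ 2‖ = ρ ^ 2 := by simp
    have h3 : ‖ζ ^ 2‖ ≤ (ρ / 2) ^ 2 := by rw [norm_pow]; gcongr
    nlinarith
  have hE : ‖φ ζ‖ * ‖ζ‖ = ‖(ρ:ℂ) ^ 2 - ζ ^ 2‖ * ‖f z - f w‖ := by
    rw [← norm_mul, hval, norm_mul]
  have h1 : ‖φ ζ‖ * ‖ζ‖ ≤ 5 * (ρ ^ 2 * A) * (ρ / 2) :=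
    mul_le_mul hφζ hζn.le (norm_nonneg _) (by positivity)
  have h2 : 3 / 4 * ρ ^ 2 * ‖f z - f w‖ ≤ ‖(ρ:ℂ) ^ 2 - ζ ^ 2‖ * ‖f z - f w‖ := by gcongr
  have h3 : ρ ^ 2 * (3 / 4 * ‖f z - f w‖) ≤ ρ ^ 2 * (5 / 2 * A * ρ) := by nlinarith
  have h4 := le_of_mul_le_mul_left h3 (by positivity)
  nlinarith [mul_pos hρ hA]

lemma typ_bound {w ρ : ℝ} (hρ : 0 < ρ) {f : ℂ → ℂ} (hf : DifferentiableOn ℂ f (ball (w:ℂ) (2 * ρ)))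
    (hpos : ∀ z ∈ ball (w:ℂ) (2 * ρ), 0 ≤ z.im * (f z - f w).im) {A : ℝ} (hA : 0 < A)
    (hfA : ‖deriv f w‖ ≤ A) {r : ℝ} (hr : r ≤ ρ / 8) {z z' : ℂ} (hz : z ∈ ball (w:ℂ) r)
    (hz' : z' ∈ ball (w:ℂ) r) :
    ‖f z - f z' - deriv f w * (z - z')‖ ≤ 512 * A / ρ * r * ‖z - z'‖ := by
  have hb := typ_phi hρ hf hpos hA hfA
  have hd1 : ∀ z ∈ ball (w:ℂ) (2 * ρ), HasDerivAt f (deriv f z) z := fun z hz =>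
    (hf.differentiableAt (isOpen_ball.mem_nhds hz)).hasDerivAt
  have hf' : DifferentiableOn ℂ (deriv f) (ball (w:ℂ) (2 * ρ)) := hf.deriv isOpen_ball
  have b1 : ∀ z ∈ ball (w:ℂ) (ρ / 4), ‖deriv f z‖ ≤ 32 * A := by
    intro z hz
    rw [mem_ball] at hz
    have hsub : closedBall z (ρ / 8) ⊆ ball (w:ℂ) (ρ / 2) := by
      intro u hu
      rw [mem_closedBall] at hu
      rw [mem_ball]
      linarith [dist_triangle u z w]
    have hd : DifferentiableOn ℂ (fun u => f u - f w) (closedBall z (ρ / 8)) :=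
      (hf.mono (hsub.trans (ball_subset_ball (by linarith)))).sub_const _
    have := Complex.norm_deriv_le_of_forall_mem_sphere_norm_le (f := fun u => f u - f w) (c := z)
      (R := ρ / 8) (C := 4 * ρ * A) (by linarith)
      (hd.diffContOnCl_ball (closedBall_subset_closedBall le_rfl))
      (fun u hu => hb u (hsub (sphere_subset_closedBall hu)))
    rw [deriv_sub_const] at this
    refine this.trans (le_of_eq ?_)
    field_simp; ring
  have b2 : ∀ z ∈ ball (w:ℂ) (ρ / 8), ‖deriv (deriv f) z‖ ≤ 512 * A / ρ := by
    intro z hz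
    rw [mem_ball] at hz
    have hsub : closedBall z (ρ / 16) ⊆ ball (w:ℂ) (ρ / 4) := by
      intro u hu
      rw [mem_closedBall] at hu
      rw [mem_ball]
      linarith [dist_triangle u z w]
    have hd : DifferentiableOn ℂ (deriv f) (closedBall z (ρ / 16)) :=
      (hf'.mono (hsub.trans (ball_subset_ball (by linarith))))
    have := Complex.norm_deriv_le_of_forall_mem_sphere_norm_le (f := deriv f) (c := z)
      (R := ρ / 16) (C := 32 * A) (by linarith)
      (hd.diffContOnCl_ball (closedBall_subset_closedBall le_rfl))
      (fun u hu => b1 u (hsub (sphere_subset_closedBall hu)))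
    refine this.trans (le_of_eq ?_)
    field_simp; ring
  have hr0 : 0 < r := (dist_nonneg.trans_lt hz)
  have hwr : (w:ℂ) ∈ ball (w:ℂ) (ρ / 8) := mem_ball_self (by linarith)
  have b3 : ∀ z ∈ ball (w:ℂ) r, ‖deriv f z - deriv f w‖ ≤ 512 * A / ρ * r := by
    intro z hz
    have hz8 : z ∈ ball (w:ℂ) (ρ / 8) := ball_subset_ball hr hz
    have := (convex_ball (w:ℂ) (ρ / 8)).norm_image_sub_le_of_norm_deriv_le (f := deriv f)
      (fun u hu => hf'.differentiableAt (isOpen_ball.mem_nhds (ball_subset_ball (by linarith) hu)))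
      b2 hwr hz8
    refine this.trans ?_
    rw [mem_ball, dist_eq_norm] at hz
    gcongr
  have key := (convex_ball (w:ℂ) r).norm_image_sub_le_of_norm_hasDerivWithin_le
    (f := fun u => f u - deriv f w * u) (f' := fun u => deriv f u - deriv f w)
    (C := 512 * A / ρ * r)
    (fun u hu => by
      have h1 := hd1 u (ball_subset_ball (by linarith) hu)
      have h2 := h1.sub ((hasDerivAt_id u).const_mul (deriv f w))
      rw [mul_one] at h2
      exact h2.hasDerivWithinAt) b3 hz' hz
  refine le_trans (le_of_eq ?_) key
  congr 1; ring

/-- Packaged estimate near a Dirichlet-zero boundary point for a function with `Im ≥ 0`. -/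
lemma dir_estimate {w R : ℝ} {f g : ℂ → ℂ} (hg : Reg f g w R)
    (hs : ∀ z ∈ ball (w:ℂ) R, g (conj z) = conj (g z)) (hpos : ∀ z ∈ UHP, 0 ≤ (f z).im)
    {b : ℝ} (hb : (f (w + ((R / 8192 : ℝ) : ℂ) * I)).im / (R / 8192) ≤ b) :
    ∃ a : ℝ, ∀ r ≤ R / 16, ∀ z ∈ ball (w:ℂ) r, ∀ z' ∈ ball (w:ℂ) r,
      ‖g z - g z' - a * (z - z')‖ ≤ 1024 * (2 * b + 2) / R * r * ‖z - z'‖ := by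
  have hR := hg.1
  have hs0 : ∀ z ∈ ball (w:ℂ) R, g (conj z) = conj (g z) + 2 * (0:ℝ) * I := by
    intro z hz; rw [hs z hz]; simp
  have him : ∀ x : ℝ, |x - w| < R → (g x).im = 0 := fun x hx => im_of_symm hs0 hx
  have hw0 : (g w).im = 0 := him w (by simpa using hR)
  have ha_im : (deriv g w).im = 0 := deriv_im_zero hg.2.1 him (by simpa using hR)
  have ha_re : 0 ≤ (deriv g w).re := dir_deriv_nonneg hg hpos hw0
  set a := (deriv g w).re with hadef
  have ea : deriv g w = (a : ℂ) := by apply Complex.ext <;> simp [hadef, ha_im]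
  have e2 : 2 * (R / 2) = R := by ring
  have hp : ∀ z ∈ ball (w:ℂ) (2 * (R / 2)), 0 ≤ z.im * (g z - g w).im := by
    rw [e2]
    intro z hz
    rw [Complex.sub_im, hw0, sub_zero]
    rcases lt_trichotomy z.im 0 with h0 | h0 | h0
    · have hz' : conj z ∈ HB w R := ⟨conj_mem_ball_real hz, by rw [mem_UHP]; simpa using h0⟩
      have h1 := hpos _ hz'.2
      rw [← hg.2.2 hz', hs z hz] at h1
      simp at h1
      nlinarith
    · rw [h0]; simp
    · have hz' : z ∈ HB w R := ⟨hz, by rwa [mem_UHP]⟩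
      rw [hg.2.2 hz']
      exact mul_nonneg h0.le (hpos _ hz'.2)
  have hgd : DifferentiableOn ℂ g (ball (w:ℂ) (2 * (R / 2))) := by rw [e2]; exact hg.2.1
  have est : ∀ A, 0 < A → a ≤ A → ∀ r ≤ R / 16, ∀ z ∈ ball (w:ℂ) r, ∀ z' ∈ ball (w:ℂ) r,
      ‖g z - g z' - a * (z - z')‖ ≤ 1024 * A / R * r * ‖z - z'‖ := by
    intro A hA haA r hr z hz z' hz'
    have := typ_bound (by linarith) hgd hp hA (by rw [ea]; simpa [abs_of_nonneg ha_re] using haA)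
      (r := r) (by linarith) hz hz'
    rw [ea] at this
    refine this.trans (le_of_eq ?_)
    field_simp; ring
  have hab : a ≤ 2 * b + 2 := by
    have hε : 0 < R / 8192 := by positivity
    set ε := R / 8192 with hεd
    have hn : ‖(w:ℂ) + (ε:ℂ) * I - w‖ = ε := by simp [abs_of_pos hε]
    have hz : (w:ℂ) + (ε:ℂ) * I ∈ ball (w:ℂ) (2 * ε) := by
      rw [mem_ball, dist_eq_norm, hn]; linarith
    have h1 := est (a + 1) (by linarith) (by linarith) (2 * ε) (by rw [hεd]; linarith) _ hz w
      (mem_ball_self (by linarith))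
    have hzH : (w:ℂ) + (ε:ℂ) * I ∈ HB w R := by
      rw [mem_HB, hn]
      exact ⟨by rw [hεd]; linarith, by simpa using hε⟩
    have h2 := (Complex.abs_im_le_norm _).trans h1
    rw [hn] at h2
    have h3 : (g ((w:ℂ) + (ε:ℂ) * I) - g w - a * ((w:ℂ) + (ε:ℂ) * I - w)).im
        = (f (w + (ε:ℂ) * I)).im - a * ε := by
      rw [Complex.sub_im, Complex.sub_im, hw0, hg.2.2 hzH]; simp
    rw [h3] at h2
    have h4 : 1024 * (a + 1) / R * (2 * ε) * ε = (a + 1) / 4 * ε := by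
      rw [hεd]; field_simp; ring
    rw [h4] at h2
    have h5 := (abs_le.1 h2).1
    rw [div_le_iff₀ hε] at hb
    have h6 : (a - (a + 1) / 4) * ε ≤ b * ε := by linarith
    have := le_of_mul_le_mul_right h6 hε
    have hb0 : 0 ≤ b := by
      have := hpos _ hzH.2
      by_contra hneg
      nlinarith
    linarith
  exact ⟨a, fun r hr z hz z' hz' => est (2 * b + 2) (by
    have hb0 : 0 ≤ b := by
      refine le_trans (div_nonneg (hpos _ ?_) (by positivity)) hb
      rw [mem_UHP]; simp; positivity
    linarith) hab r hr z hz z' hz'⟩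

lemma main_one {ι : Type*} {𝓕 : Filter ι} [𝓕.NeBot] {w R : ℝ} (hR : 0 < R) {f : ι → ℂ → ℂ}
    (hf : ∀ᶠ τ in 𝓕, (∃ g, Reg (f τ) g w R ∧ ∀ z ∈ ball (w:ℂ) R, g (conj z) = conj (g z)) ∧
      ∀ z ∈ UHP, 0 ≤ (f τ z).im)
    {p : ℂ → ℝ} (hp : ∀ z ∈ UHP, Tendsto (fun τ => (f τ z).im) 𝓕 (𝓝 (p z))) :
    ∃ l C : ℝ, 0 ≤ C ∧
      Tendsto (fun ε : ℝ => p ((w : ℂ) + (ε : ℂ) * I) / ε) (𝓝[>] (0 : ℝ)) (𝓝 l) ∧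
      ∀ η > 0, ∀ᶠ τ in 𝓕, ∀ r ≤ R / 16, ∀ σ1 σ2 : ℝ, σ1 < σ2 → |σ1 - w| < r → |σ2 - w| < r →
        ∃ a1 a2 : ℝ, Tendsto (fun z => (f τ z).re) (𝓝[UHP] (σ1 : ℂ)) (𝓝 a1) ∧
          Tendsto (fun z => (f τ z).re) (𝓝[UHP] (σ2 : ℂ)) (𝓝 a2) ∧
          |(a2 - a1) / (σ2 - σ1) - l| ≤ C * r + η := by
  have hmem : ∀ ε : ℝ, 0 < ε → (w:ℂ) + (ε:ℂ) * I ∈ UHP := fun ε hε => by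
    rw [mem_UHP]; simpa using hε
  have hnorm : ∀ ε : ℝ, 0 < ε → ‖(w:ℂ) + (ε:ℂ) * I - w‖ = ε := fun ε hε => by
    simp [abs_of_pos hε]
  set ε0 := R / 8192 with hε0
  have hε0p : 0 < ε0 := by positivity
  set b := (p (w + (ε0:ℂ) * I) + 1) / ε0 with hbdef
  have hp0 : 0 ≤ p (w + (ε0:ℂ) * I) := by
    refine ge_of_tendsto (hp _ (hmem ε0 hε0p)) ?_
    filter_upwards [hf] with τ hτ using hτ.2 _ (hmem ε0 hε0p)
  have hb0 : 0 ≤ b := by positivity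
  set K := 1024 * (2 * b + 2) / R with hK
  have hK0 : 0 ≤ K := by positivity
  -- uniform estimates
  have hest : ∀ᶠ τ in 𝓕, ∃ a : ℝ, ∃ g, Reg (f τ) g w R ∧
      (∀ x : ℝ, |x - w| < R → (g x).im = 0) ∧
      ∀ r ≤ R / 16, ∀ z ∈ ball (w:ℂ) r, ∀ z' ∈ ball (w:ℂ) r,
      ‖g z - g z' - a * (z - z')‖ ≤ K * r * ‖z - z'‖ := by
    filter_upwards [hf, (hp _ (hmem ε0 hε0p)) (Iio_mem_nhds (lt_add_one _))] with τ hτ hlt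
    obtain ⟨⟨g, hg, hs⟩, hpos⟩ := hτ
    have hlt' : (f τ (w + (ε0:ℂ) * I)).im < p (w + (ε0:ℂ) * I) + 1 := hlt
    obtain ⟨a, ha⟩ := dir_estimate hg hs hpos (b := b) (by rw [hbdef]; gcongr)
    refine ⟨a, g, hg, fun x hx => im_of_symm (d := 0) (fun z hz => by rw [hs z hz]; simp) hx, ha⟩
  have hest2 : ∀ᶠ τ in 𝓕, ∃ a : ℝ,
      (∀ ε : ℝ, 0 < ε → ε ≤ R / 32 → |(f τ (w + (ε:ℂ) * I)).im / ε - a| ≤ 2 * K * ε) ∧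
      ∀ r ≤ R / 16, ∀ σ1 σ2 : ℝ, σ1 < σ2 → |σ1 - w| < r → |σ2 - w| < r →
        ∃ a1 a2 : ℝ, Tendsto (fun z => (f τ z).re) (𝓝[UHP] (σ1 : ℂ)) (𝓝 a1) ∧
          Tendsto (fun z => (f τ z).re) (𝓝[UHP] (σ2 : ℂ)) (𝓝 a2) ∧
          |(a2 - a1) / (σ2 - σ1) - a| ≤ K * r := by
    filter_upwards [hest] with τ hτ
    obtain ⟨a, g, hg, hg0, ha⟩ := hτ
    refine ⟨a, fun ε hε hεR => ?_, fun r hr σ1 σ2 h12 h1 h2 => ?_⟩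
    · have hz : (w:ℂ) + (ε:ℂ) * I ∈ ball (w:ℂ) (2 * ε) := by
        rw [mem_ball, dist_eq_norm, hnorm ε hε]; linarith
      have h1 := ha (2 * ε) (by linarith) _ hz w (mem_ball_self (by linarith))
      have hzH : (w:ℂ) + (ε:ℂ) * I ∈ HB w R := by
        rw [mem_HB, hnorm ε hε]
        exact ⟨by linarith, by simpa using hε⟩
      have h2 := (Complex.abs_im_le_norm _).trans h1
      rw [hnorm ε hε] at h2
      have h3 : (g ((w:ℂ) + (ε:ℂ) * I) - g w - a * ((w:ℂ) + (ε:ℂ) * I - w)).im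
          = ((f τ (w + (ε:ℂ) * I)).im / ε - a) * ε := by
        rw [Complex.sub_im, Complex.sub_im, hg0 w (by simpa using hR), hg.2.2 hzH]
        simp; field_simp
      rw [h3, abs_mul, abs_of_pos hε] at h2
      have := le_of_mul_le_mul_right h2 hε
      linarith
    · have hrR : r < R := by linarith
      refine ⟨(g σ1).re, (g σ2).re,
        (Complex.continuous_re.tendsto _).comp (hg.tendsto (by linarith)),
        (Complex.continuous_re.tendsto _).comp (hg.tendsto (by linarith)), ?_⟩
      have h3 := ha r hr σ2 (real_mem_ball.2 h2) σ1 (real_mem_ball.2 h1)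
      have h4 := (Complex.abs_re_le_norm _).trans h3
      have h5 : 0 < σ2 - σ1 := by linarith
      have e1 : ‖(σ2:ℂ) - σ1‖ = σ2 - σ1 := by
        rw [← Complex.ofReal_sub, Complex.norm_real, Real.norm_eq_abs, abs_of_pos h5]
      have e2 : (g σ2 - g σ1 - a * ((σ2:ℂ) - σ1)).re
          = (((g σ2).re - (g σ1).re) / (σ2 - σ1) - a) * (σ2 - σ1) := by
        rw [sub_mul, div_mul_cancel₀ _ h5.ne', ← Complex.ofReal_sub, ← Complex.ofReal_mul]
        simp only [Complex.sub_re, Complex.ofReal_re]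
      rw [e1, e2, abs_mul, abs_of_pos h5] at h4
      exact le_of_mul_le_mul_right h4 h5
  -- Cauchy
  set P : ℝ → ℝ := fun ε => p ((w : ℂ) + (ε : ℂ) * I) / ε with hPdef
  have hPt : ∀ ε : ℝ, 0 < ε → Tendsto (fun τ => (f τ (w + (ε:ℂ) * I)).im / ε) 𝓕 (𝓝 (P ε)) :=
    fun ε hε => (hp _ (hmem ε hε)).div_const ε
  have hPC : ∀ ε ε' : ℝ, 0 < ε → ε ≤ R / 32 → 0 < ε' → ε' ≤ R / 32 →
      |P ε - P ε'| ≤ 2 * K * ε + 2 * K * ε' := by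
    intro ε ε' h1 h2 h3 h4
    refine le_of_tendsto ((hPt ε h1).sub (hPt ε' h3)).abs ?_
    filter_upwards [hest2] with τ hτ
    obtain ⟨a, ha, -⟩ := hτ
    have e1 := abs_le.1 (ha ε h1 h2)
    have e2 := abs_le.1 (ha ε' h3 h4)
    rw [abs_le]; constructor <;> linarith [e1.1, e1.2, e2.1, e2.2]
  obtain ⟨l, hl⟩ : ∃ l, Tendsto P (𝓝[>] (0:ℝ)) (𝓝 l) := by
    rw [← cauchy_map_iff_exists_tendsto, Metric.cauchy_iff]
    refine ⟨inferInstance, fun η hη => ?_⟩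
    set δ := min (R / 32) (η / (4 * K + 1) / 2) with hδ
    have hδp : 0 < δ := lt_min (by positivity) (by positivity)
    refine ⟨P '' Ioo 0 δ, image_mem_map (Ioo_mem_nhdsGT hδp), ?_⟩
    rintro _ ⟨u, hu, rfl⟩ _ ⟨u', hu', rfl⟩
    rw [Real.dist_eq]
    have h1 : δ ≤ R / 32 := min_le_left _ _
    have h2 : δ ≤ η / (4 * K + 1) / 2 := min_le_right _ _
    have h3 : (4 * K + 1) * δ ≤ η / 2 := by
      calc (4 * K + 1) * δ ≤ (4 * K + 1) * (η / (4 * K + 1) / 2) := by gcongr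
        _ = η / 2 := by field_simp
    refine (hPC u u' hu.1 (hu.2.le.trans h1) hu'.1 (hu'.2.le.trans h1)).trans_lt ?_
    have h4 : K * u ≤ K * δ := by have := hu.2; gcongr
    have h5 : K * u' ≤ K * δ := by have := hu'.2; gcongr
    nlinarith
  have hPl : ∀ ε : ℝ, 0 < ε → ε ≤ R / 32 → |P ε - l| ≤ 2 * K * ε := by
    intro ε h1 h2
    have ht : Tendsto (fun ε' => |P ε - P ε'|) (𝓝[>] (0:ℝ)) (𝓝 |P ε - l|) :=
      (tendsto_const_nhds.sub hl).abs
    have ht2 : Tendsto (fun ε' : ℝ => 2 * K * ε + 2 * K * ε') (𝓝[>] (0:ℝ))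
        (𝓝 (2 * K * ε + 2 * K * 0)) :=
      (Continuous.tendsto (by fun_prop) 0).mono_left nhdsWithin_le_nhds
    have := le_of_tendsto_of_tendsto ht ht2 (by
      filter_upwards [Ioo_mem_nhdsGT (show (0:ℝ) < R / 32 by positivity)] with ε' h'
      exact hPC ε ε' h1 h2 h'.1 h'.2.le)
    simpa using this
  refine ⟨l, K, hK0, hl, fun η hη => ?_⟩
  set ε := min (R / 32) (η / (4 * K + 1) / 2) with hε
  have hεp : 0 < ε := lt_min (by positivity) (by positivity)
  have h1 : ε ≤ R / 32 := min_le_left _ _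
  have h2 : ε ≤ η / (4 * K + 1) / 2 := min_le_right _ _
  have h3 : (4 * K + 1) * ε ≤ η / 2 := by
    calc (4 * K + 1) * ε ≤ (4 * K + 1) * (η / (4 * K + 1) / 2) := by gcongr
      _ = η / 2 := by field_simp
  have hev := (hPt ε hεp) (Metric.ball_mem_nhds _ (half_pos hη))
  filter_upwards [hest2, hev] with τ hτ hτ2 r hr σ1 σ2 h12 hσ1 hσ2
  obtain ⟨a, ha, ha2⟩ := hτ
  obtain ⟨a1, a2, t1, t2, hle⟩ := ha2 r hr σ1 σ2 h12 hσ1 hσ2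
  refine ⟨a1, a2, t1, t2, ?_⟩
  have hτ2 : |(f τ (w + (ε:ℂ) * I)).im / ε - P ε| < η / 2 := by
    have : dist ((f τ (w + (ε:ℂ) * I)).im / ε) (P ε) < η / 2 := hτ2
    rwa [Real.dist_eq] at this
  have e1 := abs_le.1 (ha ε hεp h1)
  have e2 := abs_lt.1 hτ2
  have e3 := abs_le.1 (hPl ε hεp h1)
  have e4 := abs_le.1 hle
  rw [abs_le]; constructor <;> nlinarith [e1.1, e1.2, e2.1, e2.2, e3.1, e3.2, e4.1, e4.2]

lemma Reg.div_const {f g : ℂ → ℂ} {a r : ℝ} (h : Reg f g a r) (k : ℝ) :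
    Reg (fun z => f z / (k:ℂ)) (fun z => g z / (k:ℂ)) a r :=
  ⟨h.1, h.2.1.div_const _, fun z hz => by simp only [h.2.2 hz]⟩

/-- Application of `lemma_D` with uniform radius. -/
lemma BV.unif {N : ℕ} {y : ℕ → ℝ} {j : ℕ} {t s : ℝ} {h : ℂ → ℂ} {c : ℝ} {v : ℕ → ℝ}
    {M : ℝ} (B : BV N y j t s h c v M) {i : ℕ} (hi : 1 ≤ i) (hi' : i ≤ N) (hij : i ≠ j)
    (hv : v i = 0) {w r : ℝ} (hr : 0 < r)
    (hsub : ∀ x : ℝ, |x - w| < r → x ∈ Ioo (y (2 * i - 1)) (y (2 * i))) :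
    (∃ g, Reg (fun z => h z / ((s - t : ℝ) : ℂ)) g w (r / 16) ∧
      ∀ z ∈ ball (w:ℂ) (r / 16), g (conj z) = conj (g z)) ∧
      ∀ z ∈ UHP, 0 ≤ (h z / ((s - t : ℝ) : ℂ)).im := by
  constructor
  · obtain ⟨g, hg, hs⟩ := lemma_D w r M 0 hr h (B.diff.mono HB_subset_UHP) (B.bddHB w r)
      (fun x _ hx => by rw [← hv]; exact B.dir i hi hi' hij x (hsub x hx))
    refine ⟨_, hg.div_const (s - t), fun z hz => ?_⟩
    rw [hs z hz]
    simp
  · intro z hz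
    rw [Complex.div_ofReal_im]
    exact div_nonneg (B.pos z hz) (by linarith [B.hts])

lemma diag_neBot {A C x : ℝ} (hx : x ∈ Ioo A C) :
    (𝓝[{pr : ℝ × ℝ | A < pr.1 ∧ pr.1 < pr.2 ∧ pr.2 < C}] (x, x)).NeBot := by
  have ht : Tendsto (fun ε : ℝ => (x, x + ε)) (𝓝[>] (0:ℝ))
      (𝓝[{pr : ℝ × ℝ | A < pr.1 ∧ pr.1 < pr.2 ∧ pr.2 < C}] (x, x)) := by
    refine tendsto_nhdsWithin_of_tendsto_nhds_of_eventually_within _ ?_ ?_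
    · have : Tendsto (fun ε : ℝ => (x, x + ε)) (𝓝 0) (𝓝 (x, x + 0)) :=
        Continuous.tendsto (by fun_prop) 0
      rw [add_zero] at this
      exact this.mono_left nhdsWithin_le_nhds
    · filter_upwards [Ioo_mem_nhdsGT (show (0:ℝ) < C - x by linarith [hx.2])] with ε hε
      exact ⟨hx.1, by simpa using hε.1, by show x + ε < C; linarith [hε.2]⟩
  exact ht.neBot

/-- Symmetry of the boundary Poisson kernel: the inward normal derivative of `P_ℍ(·, x)` at `w`
and that of `P_ℍ(·, w)` at `x` both exist and are equal. -/
theorem poisson_kernel_symmetry (N : ℕ) (hN : 2 ≤ N) (y : ℕ → ℝ)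
    (hy : ∀ i j : ℕ, 1 ≤ i → i < j → j ≤ 2 * N → y i < y j)
    (w x : ℝ) (hw : w ∈ Set.Ioo (y 1) (y 2)) (hx : x ∈ Set.Ioo (y (2 * N - 1)) (y (2 * N)))
    (H : ℝ → ℝ → ℂ → ℂ)
    (hH : ∀ t s : ℝ, y (2 * N - 1) < t → t < s → s < y (2 * N) → SolvesBVP N y t s (H t s))
    (H' : ℝ → ℝ → ℂ → ℂ)
    (hH' : ∀ t s : ℝ, y 1 < t → t < s → s < y 2 → SolvesBVP' N y t s (H' t s))
    (p q : ℂ → ℝ)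
    (hp : ∀ z ∈ UHP,
      Tendsto (fun pr : ℝ × ℝ => (H pr.1 pr.2 z).im / (pr.2 - pr.1))
        (𝓝[{pr : ℝ × ℝ | y (2 * N - 1) < pr.1 ∧ pr.1 < pr.2 ∧ pr.2 < y (2 * N)}] (x, x))
        (𝓝 (p z)))
    (hq : ∀ z ∈ UHP,
      Tendsto (fun pr : ℝ × ℝ => (H' pr.1 pr.2 z).im / (pr.2 - pr.1))
        (𝓝[{pr : ℝ × ℝ | y 1 < pr.1 ∧ pr.1 < pr.2 ∧ pr.2 < y 2}] (w, w))
        (𝓝 (q z))) :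
    ∃ l : ℝ,
      Tendsto (fun ε : ℝ => p ((w : ℂ) + (ε : ℂ) * Complex.I) / ε) (𝓝[>] (0 : ℝ)) (𝓝 l) ∧
      Tendsto (fun ε : ℝ => q ((x : ℂ) + (ε : ℂ) * Complex.I) / ε) (𝓝[>] (0 : ℝ)) (𝓝 l) := by
  have : (𝓝[{pr : ℝ × ℝ | y (2 * N - 1) < pr.1 ∧ pr.1 < pr.2 ∧ pr.2 < y (2 * N)}] (x, x)).NeBot :=
    diag_neBot hx
  have : (𝓝[{pr : ℝ × ℝ | y 1 < pr.1 ∧ pr.1 < pr.2 ∧ pr.2 < y 2}] (w, w)).NeBot :=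
    diag_neBot hw
  obtain ⟨r, hr, hrw⟩ := exists_radius hw
  obtain ⟨r', hr', hrx⟩ := exists_radius hx
  obtain ⟨l, C, hC, hl, hη⟩ := main_one (w := w) (R := r / 16) (by positivity)
    (f := fun τ : ℝ × ℝ => fun z => H τ.1 τ.2 z / ((τ.2 - τ.1 : ℝ) : ℂ)) (p := p)
    (𝓕 := 𝓝[{pr : ℝ × ℝ | y (2 * N - 1) < pr.1 ∧ pr.1 < pr.2 ∧ pr.2 < y (2 * N)}] (x, x))
    (by
      filter_upwards [self_mem_nhdsWithin] with τ hτ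
      obtain ⟨c, v, M, B⟩ := BV_of_SolvesBVP hN hy hτ.1 hτ.2.1 hτ.2.2 (hH _ _ hτ.1 hτ.2.1 hτ.2.2)
      exact B.unif (i := 1) le_rfl (by omega) (by omega) B.v1 hr (by simpa using hrw))
    (by
      intro z hz
      refine (hp z hz).congr fun τ => ?_
      rw [Complex.div_ofReal_im])
  obtain ⟨l', C', hC', hl', hη'⟩ := main_one (w := x) (R := r' / 16) (by positivity)
    (f := fun τ : ℝ × ℝ => fun z => H' τ.1 τ.2 z / ((τ.2 - τ.1 : ℝ) : ℂ)) (p := q)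
    (𝓕 := 𝓝[{pr : ℝ × ℝ | y 1 < pr.1 ∧ pr.1 < pr.2 ∧ pr.2 < y 2}] (w, w))
    (by
      filter_upwards [self_mem_nhdsWithin] with τ hτ
      obtain ⟨c, v, M, B⟩ := BV_of_SolvesBVP' hN hy hτ.1 hτ.2.1 hτ.2.2 (hH' _ _ hτ.1 hτ.2.1 hτ.2.2)
      exact B.unif (i := N) (by omega) le_rfl (by omega) B.vN hr' hrx)
    (by
      intro z hz
      refine (hq z hz).congr fun τ => ?_
      rw [Complex.div_ofReal_im])
  have hll : l = l' := by
    refine eq_of_abs_sub_le_all fun η hη0 => ?_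
    set κ := min (min (r / 256) (r' / 256)) (η / (C + C' + 1) / 2) with hκ
    have hκp : 0 < κ := lt_min (lt_min (by positivity) (by positivity)) (by positivity)
    have k1 : κ ≤ r / 256 := (min_le_left _ _).trans (min_le_left _ _)
    have k2 : κ ≤ r' / 256 := (min_le_left _ _).trans (min_le_right _ _)
    have k3 : (C + C' + 1) * κ ≤ η / 2 := by
      calc (C + C' + 1) * κ ≤ (C + C' + 1) * (η / (C + C' + 1) / 2) := by
            gcongr; exact min_le_right _ _
        _ = η / 2 := by field_simp
    have near : ∀ (S : Set (ℝ × ℝ)) (u : ℝ), ∀ᶠ τ in 𝓝[S] (u, u), |τ.1 - u| < κ ∧ |τ.2 - u| < κ := by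
      intro S u
      have : ∀ᶠ τ : ℝ × ℝ in 𝓝 (u, u), |τ.1 - u| < κ ∧ |τ.2 - u| < κ := by
        refine Filter.Eventually.and ?_ ?_
        · exact (Continuous.tendsto (f := fun τ : ℝ × ℝ => |τ.1 - u|) (by fun_prop) (u, u))
            (Iio_mem_nhds (by simpa using hκp))
        · exact (Continuous.tendsto (f := fun τ : ℝ × ℝ => |τ.2 - u|) (by fun_prop) (u, u))
            (Iio_mem_nhds (by simpa using hκp))
      exact nhdsWithin_le_nhds this
    obtain ⟨τ, hτ1, hτ2, hτ3⟩ := ((hη (η / 4) (by positivity)).and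
      ((near _ x).and self_mem_nhdsWithin)).exists
    obtain ⟨σ, hσ1, hσ2, hσ3⟩ := ((hη' (η / 4) (by positivity)).and
      ((near _ w).and self_mem_nhdsWithin)).exists
    obtain ⟨c, v, M, B⟩ := BV_of_SolvesBVP hN hy hτ3.1 hτ3.2.1 hτ3.2.2
      (hH _ _ hτ3.1 hτ3.2.1 hτ3.2.2)
    obtain ⟨c', v', M', B'⟩ := BV_of_SolvesBVP' hN hy hσ3.1 hσ3.2.1 hσ3.2.2
      (hH' _ _ hσ3.1 hσ3.2.1 hσ3.2.2)
    obtain ⟨a1, a2, ta1, ta2, ha⟩ := hτ1 κ (by linarith) σ.1 σ.2 hσ3.2.1 hσ2.1 hσ2.2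
    obtain ⟨b1, b2, tb1, tb2, hb⟩ := hσ1 κ (by linarith) τ.1 τ.2 hτ3.2.1 hτ2.1 hτ2.2
    have dτ : 0 < τ.2 - τ.1 := sub_pos.2 hτ3.2.1
    have dσ : 0 < σ.2 - σ.1 := sub_pos.2 hσ3.2.1
    have conv : ∀ {φ : ℂ → ℂ} {k a : ℝ} {l : Filter ℂ}, 0 < k →
        Tendsto (fun z => (φ z / (k : ℂ)).re) l (𝓝 a) → Tendsto (fun z => (φ z).re) l (𝓝 (k * a)) := by
      intro φ k a l hk ht
      refine (ht.const_mul k).congr fun z => ?_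
      rw [Complex.div_ofReal_re]; field_simp
    have G := green B B' (conv dτ ta1) (conv dτ ta2) (conv dσ tb1) (conv dσ tb2)
    have e : (a2 - a1) / (σ.2 - σ.1) = (b2 - b1) / (τ.2 - τ.1) := by
      rw [div_eq_div_iff dσ.ne' dτ.ne']; linarith
    rw [e] at ha
    have h1 := abs_le.1 ha
    have h2 := abs_le.1 hb
    rw [abs_le]; constructor <;> nlinarith [h1.1, h1.2, h2.1, h2.2]
  exact ⟨l, hl, hll ▸ hl'⟩
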